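/- Let δ ∈ (0,1), ε > 0 and c₀ > 0 be fixed. For all X, T ≥ 1, one has #𝒮^{(2)}(X,T) ≪ (XT)^ε · (X^{3/4} + X^{1/4 + δ}T²), with implied constant depending only on δ, ε and c₀. -/

import Mathlib

/-- The set `𝒮(X, T)` of quintuples `(A, B, w, y, q)` with `y² = w³ + Awq⁴ + Bq⁶`, `4|A|³ ≤ X`,
`27B² ≤ X`, `|w| ≤ c₀ T² X^δ`, `q² ≤ c₀ T² X^δ`, `y ≥ 1`, `q ≥ 1` and `gcd(w, q) = 1`. -/
def Sset (c₀ δ X T : ℝ) : Set (ℤ × ℤ × ℤ × ℤ × ℤ) :=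
  {t | t.2.2.2.1 ≥ 1 ∧ t.2.2.2.2 ≥ 1 ∧
    t.2.2.2.1 ^ 2 = t.2.2.1 ^ 3 + t.1 * t.2.2.1 * t.2.2.2.2 ^ 4 + t.2.1 * t.2.2.2.2 ^ 6 ∧
    (4 * |t.1| ^ 3 : ℝ) ≤ X ∧ (27 * t.2.1 ^ 2 : ℝ) ≤ X ∧
    (|t.2.2.1| : ℝ) ≤ c₀ * T ^ 2 * X ^ δ ∧ ((t.2.2.2.2 : ℝ)) ^ 2 ≤ c₀ * T ^ 2 * X ^ δ ∧
    Int.gcd t.2.2.1 t.2.2.2.2 = 1}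

/-- The subset `𝒮^{(1)}(X, T)` where moreover `|w| > X^{1/6} q²`. -/
def Sset1 (c₀ δ X T : ℝ) : Set (ℤ × ℤ × ℤ × ℤ × ℤ) :=
  {t ∈ Sset c₀ δ X T | X ^ ((1 : ℝ) / 6) * (t.2.2.2.2 : ℝ) ^ 2 < (|t.2.2.1| : ℝ)}

/-- The subset `𝒮^{(2)}(X, T) = 𝒮(X, T) ∖ 𝒮^{(1)}(X, T)`. -/
def Sset2 (c₀ δ X T : ℝ) : Set (ℤ × ℤ × ℤ × ℤ × ℤ) := Sset c₀ δ X T \ Sset1 c₀ δ X T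

theorem exists_card_divisors_le_rpow (ε : ℝ) (hε : 0 < ε) :
    ∃ C : ℝ, 1 ≤ C ∧ ∀ n : ℕ, n ≠ 0 → (n.divisors.card : ℝ) ≤ C * (n : ℝ) ^ ε := by
  have hl2 : 0 < Real.log 2 := Real.log_pos (by norm_num)
  set K : ℝ := max 1 (1 / (ε * Real.log 2)) with hK
  have hK1 : 1 ≤ K := le_max_left _ _
  obtain ⟨P, hP⟩ := exists_nat_gt ((2 : ℝ) ^ (1 / ε))
  refine ⟨K ^ P, one_le_pow₀ hK1, fun n hn => ?_⟩
  have key : ∀ p ∈ n.primeFactors, ((n.factorization p : ℝ) + 1) ≤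
      (if p < P then K else 1) * ((p : ℝ) ^ (n.factorization p)) ^ ε := by
    intro p hp
    have hp2 : (2 : ℝ) ≤ p := by exact_mod_cast (Nat.prime_of_mem_primeFactors hp).two_le
    set a := n.factorization p
    have hpa : ((p : ℝ) ^ a) ^ ε = ((p : ℝ) ^ ε) ^ a := by
      rw [← Real.rpow_natCast, ← Real.rpow_mul (by positivity), mul_comm,
        Real.rpow_mul (by positivity),
        Real.rpow_natCast]
    rw [hpa]
    split_ifs with h
    · have h1 : (1 + ε * Real.log 2 * a) ≤ ((p : ℝ) ^ ε) ^ a := by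
        calc (1 + ε * Real.log 2 * a) ≤ Real.exp (ε * Real.log 2 * a) := by
              linarith [Real.add_one_le_exp (ε * Real.log 2 * a)]
          _ = ((2 : ℝ) ^ ε) ^ a := by
              rw [Real.rpow_def_of_pos (by norm_num), ← Real.exp_nat_mul]; ring_nf
          _ ≤ _ := by gcongr
      have h2 : 1 ≤ K * (ε * Real.log 2) := by
        have : 1 / (ε * Real.log 2) ≤ K := le_max_right _ _
        rwa [div_le_iff₀ (by positivity)] at this
      calc (a : ℝ) + 1 ≤ a * (K * (ε * Real.log 2)) + K := by
            have : (a : ℝ) * 1 ≤ a * (K * (ε * Real.log 2)) := by gcongr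
            linarith
        _ = K * (1 + ε * Real.log 2 * a) := by ring
        _ ≤ _ := by gcongr
    · have h3 : (2 : ℝ) ≤ (p : ℝ) ^ ε := by
        have : (2 : ℝ) ^ (1 / ε) ≤ p := hP.le.trans (by exact_mod_cast not_lt.mp h)
        calc (2 : ℝ) = ((2 : ℝ) ^ (1 / ε)) ^ ε := by
              rw [← Real.rpow_mul (by norm_num)]; field_simp; simp
          _ ≤ _ := by gcongr
      calc (a : ℝ) + 1 ≤ 2 ^ a := by exact_mod_cast Nat.lt_two_pow_self
        _ ≤ ((p : ℝ) ^ ε) ^ a := by gcongr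
        _ = _ := by ring
  rw [Nat.card_divisors hn]
  push_cast
  calc ∏ p ∈ n.primeFactors, ((n.factorization p : ℝ) + 1)
      ≤ ∏ p ∈ n.primeFactors, (if p < P then K else 1) * ((p : ℝ) ^ (n.factorization p)) ^ ε :=
        Finset.prod_le_prod (fun _ _ => by positivity) key
    _ = (∏ p ∈ n.primeFactors, (if p < P then K else 1)) * (n : ℝ) ^ ε := by
        rw [Finset.prod_mul_distrib, Real.finsetProd_rpow _ _ (fun _ _ => by positivity)]
        congr 2
        conv_rhs => rw [← Nat.prod_factorization_pow_eq_self hn]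
        rw [Finsupp.prod]
        push_cast
        rfl
    _ ≤ _ := by
        gcongr
        rw [Finset.prod_ite, Finset.prod_const, Finset.prod_const_one, mul_one]
        refine pow_le_pow_right₀ hK1 ?_
        calc _ ≤ (Finset.range P).card := Finset.card_le_card (fun p hp => by
              simp only [Finset.mem_filter] at hp; simpa using hp.2)
          _ = P := by simp

/-- Elements of a residue-type congruence `y² ≡ c` with `y` a unit: counting in an interval. -/
theorem card_le_of_sq_congr (m : ℕ) (hm : m ≠ 0) (c Y : ℤ) (hY : 0 ≤ Y) (S : Finset ℤ)
    (h : ∀ y ∈ S, 1 ≤ y ∧ y ≤ Y ∧ (m : ℤ) ∣ y ^ 2 - c ∧ IsCoprime y m) :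
    (S.card : ℝ) ≤ m.divisors.card * (2 * Y / m + 1) := by
  rcases S.eq_empty_or_nonempty with rfl | ⟨y₀, hy₀⟩
  · simp only [Finset.card_empty, Nat.cast_zero]
    have : (0 : ℝ) ≤ Y := by exact_mod_cast hY
    positivity
  have hm0 : (0 : ℤ) < m := by exact_mod_cast Nat.pos_of_ne_zero hm
  obtain ⟨-, -, h0c, h0m⟩ := h y₀ hy₀
  have hcard : S.card ≤ (m.divisors ×ˢ Finset.Icc (0 : ℤ) (2 * Y / m)).card := by
    refine Finset.card_le_card_of_injOn
      (fun y => (Int.gcd (y - y₀) m, 2 * y / m)) ?_ ?_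
    · intro y hy
      obtain ⟨h1, h2, -, -⟩ := h y hy
      simp only [Finset.coe_product, Set.mem_prod, Finset.mem_coe, Nat.mem_divisors, Finset.mem_Icc]
      refine ⟨⟨?_, hm⟩, Int.ediv_nonneg (by linarith) hm0.le,
        Int.ediv_le_ediv hm0 (by linarith)⟩
      exact_mod_cast Int.gcd_dvd_right (y - y₀) (m : ℤ)
    · intro y hy y' hy' heq
      simp only [Prod.mk.injEq] at heq
      obtain ⟨hg, hf⟩ := heq
      obtain ⟨-, -, hyc, -⟩ := h y hy
      obtain ⟨-, -, hyc', -⟩ := h y' hy'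
      have main : ∀ z : ℤ, (m : ℤ) ∣ z ^ 2 - c →
          ∃ e : ℤ, (m : ℤ) = Int.gcd (z - y₀) m * e ∧ e ∣ z + y₀ := by
        intro z hz
        obtain ⟨e, he⟩ := Int.gcd_dvd_right (z - y₀) (m : ℤ)
        refine ⟨e, he, ?_⟩
        set d := Int.gcd (z - y₀) m with hd
        have hd0 : (d : ℤ) ≠ 0 := by
          intro h0; rw [h0] at he; simp at he; omega
        obtain ⟨r, hr⟩ := Int.gcd_dvd_left (z - y₀) (m : ℤ)
        rw [← hd] at hr
        have hcop : IsCoprime r e := by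
          have := Int.gcd_eq_gcd_ab (z - y₀) (m : ℤ)
          rw [← hd] at this
          refine ⟨Int.gcdA (z - y₀) m, Int.gcdB (z - y₀) m, ?_⟩
          apply mul_left_cancel₀ hd0
          linear_combination (-Int.gcdA (z - y₀) m) * hr - (Int.gcdB (z - y₀) m) * he - this
        have hdvd : (d : ℤ) * e ∣ d * (r * (z + y₀)) := by
          rw [← he]
          have h3 := dvd_sub hz h0c
          have h4 : z ^ 2 - c - (y₀ ^ 2 - c) = d * (r * (z + y₀)) := by
            linear_combination (z + y₀) * hr
          rwa [h4] at h3
        exact hcop.symm.dvd_of_dvd_mul_left (Int.dvd_of_mul_dvd_mul_left hd0 hdvd)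
      obtain ⟨e, he, hez⟩ := main y hyc
      obtain ⟨e', he', hez'⟩ := main y' hyc'
      rw [← hg] at he'
      have hdy := Int.gcd_dvd_left (y - y₀) (m : ℤ)
      have hdy' := Int.gcd_dvd_left (y' - y₀) (m : ℤ)
      have hdm := Int.gcd_dvd_right (y - y₀) (m : ℤ)
      rw [← hg] at hdy'
      set d := Int.gcd (y - y₀) m with hd
      have hd0 : (d : ℤ) ≠ 0 := by
        intro h0; rw [h0] at he; simp at he; omega
      have hee : e = e' := mul_left_cancel₀ hd0 (he.symm.trans he')
      subst hee
      have hdd : (d : ℤ) ∣ y - y' := by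
        have := dvd_sub hdy hdy'; simpa using this
      have hed : e ∣ y - y' := by
        have := dvd_sub hez hez'; simpa using this
      have h2 : (m : ℤ) ∣ 2 * (y - y') := by
        -- a common divisor of `d` and `e` divides `2 y₀` and `m`
        have hlin : ∃ a b : ℤ, a * d + b * e = 2 := by
          have hgd : ((Int.gcd d e : ℕ) : ℤ) ∣ 2 := by
            have h5 : ((Int.gcd d e : ℕ) : ℤ) ∣ 2 * y₀ := by
              have h6 := dvd_sub ((Int.gcd_dvd_right (d : ℤ) e).trans hez)
                ((Int.gcd_dvd_left (d : ℤ) e).trans hdy)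
              have : y + y₀ - (y - y₀) = 2 * y₀ := by ring
              rwa [this] at h6
            have h7 : IsCoprime ((Int.gcd d e : ℕ) : ℤ) y₀ :=
              (IsCoprime.of_isCoprime_of_dvd_right h0m
                ((Int.gcd_dvd_left (d : ℤ) e).trans hdm)).symm
            exact h7.dvd_of_dvd_mul_right h5
          obtain ⟨s, hs⟩ := hgd
          refine ⟨Int.gcdA d e * s, Int.gcdB d e * s, ?_⟩
          have := Int.gcd_eq_gcd_ab (d : ℤ) e
          linear_combination (-s) * this - hs
        obtain ⟨a, b, hab⟩ := hlin
        rw [← hab, add_mul, he]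
        obtain ⟨r, hr⟩ := hed
        obtain ⟨s, hs⟩ := hdd
        refine ⟨a * r + b * s, ?_⟩
        linear_combination (a * d) * hr + (b * e) * hs
      obtain ⟨j, hj⟩ := h2
      have e1 := Int.mul_ediv_add_emod (2 * y) m
      have e2 := Int.mul_ediv_add_emod (2 * y') m
      have r1 := Int.emod_nonneg (2 * y) hm0.ne'
      have r2 := Int.emod_nonneg (2 * y') hm0.ne'
      have r3 := Int.emod_lt_of_pos (2 * y) hm0
      have r4 := Int.emod_lt_of_pos (2 * y') hm0
      rw [hf] at e1
      have hj1 : (m : ℤ) * j < m * 1 := by rw [← hj]; linarith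
      have hj2 : (m : ℤ) * (-1) < m * j := by rw [← hj]; linarith
      have hj3 := lt_of_mul_lt_mul_left hj1 hm0.le
      have hj4 := lt_of_mul_lt_mul_left hj2 hm0.le
      have : j = 0 := by omega
      subst this
      linarith
  have hq0 : 0 ≤ 2 * Y / (m : ℤ) := Int.ediv_nonneg (by linarith) hm0.le
  calc (S.card : ℝ) ≤ ((m.divisors ×ˢ Finset.Icc (0 : ℤ) (2 * Y / m)).card : ℕ) := by
        exact_mod_cast hcard
    _ = m.divisors.card * (((2 * Y / (m : ℤ) : ℤ) : ℝ) + 1) := by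
        rw [Finset.card_product, Int.card_Icc]
        push_cast
        have : (((2 * Y / (m : ℤ) + 1 - 0).toNat : ℤ) : ℝ) = ((2 * Y / (m : ℤ) + 1 : ℤ) : ℝ) := by
          rw [Int.toNat_of_nonneg (by linarith)]; simp
        rw [← Int.cast_natCast (R := ℝ) (Int.toNat _), this]
        push_cast; ring
    _ ≤ _ := by
        gcongr
        have : ((2 * Y / (m : ℤ) : ℤ) : ℝ) ≤ ((2 * Y : ℤ) : ℝ) / ((m : ℤ) : ℝ) := by
          rw [le_div_iff₀ (by exact_mod_cast hm0)]
          exact_mod_cast Int.ediv_mul_le _ hm0.ne'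
        simpa using this

theorem card_le_sum_card_fiber {α β : Type*} [DecidableEq β] (S : Finset α) (T : Finset β)
    (f : α → β) (hf : ∀ a ∈ S, f a ∈ T) (g : β → ℝ)
    (h : ∀ b ∈ T, ((S.filter (fun a => f a = b)).card : ℝ) ≤ g b) :
    (S.card : ℝ) ≤ ∑ b ∈ T, g b := by
  rw [Finset.card_eq_sum_card_fiberwise (t := T) (f := f) hf]
  push_cast
  exact Finset.sum_le_sum h

theorem card_le_mul_of_fiber {α β : Type*} [DecidableEq β] (S : Finset α)
    (f : α → β) (M N : ℝ) (hN : 0 ≤ N) (hM : ((S.image f).card : ℝ) ≤ M)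
    (h : ∀ b ∈ S.image f, ((S.filter (fun a => f a = b)).card : ℝ) ≤ N) :
    (S.card : ℝ) ≤ M * N := by
  refine (card_le_sum_card_fiber S (S.image f) f (fun a ha => Finset.mem_image_of_mem f ha)
    (fun _ => N) h).trans ?_
  rw [Finset.sum_const, nsmul_eq_mul]
  gcongr

theorem card_le_of_congr (m : ℤ) (hm : 0 < m) (N : ℝ) (hN : 0 ≤ N) (S : Finset ℤ)
    (h1 : ∀ x ∈ S, |(x : ℝ)| ≤ N) (h2 : ∀ x ∈ S, ∀ y ∈ S, m ∣ x - y) :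
    (S.card : ℝ) ≤ 2 * N / m + 1 := by
  have hm' : (0 : ℝ) < m := by exact_mod_cast hm
  rcases S.eq_empty_or_nonempty with rfl | hne
  · simp only [Finset.card_empty, Nat.cast_zero]
    positivity
  set x₀ := S.min' hne
  have hx₀ : x₀ ∈ S := S.min'_mem hne
  have hfl : 0 ≤ ⌊2 * N / m⌋ := Int.floor_nonneg.mpr (by positivity)
  have hcard : S.card ≤ (Finset.Icc (0 : ℤ) ⌊2 * N / m⌋).card := by
    refine Finset.card_le_card_of_injOn (fun x => (x - x₀) / m) ?_ ?_
    · intro x hx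
      have hle : x₀ ≤ x := S.min'_le x hx
      simp only [Finset.coe_Icc, Set.mem_Icc]
      refine ⟨Int.ediv_nonneg (by linarith) hm.le, ?_⟩
      rw [Int.le_floor, le_div_iff₀ hm']
      have e1 : (x - x₀) / m * m ≤ x - x₀ := Int.ediv_mul_le _ hm.ne'
      have e2 : (((x - x₀) / m * m : ℤ) : ℝ) ≤ ((x - x₀ : ℤ) : ℝ) := by exact_mod_cast e1
      push_cast at e2
      have := abs_le.mp (h1 x hx)
      have := abs_le.mp (h1 x₀ hx₀)
      linarith
    · intro x hx y hy hxy
      have e1 := Int.ediv_mul_cancel (h2 x hx x₀ hx₀)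
      have e2 := Int.ediv_mul_cancel (h2 y hy x₀ hx₀)
      simp only at hxy
      rw [hxy] at e1
      linarith
  calc (S.card : ℝ) ≤ ((Finset.Icc (0 : ℤ) ⌊2 * N / m⌋).card : ℝ) := by exact_mod_cast hcard
    _ = ⌊2 * N / m⌋ + 1 := by
      rw [Int.card_Icc]
      rw [← Int.cast_natCast (R := ℝ) (Int.toNat _), Int.toNat_of_nonneg (by linarith)]
      push_cast; ring
    _ ≤ _ := by gcongr; exact Int.floor_le _

theorem card_le_of_abs_le (N : ℝ) (hN : 0 ≤ N) (S : Finset ℤ)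
    (h1 : ∀ x ∈ S, |(x : ℝ)| ≤ N) : (S.card : ℝ) ≤ 2 * N + 1 := by
  simpa using card_le_of_congr 1 one_pos N hN S h1 (fun x _ y _ => one_dvd _)

/-- Coordinates of a point `(w / q², y / q³)` in lowest terms on `Y² = X³ + AX + B`, where the
sizes of `A`, `B` and `w / q²` are controlled by `k`. -/
structure IsPt (k q A B w y : ℤ) : Prop where
  k_pos : 1 ≤ k
  q_pos : 1 ≤ q
  y_pos : 1 ≤ y
  abs_A : |A| ≤ k ^ 4
  abs_B : |B| ≤ k ^ 6
  abs_w : |w| ≤ k ^ 2 * q ^ 2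
  coprime : IsCoprime w q
  eqn : y ^ 2 = w ^ 3 + A * w * q ^ 4 + B * q ^ 6

namespace IsPt

variable {k q A B w y : ℤ}

theorem y_le (h : IsPt k q A B w y) : y ≤ 2 * k ^ 3 * q ^ 3 := by
  have hk := h.k_pos
  have hq := h.q_pos
  refine le_of_sq_le_sq ?_ (by positivity) |> fun h => h
  have hw : |w ^ 3| ≤ (k ^ 2 * q ^ 2) ^ 3 := by
    rw [abs_pow]; exact pow_le_pow_left₀ (abs_nonneg _) h.abs_w 3
  have hA : |A * w * q ^ 4| ≤ k ^ 4 * (k ^ 2 * q ^ 2) * q ^ 4 := by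
    rw [abs_mul, abs_mul, abs_of_nonneg (by positivity : 0 ≤ q ^ 4)]
    gcongr
    · exact h.abs_A
    · exact h.abs_w
  have hB : |B * q ^ 6| ≤ k ^ 6 * q ^ 6 := by
    rw [abs_mul, abs_of_nonneg (by positivity : 0 ≤ q ^ 6)]
    gcongr
    exact h.abs_B
  have h0 : 0 ≤ k ^ 6 * q ^ 6 := by positivity
  have := (abs_le.mp hw).2
  have := (abs_le.mp hA).2
  have := (abs_le.mp hB).2
  rw [h.eqn]
  nlinarith

theorem coprime_y (h : IsPt k q A B w y) : IsCoprime y q := by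
  have h1 : IsCoprime (w ^ 3) q := h.coprime.pow_left
  have h2 : IsCoprime (y ^ 2) q := by
    rw [h.eqn]
    have : w ^ 3 + A * w * q ^ 4 + B * q ^ 6 = w ^ 3 + q * (A * w * q ^ 3 + B * q ^ 5) := by ring
    rw [this]
    exact h1.add_mul_left_left _
  exact (IsCoprime.pow_left_iff (by norm_num)).mp h2

theorem A_congr {A' B' : ℤ} (h : IsPt k q A B w y) (h' : IsPt k q A' B' w y) :
    q ^ 2 ∣ A - A' := by
  have hq := h.q_pos
  have h1 : w * (A - A') = q ^ 2 * (B' - B) := by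
    have h0 : q ^ 4 ≠ 0 := by positivity
    apply mul_left_cancel₀ h0
    linear_combination h'.eqn - h.eqn
  have h2 : IsCoprime (q ^ 2) w := h.coprime.symm.pow_left
  exact h2.dvd_of_dvd_mul_left ⟨_, h1⟩

theorem B_eq {B' : ℤ} (h : IsPt k q A B w y) (h' : IsPt k q A B' w y) : B = B' := by
  have hq := h.q_pos
  have h0 : q ^ 6 ≠ 0 := by positivity
  apply mul_right_cancel₀ h0
  linear_combination h'.eqn - h.eqn

end IsPt

theorem card_isPt_le (k q : ℤ) (hk : 1 ≤ k) (hq : 1 ≤ q) (W : ℝ) (hW : 0 ≤ W)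
    (S : Finset (ℤ × ℤ × ℤ × ℤ))
    (hS : ∀ t ∈ S, IsPt k q t.1 t.2.1 t.2.2.1 t.2.2.2 ∧ |(t.2.2.1 : ℝ)| ≤ W) :
    (S.card : ℝ) ≤ (2 * W + 1) * (((q.toNat ^ 4).divisors.card * (4 * k ^ 3 / q + 1)) *
      (2 * k ^ 4 / q ^ 2 + 1)) := by
  have hk' : (1 : ℝ) ≤ k := by exact_mod_cast hk
  have hq' : (1 : ℝ) ≤ q := by exact_mod_cast hq
  have hqn : ((q.toNat : ℕ) : ℤ) = q := Int.toNat_of_nonneg (by linarith)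
  have hqn' : ((q.toNat : ℕ) : ℝ) = q := by exact_mod_cast congrArg (Int.cast (R := ℝ)) hqn
  refine card_le_mul_of_fiber S (fun t => t.2.2.1) _ _ (by positivity) ?_ ?_
  · refine card_le_of_abs_le W hW _ fun x hx => ?_
    obtain ⟨t, ht, rfl⟩ := Finset.mem_image.mp hx
    exact (hS t ht).2
  · intro w _
    refine card_le_mul_of_fiber _ (fun t => t.2.2.2) _ _ (by positivity) ?_ ?_
    · have := card_le_of_sq_congr (q.toNat ^ 4) (pow_ne_zero 4 (by omega)) (w ^ 3)
        (2 * k ^ 3 * q ^ 3)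
        (by positivity) ((S.filter (fun t => t.2.2.1 = w)).image (fun t => t.2.2.2)) ?_
      · refine this.trans (le_of_eq ?_)
        push_cast
        rw [hqn']
        field_simp
        norm_num
        left; ring
      · intro y hy
        obtain ⟨t, ht, rfl⟩ := Finset.mem_image.mp hy
        obtain ⟨ht₁, rfl⟩ := Finset.mem_filter.mp ht
        have h := (hS t ht₁).1
        push_cast
        rw [hqn]
        refine ⟨h.y_pos, h.y_le, ⟨t.1 * t.2.2.1 + t.2.1 * q ^ 2, ?_⟩, h.coprime_y.pow_right⟩
        rw [h.eqn]; ring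
    · intro y _
      set S' := (S.filter (fun t => t.2.2.1 = w)).filter (fun t => t.2.2.2 = y) with hS'
      have hmem : ∀ t ∈ S', IsPt k q t.1 t.2.1 w y := by
        intro t ht
        simp only [hS', Finset.mem_filter] at ht
        obtain ⟨⟨ht, rfl⟩, rfl⟩ := ht
        exact (hS t ht).1
      have hmem' : ∀ t ∈ S', t.2.2.1 = w ∧ t.2.2.2 = y := by
        intro t ht
        simp only [hS', Finset.mem_filter] at ht
        exact ⟨ht.1.2, ht.2⟩
      rw [← Finset.card_image_of_injOn (f := fun t => t.1) (s := S')]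
      · have := card_le_of_congr (q ^ 2) (by positivity) (k ^ 4) (by positivity)
          (S'.image (fun t => t.1)) ?_ ?_
        · push_cast at this
          exact this
        · intro x hx
          obtain ⟨t, ht, rfl⟩ := Finset.mem_image.mp hx
          exact_mod_cast (hmem t ht).abs_A
        · intro x hx x' hx'
          obtain ⟨t, ht, rfl⟩ := Finset.mem_image.mp hx
          obtain ⟨t', ht', rfl⟩ := Finset.mem_image.mp hx'
          exact (hmem t ht).A_congr (hmem t' ht')
      · rintro ⟨A, B, w₁, y₁⟩ ht ⟨A', B', w₂, y₂⟩ ht' hAA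
        obtain ⟨h1, h2⟩ := hmem' _ ht
        obtain ⟨h3, h4⟩ := hmem' _ ht'
        simp only at hAA h1 h2 h3 h4
        have hB := (hmem _ ht).B_eq (hAA ▸ hmem _ ht')
        rw [Prod.mk.injEq, Prod.mk.injEq, Prod.mk.injEq]
        exact ⟨hAA, hB, h1.trans h3.symm, h2.trans h4.symm⟩

/-- Gauss reduction of the lattice spanned by `(u, 1)` and `(-Q, 0)` for the form
`v² + K² z²`. -/
theorem exists_reduced_basis (K Q u : ℤ) :
    ∃ v₁ z₁ v₂ z₂ t₁ t₂ : ℤ, v₁ = u * z₁ + Q * t₁ ∧ v₂ = u * z₂ + Q * t₂ ∧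
      t₁ * z₂ - t₂ * z₁ = 1 ∧ v₁ ^ 2 + K ^ 2 * z₁ ^ 2 ≤ v₂ ^ 2 + K ^ 2 * z₂ ^ 2 ∧
      3 * ((v₁ ^ 2 + K ^ 2 * z₁ ^ 2) * (v₂ ^ 2 + K ^ 2 * z₂ ^ 2)) ≤ 4 * (K ^ 2 * Q ^ 2) := by
  let N : ℤ → ℤ → ℤ := fun t z => (u * z + Q * t) ^ 2 + K ^ 2 * z ^ 2
  have hN : ∀ t z, 0 ≤ N t z := fun t z => by positivity
  let P : ℕ → Prop := fun n => ∃ t₁ z₁ t₂ z₂ : ℤ, t₁ * z₂ - t₂ * z₁ = 1 ∧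
    N t₁ z₁ + N t₂ z₂ = n
  have hP : ∃ n, P n := by
    refine ⟨(N 0 1 + N (-1) 0).toNat, 0, 1, -1, 0, by norm_num, ?_⟩
    rw [Int.toNat_of_nonneg (add_nonneg (hN _ _) (hN _ _))]
  classical
  obtain ⟨t₁, z₁, t₂, z₂, hdet, hn⟩ := Nat.find_spec hP
  have hmin : ∀ a b c d : ℤ, a * d - c * b = 1 → N t₁ z₁ + N t₂ z₂ ≤ N a b + N c d := by
    intro a b c d h
    rw [hn]
    have h1 : P (N a b + N c d).toNat :=
      ⟨a, b, c, d, h, (Int.toNat_of_nonneg (add_nonneg (hN _ _) (hN _ _))).symm⟩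
    have h2 := Nat.find_min' hP h1
    have h3 := Int.toNat_of_nonneg (add_nonneg (hN a b) (hN c d))
    omega
  have m1 := hmin t₁ z₁ (t₂ + t₁) (z₂ + z₁) (by linear_combination hdet)
  have m2 := hmin t₁ z₁ (t₂ - t₁) (z₂ - z₁) (by linear_combination hdet)
  have m3 := hmin (t₁ + t₂) (z₁ + z₂) t₂ z₂ (by linear_combination hdet)
  have m4 := hmin (t₁ - t₂) (z₁ - z₂) t₂ z₂ (by linear_combination hdet)
  set s : ℤ := (u * z₁ + Q * t₁) * (u * z₂ + Q * t₂) + K ^ 2 * z₁ * z₂ with hs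
  have e1 : N (t₂ + t₁) (z₂ + z₁) = N t₂ z₂ + 2 * s + N t₁ z₁ := by simp only [N, hs]; ring
  have e2 : N (t₂ - t₁) (z₂ - z₁) = N t₂ z₂ - 2 * s + N t₁ z₁ := by simp only [N, hs]; ring
  have e3 : N (t₁ + t₂) (z₁ + z₂) = N t₂ z₂ + 2 * s + N t₁ z₁ := by simp only [N, hs]; ring
  have e4 : N (t₁ - t₂) (z₁ - z₂) = N t₂ z₂ - 2 * s + N t₁ z₁ := by simp only [N, hs]; ring
  rw [e1] at m1; rw [e2] at m2; rw [e3] at m3; rw [e4] at m4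
  have a1 : |2 * s| ≤ N t₁ z₁ := abs_le.mpr ⟨by linarith, by linarith⟩
  have a2 : |2 * s| ≤ N t₂ z₂ := abs_le.mpr ⟨by linarith, by linarith⟩
  have a3 : |2 * s| * |2 * s| ≤ N t₁ z₁ * N t₂ z₂ :=
    mul_le_mul a1 a2 (abs_nonneg _) (hN _ _)
  rw [abs_mul_abs_self] at a3
  have lag : N t₁ z₁ * N t₂ z₂ = s ^ 2 + K ^ 2 * Q ^ 2 := by
    have : N t₁ z₁ * N t₂ z₂ = s ^ 2 + K ^ 2 * Q ^ 2 * (t₁ * z₂ - t₂ * z₁) ^ 2 := by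
      simp only [N, hs]; ring
    rw [this, hdet]; ring
  have hb : 3 * (N t₁ z₁ * N t₂ z₂) ≤ 4 * (K ^ 2 * Q ^ 2) := by nlinarith
  rcases le_total (N t₁ z₁) (N t₂ z₂) with h | h
  · exact ⟨_, z₁, _, z₂, t₁, t₂, rfl, rfl, hdet, h, hb⟩
  · refine ⟨_, z₂, _, -z₁, t₂, -t₁, rfl, rfl, by linear_combination hdet, ?_, ?_⟩
    · simp only [N] at h
      linear_combination h
    · simp only [N] at hb
      linear_combination hb

theorem IsPt.exists_root {k q A B w y : ℤ} (h : IsPt k q A B w y) :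
    ∃ u c d e : ℤ, q ^ 2 * c = 6 * u ^ 2 - 6 * w ∧ q ^ 4 * d = 4 * u ^ 3 - 12 * w * u + 8 * y ∧
      q ^ 6 * e = u ^ 4 - 6 * w * u ^ 2 + 8 * y * u - 4 * A * q ^ 4 - 3 * w ^ 2 ∧
      q ^ 2 ∣ u ^ 2 - w := by
  have hq := h.q_pos
  have hcop : IsCoprime w (q ^ 4) := h.coprime.pow_right
  obtain ⟨r, s, hrs⟩ := hcop
  set u := r * y with hu
  have h1 : u * w - y = q ^ 4 * (-s * y) := by rw [hu]; linear_combination y * hrs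
  have hcw : IsCoprime (q ^ 4) (w ^ 2) := h.coprime.symm.pow
  have h2 : q ^ 4 ∣ u ^ 2 - w := by
    refine hcw.dvd_of_dvd_mul_left
      ⟨(-s * y) * (u * w + y) + (A * w + B * q ^ 2), ?_⟩
    linear_combination (u * w + y) * h1 + h.eqn
  obtain ⟨a, ha⟩ := h2
  have h3 : ∃ b, u ^ 3 - y = q ^ 4 * b := ⟨u * a + (-s * y), by
    linear_combination u * ha + h1⟩
  obtain ⟨b, hb⟩ := h3
  have hcu : IsCoprime (q ^ 2) (u ^ 2) := by
    have hyq : IsCoprime y q := h.coprime_y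
    have hq4 : IsCoprime y (q ^ 4) := hyq.pow_right
    have : IsCoprime (u * w) (q ^ 4) := by
      have e : u * w = y + q ^ 4 * (-s * y) := by linear_combination h1
      rw [e]
      exact hq4.add_mul_left_left _
    have h5 : IsCoprime u (q ^ 4) := this.of_mul_left_left
    have h6 : IsCoprime u q := (IsCoprime.pow_right_iff (by norm_num)).mp h5
    exact h6.symm.pow
  have h4 : q ^ 2 ∣ A - 3 * u ^ 2 * a + 2 * u * b := by
    have hw : w = u ^ 2 - q ^ 4 * a := by linear_combination -ha
    have hy : y = u ^ 3 - q ^ 4 * b := by linear_combination -hb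
    have he := h.eqn
    rw [hw, hy] at he
    refine hcu.dvd_of_dvd_mul_left ⟨q ^ 2 * b ^ 2 + A * q ^ 2 * a - B - 3 * u ^ 2 * a ^ 2 * q ^ 2
      + a ^ 3 * q ^ 6, ?_⟩
    have h0 : q ^ 4 ≠ 0 := by positivity
    apply mul_left_cancel₀ h0
    linear_combination -he
  obtain ⟨g, hg⟩ := h4
  refine ⟨u, 6 * q ^ 2 * a, 12 * u * a - 8 * b, -4 * g - 3 * q ^ 2 * a ^ 2, ?_, ?_, ?_, ?_⟩
  · linear_combination -6 * ha
  · linear_combination (-12 * u) * ha + 8 * hb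
  · have hw : w = u ^ 2 - q ^ 4 * a := by linear_combination -ha
    have hy : y = u ^ 3 - q ^ 4 * b := by linear_combination -hb
    rw [hw, hy]
    linear_combination (4 * q ^ 4) * hg
  · exact ⟨q ^ 2 * a, by linear_combination ha⟩

section Coefficients

variable {R : Type*} [CommRing R]

/-- The coefficient of `X⁴` in `F(X v₁ + Y v₂, X z₁ + Y z₂)`, where
`F(t, z) = t⁴ + p₂ t² z² + p₃ t z³ + p₄ z⁴`. -/
def qCoeff₀ (p₂ p₃ p₄ v₁ z₁ : R) : R :=
  v₁ ^ 4 + p₂ * v₁ ^ 2 * z₁ ^ 2 + p₃ * v₁ * z₁ ^ 3 + p₄ * z₁ ^ 4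

/-- The coefficient of `X³Y` in `F(X v₁ + Y v₂, X z₁ + Y z₂)`. -/
def qCoeff₁ (p₂ p₃ p₄ v₁ z₁ v₂ z₂ : R) : R :=
  4 * v₁ ^ 3 * v₂ + p₂ * (2 * v₁ * v₂ * z₁ ^ 2 + 2 * v₁ ^ 2 * z₁ * z₂) +
    p₃ * (v₂ * z₁ ^ 3 + 3 * v₁ * z₁ ^ 2 * z₂) + p₄ * (4 * z₁ ^ 3 * z₂)

/-- The coefficient of `X²Y²` in `F(X v₁ + Y v₂, X z₁ + Y z₂)`. -/
def qCoeff₂ (p₂ p₃ p₄ v₁ z₁ v₂ z₂ : R) : R :=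
  6 * v₁ ^ 2 * v₂ ^ 2 + p₂ * (v₁ ^ 2 * z₂ ^ 2 + 4 * v₁ * v₂ * z₁ * z₂ + v₂ ^ 2 * z₁ ^ 2) +
    p₃ * (3 * v₂ * z₁ ^ 2 * z₂ + 3 * v₁ * z₁ * z₂ ^ 2) + p₄ * (6 * z₁ ^ 2 * z₂ ^ 2)

end Coefficients

theorem abs_qCoeff₀_le {p₂ p₃ p₄ v₁ z₁ a : ℝ} (h2 : |p₂| ≤ 6) (h3 : |p₃| ≤ 16) (h4 : |p₄| ≤ 7)
    (hv : |v₁| ≤ a) (hz : |z₁| ≤ a) : |qCoeff₀ p₂ p₃ p₄ v₁ z₁| ≤ 30 * a ^ 4 := by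
  have ha : 0 ≤ a := (abs_nonneg _).trans hv
  have t0 : |v₁ ^ 4| ≤ a ^ 4 := by rw [abs_pow]; gcongr
  have t2 : |p₂ * v₁ ^ 2 * z₁ ^ 2| ≤ 6 * a ^ 2 * a ^ 2 := by
    simp only [abs_mul, abs_pow]; gcongr
  have t3 : |p₃ * v₁ * z₁ ^ 3| ≤ 16 * a * a ^ 3 := by
    simp only [abs_mul, abs_pow]; gcongr
  have t4 : |p₄ * z₁ ^ 4| ≤ 7 * a ^ 4 := by
    simp only [abs_mul, abs_pow]; gcongr
  rw [qCoeff₀]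
  rw [abs_le] at *
  constructor <;> linarith

theorem abs_qCoeff₁_le {p₂ p₃ p₄ v₁ z₁ v₂ z₂ a b : ℝ} (h2 : |p₂| ≤ 6) (h3 : |p₃| ≤ 16)
    (h4 : |p₄| ≤ 7) (hv : |v₁| ≤ a) (hz : |z₁| ≤ a) (hv' : |v₂| ≤ b) (hz' : |z₂| ≤ b) :
    |qCoeff₁ p₂ p₃ p₄ v₁ z₁ v₂ z₂| ≤ 120 * (a ^ 3 * b) := by
  have ha : 0 ≤ a := (abs_nonneg _).trans hv
  have hb : 0 ≤ b := (abs_nonneg _).trans hv'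
  have t0 : |v₁ ^ 3 * v₂| ≤ a ^ 3 * b := by simp only [abs_mul, abs_pow]; gcongr
  have t1 : |p₂ * (v₁ * v₂ * z₁ ^ 2)| ≤ 6 * (a * b * a ^ 2) := by
    simp only [abs_mul, abs_pow]; gcongr
  have t2 : |p₂ * (v₁ ^ 2 * z₁ * z₂)| ≤ 6 * (a ^ 2 * a * b) := by
    simp only [abs_mul, abs_pow]; gcongr
  have t3 : |p₃ * (v₂ * z₁ ^ 3)| ≤ 16 * (b * a ^ 3) := by
    simp only [abs_mul, abs_pow]; gcongr
  have t4 : |p₃ * (v₁ * z₁ ^ 2 * z₂)| ≤ 16 * (a * a ^ 2 * b) := by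
    simp only [abs_mul, abs_pow]; gcongr
  have t5 : |p₄ * (z₁ ^ 3 * z₂)| ≤ 7 * (a ^ 3 * b) := by
    simp only [abs_mul, abs_pow]; gcongr
  rw [qCoeff₁]
  rw [abs_le] at *
  constructor <;> linarith

theorem abs_qCoeff₂_le {p₂ p₃ p₄ v₁ z₁ v₂ z₂ a b : ℝ} (h2 : |p₂| ≤ 6) (h3 : |p₃| ≤ 16)
    (h4 : |p₄| ≤ 7) (hv : |v₁| ≤ a) (hz : |z₁| ≤ a) (hv' : |v₂| ≤ b) (hz' : |z₂| ≤ b) :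
    |qCoeff₂ p₂ p₃ p₄ v₁ z₁ v₂ z₂| ≤ 180 * (a * b) ^ 2 := by
  have ha : 0 ≤ a := (abs_nonneg _).trans hv
  have hb : 0 ≤ b := (abs_nonneg _).trans hv'
  have t0 : |v₁ ^ 2 * v₂ ^ 2| ≤ a ^ 2 * b ^ 2 := by simp only [abs_mul, abs_pow]; gcongr
  have t1 : |p₂ * (v₁ ^ 2 * z₂ ^ 2)| ≤ 6 * (a ^ 2 * b ^ 2) := by
    simp only [abs_mul, abs_pow]; gcongr
  have t2 : |p₂ * (v₁ * v₂ * z₁ * z₂)| ≤ 6 * (a * b * a * b) := by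
    simp only [abs_mul]; gcongr
  have t6 : |p₂ * (v₂ ^ 2 * z₁ ^ 2)| ≤ 6 * (b ^ 2 * a ^ 2) := by
    simp only [abs_mul, abs_pow]; gcongr
  have t3 : |p₃ * (v₂ * z₁ ^ 2 * z₂)| ≤ 16 * (b * a ^ 2 * b) := by
    simp only [abs_mul, abs_pow]; gcongr
  have t4 : |p₃ * (v₁ * z₁ * z₂ ^ 2)| ≤ 16 * (a * a * b ^ 2) := by
    simp only [abs_mul, abs_pow]; gcongr
  have t5 : |p₄ * (z₁ ^ 2 * z₂ ^ 2)| ≤ 7 * (a ^ 2 * b ^ 2) := by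
    simp only [abs_mul, abs_pow]; gcongr
  rw [qCoeff₂]
  rw [abs_le] at *
  constructor <;> linarith

/-- The integral quartic form attached to a point through a reduced basis. -/
structure IsForm (k q z₁ z₂ f₀ f₁ f₂ f₃ f₄ : ℤ) : Prop where
  z₁_ne : z₁ ≠ 0
  coprime : IsCoprime z₁ z₂
  eqn : q ^ 2 = f₀ * z₂ ^ 4 - f₁ * z₂ ^ 3 * z₁ + f₂ * z₂ ^ 2 * z₁ ^ 2 - f₃ * z₂ * z₁ ^ 3
    + f₄ * z₁ ^ 4
  z₁_sq : k * z₁ ^ 2 ≤ 2 * q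
  z₁_z₂ : k * (|z₁| * |z₂|) ≤ 2 * q
  abs_f₀ : |f₀| ≤ 120 * k ^ 2
  cases : (|(f₀ : ℝ)| * q ^ 2 ≤ 7680 * k ^ 4 * z₁ ^ 4 ∧ |(f₁ : ℝ)| * q ≤ 15360 * k ^ 3 * z₁ ^ 2 ∧
      |(f₂ : ℝ)| ≤ 720 * k ^ 2 ∧ |(f₃ : ℝ)| * z₁ ^ 2 ≤ 960 * k * q) ∨
    (z₂ ≠ 0 ∧ |(f₀ : ℝ)| * z₂ ^ 4 ≤ 480 * q ^ 2 ∧ |(f₂ : ℝ)| ≤ 720 * k ^ 2 ∧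
      |(f₃ : ℝ)| * q ≤ 3840 * k ^ 3 * z₂ ^ 2 ∧ |(f₄ : ℝ)| * q ^ 2 ≤ 7680 * k ^ 4 * z₂ ^ 4 ∧
      (q : ℝ) ≤ 8 * k * z₂ ^ 2)

/-- The form `f` is `q⁻⁶ F(X v₁ + Y v₂, X z₁ + Y z₂)` with
`F(t, z) = t⁴ - 6wt²z² + 8ytz³ - (4Aq⁴ + 3w²)z⁴`. -/
structure IsFormOf (q A w y v₁ z₁ v₂ z₂ f₀ f₁ f₂ f₃ f₄ : ℤ) : Prop where
  det : v₁ * z₂ - v₂ * z₁ = q ^ 2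
  h₀ : q ^ 6 * f₀ = qCoeff₀ (-6 * w) (8 * y) (-(4 * A * q ^ 4 + 3 * w ^ 2)) v₁ z₁
  h₁ : q ^ 6 * f₁ = qCoeff₁ (-6 * w) (8 * y) (-(4 * A * q ^ 4 + 3 * w ^ 2)) v₁ z₁ v₂ z₂
  h₂ : q ^ 6 * f₂ = qCoeff₂ (-6 * w) (8 * y) (-(4 * A * q ^ 4 + 3 * w ^ 2)) v₁ z₁ v₂ z₂
  h₃ : q ^ 6 * f₃ = qCoeff₁ (-6 * w) (8 * y) (-(4 * A * q ^ 4 + 3 * w ^ 2)) v₂ z₂ v₁ z₁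
  h₄ : q ^ 6 * f₄ = qCoeff₀ (-6 * w) (8 * y) (-(4 * A * q ^ 4 + 3 * w ^ 2)) v₂ z₂

theorem IsFormOf.eqn {q A w y v₁ z₁ v₂ z₂ f₀ f₁ f₂ f₃ f₄ : ℤ} (hq : q ≠ 0)
    (h : IsFormOf q A w y v₁ z₁ v₂ z₂ f₀ f₁ f₂ f₃ f₄) :
    q ^ 2 = f₀ * z₂ ^ 4 - f₁ * z₂ ^ 3 * z₁ + f₂ * z₂ ^ 2 * z₁ ^ 2 - f₃ * z₂ * z₁ ^ 3
    + f₄ * z₁ ^ 4 := by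
  obtain ⟨hd, h0, h1, h2, h3, h4⟩ := h
  apply mul_left_cancel₀ (pow_ne_zero 6 hq)
  have e : q ^ 6 * q ^ 2 = (v₁ * z₂ - v₂ * z₁) ^ 4 := by rw [hd]; ring
  rw [e]
  simp only [qCoeff₀, qCoeff₁, qCoeff₂] at h0 h1 h2 h3 h4
  linear_combination (-z₂ ^ 4) * h0 + z₂ ^ 3 * z₁ * h1 - z₂ ^ 2 * z₁ ^ 2 * h2
    + z₂ * z₁ ^ 3 * h3 - z₁ ^ 4 * h4

theorem IsFormOf.det_pow_mul {q A w y v₁ z₁ v₂ z₂ f₀ f₁ f₂ f₃ f₄ : ℤ}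
    (h : IsFormOf q A w y v₁ z₁ v₂ z₂ f₀ f₁ f₂ f₃ f₄) :
    4 * v₁ * (q ^ 2) ^ 3 =
      q ^ 6 * (4 * f₀ * z₂ ^ 3 - 3 * f₁ * z₂ ^ 2 * z₁ + 2 * f₂ * z₂ * z₁ ^ 2 - f₃ * z₁ ^ 3) := by
  obtain ⟨hd, h0, h1, h2, h3, h4⟩ := h
  rw [← hd]
  simp only [qCoeff₀, qCoeff₁, qCoeff₂] at h0 h1 h2 h3 h4
  linear_combination (-4 * z₂ ^ 3) * h0 + 3 * z₂ ^ 2 * z₁ * h1 - 2 * z₂ * z₁ ^ 2 * h2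
    + z₁ ^ 3 * h3

theorem IsFormOf.eval {q A w y v₁ z₁ v₂ z₂ f₀ f₁ f₂ f₃ f₄ : ℤ}
    (h : IsFormOf q A w y v₁ z₁ v₂ z₂ f₀ f₁ f₂ f₃ f₄) (t : ℤ) :
    (q ^ 2) ^ 4 * (t ^ 4 - 6 * w * t ^ 2 + 8 * y * t - (4 * A * q ^ 4 + 3 * w ^ 2)) =
      q ^ 6 * (f₀ * (t * z₂ - v₂) ^ 4 + f₁ * (t * z₂ - v₂) ^ 3 * (v₁ - t * z₁) +
        f₂ * (t * z₂ - v₂) ^ 2 * (v₁ - t * z₁) ^ 2 + f₃ * (t * z₂ - v₂) * (v₁ - t * z₁) ^ 3 +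
        f₄ * (v₁ - t * z₁) ^ 4) := by
  obtain ⟨hd, h0, h1, h2, h3, h4⟩ := h
  rw [← hd]
  simp only [qCoeff₀, qCoeff₁, qCoeff₂] at h0 h1 h2 h3 h4
  have e1 : (t * z₂ - v₂) * z₁ + (v₁ - t * z₁) * z₂ = v₁ * z₂ - v₂ * z₁ := by ring
  have e2 : (t * z₂ - v₂) * v₁ + (v₁ - t * z₁) * v₂ = t * (v₁ * z₂ - v₂ * z₁) := by ring
  generalize hX : t * z₂ - v₂ = X at *
  generalize hY : v₁ - t * z₁ = Y at *
  generalize hD : v₁ * z₂ - v₂ * z₁ = D at *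
  generalize 4 * A * q ^ 4 + 3 * w ^ 2 = E at *
  calc D ^ 4 * (t ^ 4 - 6 * w * t ^ 2 + 8 * y * t - E)
      = (t * D) ^ 4 - 6 * w * (t * D) ^ 2 * D ^ 2 + 8 * y * (t * D) * D ^ 3 - E * D ^ 4 := by ring
    _ = _ := by
      rw [← e2, ← e1]
      linear_combination (-X ^ 4) * h0 - X ^ 3 * Y * h1 - X ^ 2 * Y ^ 2 * h2 - X * Y ^ 3 * h3
        - Y ^ 4 * h4

/-- A point is determined by its form and by `q`, `z₁`, `z₂`. -/
theorem IsFormOf.injective {q A w y v₁ z₁ v₂ z₂ f₀ f₁ f₂ f₃ f₄ A' w' y' v₁' v₂' : ℤ} (hq : q ≠ 0)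
    (hz : z₁ ≠ 0) (h : IsFormOf q A w y v₁ z₁ v₂ z₂ f₀ f₁ f₂ f₃ f₄)
    (h' : IsFormOf q A' w' y' v₁' z₁ v₂' z₂ f₀ f₁ f₂ f₃ f₄) : A = A' ∧ w = w' ∧ y = y' := by
  have hv1 : v₁ = v₁' := by
    have := h.det_pow_mul.trans h'.det_pow_mul.symm
    have h0 : (q ^ 2) ^ 3 ≠ 0 := by positivity
    have := mul_right_cancel₀ h0 this
    linarith
  subst hv1
  have hv2 : v₂ = v₂' := by
    apply mul_right_cancel₀ hz
    linear_combination h'.det - h.det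
  subst hv2
  have h0 : (q ^ 2) ^ 4 ≠ 0 := by positivity
  have g0 := mul_left_cancel₀ h0 ((h.eval 0).trans (h'.eval 0).symm)
  have g1 := mul_left_cancel₀ h0 ((h.eval 1).trans (h'.eval 1).symm)
  have g2 := mul_left_cancel₀ h0 ((h.eval (-1)).trans (h'.eval (-1)).symm)
  have hw : w = w' := by linarith
  have hy : y = y' := by linarith
  subst hw hy
  refine ⟨?_, rfl, rfl⟩
  have h4 : q ^ 4 ≠ 0 := by positivity
  apply mul_right_cancel₀ h4
  linarith

theorem qCoeff₀_mul {R : Type*} [CommRing R] (K p₂ p₃ p₄ v₁ z₁ : R) :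
    qCoeff₀ (K ^ 2 * p₂) (K ^ 3 * p₃) (K ^ 4 * p₄) v₁ z₁ = qCoeff₀ p₂ p₃ p₄ v₁ (K * z₁) := by
  simp only [qCoeff₀]; ring

theorem qCoeff₁_mul {R : Type*} [CommRing R] (K p₂ p₃ p₄ v₁ z₁ v₂ z₂ : R) :
    qCoeff₁ (K ^ 2 * p₂) (K ^ 3 * p₃) (K ^ 4 * p₄) v₁ z₁ v₂ z₂ =
      qCoeff₁ p₂ p₃ p₄ v₁ (K * z₁) v₂ (K * z₂) := by
  simp only [qCoeff₁]; ring

theorem qCoeff₂_mul {R : Type*} [CommRing R] (K p₂ p₃ p₄ v₁ z₁ v₂ z₂ : R) :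
    qCoeff₂ (K ^ 2 * p₂) (K ^ 3 * p₃) (K ^ 4 * p₄) v₁ z₁ v₂ z₂ =
      qCoeff₂ p₂ p₃ p₄ v₁ (K * z₁) v₂ (K * z₂) := by
  simp only [qCoeff₂]; ring

theorem IsPt.exists_form {k q A B w y : ℤ} (h : IsPt k q A B w y) :
    ∃ v₁ z₁ v₂ z₂ f₀ f₁ f₂ f₃ f₄ : ℤ, IsFormOf q A w y v₁ z₁ v₂ z₂ f₀ f₁ f₂ f₃ f₄ ∧
      IsCoprime z₁ z₂ ∧ q ^ 2 ∣ v₁ ^ 2 - w * z₁ ^ 2 ∧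
      v₁ ^ 2 + (k * q) ^ 2 * z₁ ^ 2 ≤ v₂ ^ 2 + (k * q) ^ 2 * z₂ ^ 2 ∧
      3 * ((v₁ ^ 2 + (k * q) ^ 2 * z₁ ^ 2) * (v₂ ^ 2 + (k * q) ^ 2 * z₂ ^ 2)) ≤
        4 * ((k * q) ^ 2 * (q ^ 2) ^ 2) := by
  obtain ⟨u, c, d, e, hc, hd, he, hu⟩ := h.exists_root
  obtain ⟨v₁, z₁, v₂, z₂, t₁, t₂, hv1, hv2, hdet, hle, hprod⟩ :=
    exists_reduced_basis (k * q) (q ^ 2) u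
  refine ⟨v₁, z₁, v₂, z₂, qCoeff₀ c d e t₁ z₁ + (q ^ 2 - 1) * t₁ ^ 4 + 4 * u * t₁ ^ 3 * z₁,
    qCoeff₁ c d e t₁ z₁ t₂ z₂ + (q ^ 2 - 1) * (4 * t₁ ^ 3 * t₂) +
      4 * u * (t₁ ^ 3 * z₂ + 3 * t₁ ^ 2 * t₂ * z₁),
    qCoeff₂ c d e t₁ z₁ t₂ z₂ + (q ^ 2 - 1) * (6 * t₁ ^ 2 * t₂ ^ 2) +
      4 * u * (3 * t₁ ^ 2 * t₂ * z₂ + 3 * t₁ * t₂ ^ 2 * z₁),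
    qCoeff₁ c d e t₂ z₂ t₁ z₁ + (q ^ 2 - 1) * (4 * t₂ ^ 3 * t₁) +
      4 * u * (t₂ ^ 3 * z₁ + 3 * t₂ ^ 2 * t₁ * z₂),
    qCoeff₀ c d e t₂ z₂ + (q ^ 2 - 1) * t₂ ^ 4 + 4 * u * t₂ ^ 3 * z₂,
    ⟨?_, ?_, ?_, ?_, ?_, ?_⟩, ⟨-t₂, t₁, by linear_combination hdet⟩, ?_, hle, hprod⟩
  · rw [hv1, hv2]; linear_combination q ^ 2 * hdet
  · rw [hv1]; simp only [qCoeff₀]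
    linear_combination (q ^ 4 * t₁ ^ 2 * z₁ ^ 2) * hc + q ^ 2 * t₁ * z₁ ^ 3 * hd + z₁ ^ 4 * he
  · rw [hv1, hv2]; simp only [qCoeff₁]
    linear_combination (q ^ 4 * (2 * t₁ * t₂ * z₁ ^ 2 + 2 * t₁ ^ 2 * z₁ * z₂)) * hc +
      q ^ 2 * (t₂ * z₁ ^ 3 + 3 * t₁ * z₁ ^ 2 * z₂) * hd + 4 * z₁ ^ 3 * z₂ * he
  · rw [hv1, hv2]; simp only [qCoeff₂]
    linear_combination
      (q ^ 4 * (t₁ ^ 2 * z₂ ^ 2 + 4 * t₁ * t₂ * z₁ * z₂ + t₂ ^ 2 * z₁ ^ 2)) * hc +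
      q ^ 2 * (3 * t₂ * z₁ ^ 2 * z₂ + 3 * t₁ * z₁ * z₂ ^ 2) * hd + 6 * z₁ ^ 2 * z₂ ^ 2 * he
  · rw [hv1, hv2]; simp only [qCoeff₁]
    linear_combination (q ^ 4 * (2 * t₁ * t₂ * z₂ ^ 2 + 2 * t₂ ^ 2 * z₁ * z₂)) * hc +
      q ^ 2 * (t₁ * z₂ ^ 3 + 3 * t₂ * z₂ ^ 2 * z₁) * hd + 4 * z₂ ^ 3 * z₁ * he
  · rw [hv2]; simp only [qCoeff₀]
    linear_combination (q ^ 4 * t₂ ^ 2 * z₂ ^ 2) * hc + q ^ 2 * t₂ * z₂ ^ 3 * hd + z₂ ^ 4 * he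
  · obtain ⟨g, hg⟩ := hu
    refine ⟨2 * u * z₁ * t₁ + q ^ 2 * t₁ ^ 2 + g * z₁ ^ 2, ?_⟩
    rw [hv1]
    linear_combination z₁ ^ 2 * hg

set_option maxHeartbeats 800000 in
/-- The numerical consequences of reducedness of the basis, with `k` and `q` real. -/
theorem IsFormOf.bounds {k q A B w y v₁ z₁ v₂ z₂ f₀ f₁ f₂ f₃ f₄ : ℤ} (h : IsPt k q A B w y)
    (hf : IsFormOf q A w y v₁ z₁ v₂ z₂ f₀ f₁ f₂ f₃ f₄)
    (hle : v₁ ^ 2 + (k * q) ^ 2 * z₁ ^ 2 ≤ v₂ ^ 2 + (k * q) ^ 2 * z₂ ^ 2)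
    (hprod : 3 * ((v₁ ^ 2 + (k * q) ^ 2 * z₁ ^ 2) * (v₂ ^ 2 + (k * q) ^ 2 * z₂ ^ 2)) ≤
        4 * ((k * q) ^ 2 * (q ^ 2) ^ 2)) :
    ∃ a b : ℝ, 0 ≤ a ∧ a ≤ b ∧ a * b ≤ 2 * k * q ^ 3 ∧ |(v₁ : ℝ)| ≤ a ∧ k * q * |(z₁ : ℝ)| ≤ a ∧
      |(v₂ : ℝ)| ≤ b ∧ k * q * |(z₂ : ℝ)| ≤ b ∧ |(f₀ : ℝ)| * q ^ 6 ≤ 30 * a ^ 4 ∧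
      |(f₁ : ℝ)| * q ^ 6 ≤ 120 * (a ^ 3 * b) ∧ |(f₂ : ℝ)| * q ^ 6 ≤ 180 * (a * b) ^ 2 ∧
      |(f₃ : ℝ)| * q ^ 6 ≤ 120 * (b ^ 3 * a) ∧ |(f₄ : ℝ)| * q ^ 6 ≤ 30 * b ^ 4 := by
  have hk : (1 : ℝ) ≤ k := by exact_mod_cast h.k_pos
  have hq : (1 : ℝ) ≤ q := by exact_mod_cast h.q_pos
  have hK : (0 : ℝ) < k * q := by positivity
  have hle' : (v₁ : ℝ) ^ 2 + (k * q) ^ 2 * z₁ ^ 2 ≤ v₂ ^ 2 + (k * q) ^ 2 * z₂ ^ 2 := by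
    exact_mod_cast hle
  have hprod' : 3 * (((v₁ : ℝ) ^ 2 + (k * q) ^ 2 * z₁ ^ 2) * (v₂ ^ 2 + (k * q) ^ 2 * z₂ ^ 2)) ≤
      4 * ((k * q) ^ 2 * (q ^ 2) ^ 2) := by exact_mod_cast hprod
  set n₁ := (v₁ : ℝ) ^ 2 + (k * q) ^ 2 * z₁ ^ 2 with hn1
  set n₂ := (v₂ : ℝ) ^ 2 + (k * q) ^ 2 * z₂ ^ 2 with hn2
  have hn1' : 0 ≤ n₁ := by positivity
  have hn2' : 0 ≤ n₂ := by positivity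
  have b1 : |(v₁ : ℝ)| ≤ √n₁ :=
    Real.abs_le_sqrt (by rw [hn1]; linarith [sq_nonneg (k * q * z₁ : ℝ)])
  have b2 : |(k * q * z₁ : ℝ)| ≤ √n₁ :=
    Real.abs_le_sqrt (by rw [hn1]; linarith [sq_nonneg (v₁ : ℝ)])
  have b3 : |(v₂ : ℝ)| ≤ √n₂ :=
    Real.abs_le_sqrt (by rw [hn2]; linarith [sq_nonneg (k * q * z₂ : ℝ)])
  have b4 : |(k * q * z₂ : ℝ)| ≤ √n₂ :=
    Real.abs_le_sqrt (by rw [hn2]; linarith [sq_nonneg (v₂ : ℝ)])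
  have hw : |(w : ℝ)| ≤ k ^ 2 * q ^ 2 := by exact_mod_cast h.abs_w
  have hy : (y : ℝ) ≤ 2 * k ^ 3 * q ^ 3 := by exact_mod_cast h.y_le
  have hy0 : (1 : ℝ) ≤ y := by exact_mod_cast h.y_pos
  have hA : |(A : ℝ)| ≤ k ^ 4 := by exact_mod_cast h.abs_A
  set K : ℝ := k * q with hKdef
  have p2 : |(-6 * w : ℝ) / K ^ 2| ≤ 6 := by
    rw [abs_div, abs_of_pos (by positivity : 0 < K ^ 2), div_le_iff₀ (by positivity), abs_mul]
    norm_num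
    rw [hKdef, mul_pow]; exact hw
  have p3 : |(8 * y : ℝ) / K ^ 3| ≤ 16 := by
    rw [abs_of_nonneg (by positivity), div_le_iff₀ (by positivity), hKdef, mul_pow]
    linarith
  have p4 : |(-(4 * A * q ^ 4 + 3 * w ^ 2) : ℝ) / K ^ 4| ≤ 7 := by
    rw [abs_div, abs_of_pos (by positivity : 0 < K ^ 4), div_le_iff₀ (by positivity), abs_neg]
    have e1 : |(4 * A * q ^ 4 : ℝ)| ≤ 4 * k ^ 4 * q ^ 4 := by
      rw [abs_mul, abs_mul, abs_of_nonneg (by positivity : (0 : ℝ) ≤ q ^ 4)]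
      norm_num
      gcongr
    have e2 : |(3 * w ^ 2 : ℝ)| ≤ 3 * (k ^ 2 * q ^ 2) ^ 2 := by
      rw [abs_mul, abs_pow, abs_of_pos (by norm_num : (0 : ℝ) < 3)]
      gcongr
    calc _ ≤ |(4 * A * q ^ 4 : ℝ)| + |(3 * w ^ 2 : ℝ)| := abs_add_le _ _
      _ ≤ (4 * k ^ 4 * q ^ 4 + 3 * (k ^ 2 * q ^ 2) ^ 2 : ℝ) := add_le_add e1 e2
      _ = _ := by rw [hKdef]; ring
  have s2 : (-6 * w : ℝ) = K ^ 2 * ((-6 * w : ℝ) / K ^ 2) := by field_simp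
  have s3 : (8 * y : ℝ) = K ^ 3 * ((8 * y : ℝ) / K ^ 3) := by field_simp
  have s4 : (-(4 * A * q ^ 4 + 3 * w ^ 2) : ℝ) =
    K ^ 4 * ((-(4 * A * q ^ 4 + 3 * w ^ 2) : ℝ) / K ^ 4) := by field_simp
  have h0 : (f₀ : ℝ) * q ^ 6 =
      qCoeff₀ (R := ℝ) (-6 * w) (8 * y) (-(4 * A * q ^ 4 + 3 * w ^ 2)) v₁ z₁ := by
    have := congrArg (Int.cast (R := ℝ)) hf.h₀
    simp only [qCoeff₀] at this ⊢
    push_cast at this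
    linear_combination this
  have h1 : (f₁ : ℝ) * q ^ 6 =
      qCoeff₁ (R := ℝ) (-6 * w) (8 * y) (-(4 * A * q ^ 4 + 3 * w ^ 2)) v₁ z₁ v₂ z₂ := by
    have := congrArg (Int.cast (R := ℝ)) hf.h₁
    simp only [qCoeff₁] at this ⊢
    push_cast at this
    linear_combination this
  have h2 : (f₂ : ℝ) * q ^ 6 =
      qCoeff₂ (R := ℝ) (-6 * w) (8 * y) (-(4 * A * q ^ 4 + 3 * w ^ 2)) v₁ z₁ v₂ z₂ := by
    have := congrArg (Int.cast (R := ℝ)) hf.h₂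
    simp only [qCoeff₂] at this ⊢
    push_cast at this
    linear_combination this
  have h3 : (f₃ : ℝ) * q ^ 6 =
      qCoeff₁ (R := ℝ) (-6 * w) (8 * y) (-(4 * A * q ^ 4 + 3 * w ^ 2)) v₂ z₂ v₁ z₁ := by
    have := congrArg (Int.cast (R := ℝ)) hf.h₃
    simp only [qCoeff₁] at this ⊢
    push_cast at this
    linear_combination this
  have h4 : (f₄ : ℝ) * q ^ 6 =
      qCoeff₀ (R := ℝ) (-6 * w) (8 * y) (-(4 * A * q ^ 4 + 3 * w ^ 2)) v₂ z₂ := by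
    have := congrArg (Int.cast (R := ℝ)) hf.h₄
    simp only [qCoeff₀] at this ⊢
    push_cast at this
    linear_combination this
  rw [s2, s3, s4, qCoeff₀_mul] at h0 h4
  rw [s2, s3, s4, qCoeff₁_mul] at h1 h3
  rw [s2, s3, s4, qCoeff₂_mul] at h2
  have hq6 : |(q : ℝ) ^ 6| = q ^ 6 := abs_of_nonneg (by positivity)
  refine ⟨√n₁, √n₂, Real.sqrt_nonneg _, Real.sqrt_le_sqrt hle', ?_, b1, ?_, b3, ?_, ?_, ?_, ?_, ?_,
    ?_⟩
  · rw [← Real.sqrt_mul hn1']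
    refine Real.sqrt_le_iff.mpr ⟨by positivity, ?_⟩
    have : (2 * k * q ^ 3 : ℝ) ^ 2 = 4 * (K ^ 2 * (q ^ 2) ^ 2) := by rw [hKdef]; ring
    rw [this]
    linarith [mul_nonneg hn1' hn2']
  · rwa [abs_mul, abs_of_pos hK] at b2
  · rwa [abs_mul, abs_of_pos hK] at b4
  · rw [← hq6, ← abs_mul, h0]; exact abs_qCoeff₀_le p2 p3 p4 b1 b2
  · rw [← hq6, ← abs_mul, h1]; exact abs_qCoeff₁_le p2 p3 p4 b1 b2 b3 b4
  · rw [← hq6, ← abs_mul, h2]; exact abs_qCoeff₂_le p2 p3 p4 b1 b2 b3 b4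
  · rw [← hq6, ← abs_mul, h3]; exact abs_qCoeff₁_le p2 p3 p4 b3 b4 b1 b2
  · rw [← hq6, ← abs_mul, h4]; exact abs_qCoeff₀_le p2 p3 p4 b3 b4

theorem IsPt.exists_isForm {k q A B w y : ℤ} (h : IsPt k q A B w y) (hkq : 2 * k ^ 3 < q) :
    ∃ v₁ z₁ v₂ z₂ f₀ f₁ f₂ f₃ f₄ : ℤ, IsFormOf q A w y v₁ z₁ v₂ z₂ f₀ f₁ f₂ f₃ f₄ ∧
      IsForm k q z₁ z₂ f₀ f₁ f₂ f₃ f₄ ∧ q ^ 2 ∣ v₁ ^ 2 - w * z₁ ^ 2 := by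
  obtain ⟨v₁, z₁, v₂, z₂, f₀, f₁, f₂, f₃, f₄, hf, hcop, hdvd, hle, hprod⟩ := h.exists_form
  obtain ⟨a, b, ha, hab, habq, hv1, hz1, hv2, hz2, g0, g1, g2, g3, g4⟩ := hf.bounds h hle hprod
  have hk : (1 : ℝ) ≤ k := by exact_mod_cast h.k_pos
  have hq : (1 : ℝ) ≤ q := by exact_mod_cast h.q_pos
  have hkq' : 2 * (k : ℝ) ^ 3 < q := by exact_mod_cast hkq
  have hq0 : (0 : ℝ) < q := by linarith
  have hk0 : (0 : ℝ) < k := by linarith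
  have hdet : (v₁ * z₂ - v₂ * z₁ : ℝ) = q ^ 2 := by exact_mod_cast hf.det
  have hdet' : (q : ℝ) ^ 2 ≤ a * |(z₂ : ℝ)| + b * |(z₁ : ℝ)| := by
    rw [← hdet]
    calc (v₁ * z₂ - v₂ * z₁ : ℝ) ≤ |(v₁ * z₂ - v₂ * z₁ : ℝ)| := le_abs_self _
      _ ≤ |(v₁ * z₂ : ℝ)| + |(v₂ * z₁ : ℝ)| := abs_sub _ _
      _ ≤ _ := by rw [abs_mul, abs_mul]; gcongr
  have hz1ne : z₁ ≠ 0 := by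
    rintro rfl
    have hz2' : IsUnit z₂ := isCoprime_zero_left.mp hcop
    have hz2'' : |(z₂ : ℝ)| = 1 := by
      exact_mod_cast (congrArg (Int.cast (R := ℝ)) (Int.isUnit_iff_abs_eq.mp hz2'))
    rw [hz2''] at hdet'
    simp only [Int.cast_zero, abs_zero, mul_zero, mul_one, add_zero] at hdet'
    have e1 : (q : ℝ) ^ 2 * q ^ 2 ≤ a * b := mul_le_mul hdet' (hdet'.trans hab) (by positivity) ha
    have e2 : (q : ℝ) * q ^ 3 ≤ 2 * k * q ^ 3 := by linarith
    have e3 : (q : ℝ) ≤ 2 * k := le_of_mul_le_mul_right e2 (by positivity)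
    have e4 : (k : ℝ) ≤ k ^ 3 := le_self_pow₀ hk (by norm_num)
    linarith
  have hζ : (1 : ℝ) ≤ |(z₁ : ℝ)| := by exact_mod_cast Int.one_le_abs hz1ne
  set ζ := |(z₁ : ℝ)| with hζdef
  set η := |(z₂ : ℝ)| with hηdef
  have hη0 : 0 ≤ η := abs_nonneg _
  have hb : 0 ≤ b := ha.trans hab
  have hsq : (z₁ : ℝ) ^ 2 = ζ ^ 2 := (sq_abs _).symm
  have hsq' : (z₂ : ℝ) ^ 2 = η ^ 2 := (sq_abs _).symm
  have hq4 : (z₁ : ℝ) ^ 4 = ζ ^ 4 := by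
    rw [show (z₁ : ℝ) ^ 4 = ((z₁ : ℝ) ^ 2) ^ 2 by ring, hsq]; ring
  have hq4' : (z₂ : ℝ) ^ 4 = η ^ 4 := by
    rw [show (z₂ : ℝ) ^ 4 = ((z₂ : ℝ) ^ 2) ^ 2 by ring, hsq']; ring
  have haa : a * a ≤ 2 * k * q ^ 3 := (mul_le_mul_of_nonneg_left hab ha).trans habq
  have c1 : k * ζ ^ 2 ≤ 2 * q := by
    have e1 : (k * q * ζ) * (k * q * ζ) ≤ a * a := mul_le_mul hz1 hz1 (by positivity) ha
    have e2 : k * ζ ^ 2 * (k * q ^ 2) ≤ 2 * q * (k * q ^ 2) := by linarith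
    exact le_of_mul_le_mul_right e2 (by positivity)
  have c2 : k * (ζ * η) ≤ 2 * q := by
    have e1 : (k * q * ζ) * (k * q * η) ≤ a * b := mul_le_mul hz1 hz2 (by positivity) ha
    have e2 : k * (ζ * η) * (k * q ^ 2) ≤ 2 * q * (k * q ^ 2) := by linarith
    exact le_of_mul_le_mul_right e2 (by positivity)
  have c3 : |(f₀ : ℝ)| ≤ 120 * k ^ 2 := by
    have e1 : (a * a) * (a * a) ≤ (2 * k * q ^ 3) * (2 * k * q ^ 3) :=
      mul_le_mul haa haa (by positivity) (by positivity)
    have e2 : |(f₀ : ℝ)| * q ^ 6 ≤ 120 * k ^ 2 * q ^ 6 := by linarith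
    exact le_of_mul_le_mul_right e2 (by positivity)
  have c4 : |(f₂ : ℝ)| ≤ 720 * k ^ 2 := by
    have e1 : (a * b) * (a * b) ≤ (2 * k * q ^ 3) * (2 * k * q ^ 3) :=
      mul_le_mul habq habq (by positivity) (by positivity)
    have e2 : |(f₂ : ℝ)| * q ^ 6 ≤ 720 * k ^ 2 * q ^ 6 := by linarith
    exact le_of_mul_le_mul_right e2 (by positivity)
  refine ⟨v₁, z₁, v₂, z₂, f₀, f₁, f₂, f₃, f₄, hf, ⟨hz1ne, hcop, hf.eqn ?_, ?_, ?_, ?_, ?_⟩, hdvd⟩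
  · have := h.q_pos; omega
  · rw [← hsq] at c1; exact_mod_cast c1
  · rw [hζdef, hηdef] at c2; exact_mod_cast c2
  · exact_mod_cast c3
  rw [hsq, hsq', hq4, hq4']
  rcases le_or_gt ((q : ℝ) ^ 2) (2 * (b * ζ)) with hcase | hcase
  · left
    have ea : a ≤ 4 * k * q * ζ := by
      have : a * q ^ 2 ≤ 4 * k * q * ζ * q ^ 2 := by
        calc a * q ^ 2 ≤ a * (2 * (b * ζ)) := by gcongr
          _ = 2 * (a * b) * ζ := by ring
          _ ≤ 2 * (2 * k * q ^ 3) * ζ := by gcongr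
          _ = _ := by ring
      exact le_of_mul_le_mul_right this (by positivity)
    have eb : b * ζ ≤ 2 * q ^ 2 := by
      have : b * ζ * (k * q) ≤ 2 * q ^ 2 * (k * q) := by
        calc b * ζ * (k * q) = (k * q * ζ) * b := by ring
          _ ≤ a * b := by gcongr
          _ ≤ _ := habq
          _ = _ := by ring
      exact le_of_mul_le_mul_right this (by positivity)
    refine ⟨?_, ?_, c4, ?_⟩
    · have : |(f₀ : ℝ)| * q ^ 2 * q ^ 4 ≤ 7680 * k ^ 4 * ζ ^ 4 * q ^ 4 := by
        calc _ = |(f₀ : ℝ)| * q ^ 6 := by ring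
          _ ≤ 30 * a ^ 4 := g0
          _ ≤ 30 * (4 * k * q * ζ) ^ 4 := by gcongr
          _ = _ := by ring
      exact le_of_mul_le_mul_right this (by positivity)
    · have : |(f₁ : ℝ)| * q * q ^ 5 ≤ 15360 * k ^ 3 * ζ ^ 2 * q ^ 5 := by
        calc _ = |(f₁ : ℝ)| * q ^ 6 := by ring
          _ ≤ 120 * (a ^ 3 * b) := g1
          _ = 120 * a ^ 2 * (a * b) := by ring
          _ ≤ 120 * (4 * k * q * ζ) ^ 2 * (2 * k * q ^ 3) := by gcongr
          _ = 3840 * (k ^ 3 * ζ ^ 2 * q ^ 5) := by ring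
          _ ≤ 15360 * (k ^ 3 * ζ ^ 2 * q ^ 5) := by gcongr; norm_num
          _ = _ := by ring
      exact le_of_mul_le_mul_right this (by positivity)
    · have : |(f₃ : ℝ)| * ζ ^ 2 * q ^ 6 ≤ 960 * k * q * q ^ 6 := by
        calc _ = |(f₃ : ℝ)| * q ^ 6 * ζ ^ 2 := by ring
          _ ≤ 120 * (b ^ 3 * a) * ζ ^ 2 := by gcongr
          _ = 120 * (b * ζ) ^ 2 * (a * b) := by ring
          _ ≤ 120 * (2 * q ^ 2) ^ 2 * (2 * k * q ^ 3) := by gcongr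
          _ = _ := by ring
      exact le_of_mul_le_mul_right this (by positivity)
  · right
    have hca : (q : ℝ) ^ 2 ≤ 2 * (a * η) := by linarith
    have hη : z₂ ≠ 0 := by
      rintro rfl
      rw [hηdef] at hca
      simp only [Int.cast_zero, abs_zero, mul_zero] at hca
      have : (0 : ℝ) < q ^ 2 := by positivity
      linarith
    have ea : b ≤ 4 * k * q * η := by
      have : b * q ^ 2 ≤ 4 * k * q * η * q ^ 2 := by
        calc b * q ^ 2 ≤ b * (2 * (a * η)) := by gcongr
          _ = 2 * (a * b) * η := by ring
          _ ≤ 2 * (2 * k * q ^ 3) * η := by gcongr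
          _ = _ := by ring
      exact le_of_mul_le_mul_right this (by positivity)
    have eb : a * η ≤ 2 * q ^ 2 := by
      have : a * η * (k * q) ≤ 2 * q ^ 2 * (k * q) := by
        calc a * η * (k * q) = a * (k * q * η) := by ring
          _ ≤ a * b := by gcongr
          _ ≤ _ := habq
          _ = _ := by ring
      exact le_of_mul_le_mul_right this (by positivity)
    refine ⟨hη, ?_, c4, ?_, ?_, ?_⟩
    · have : |(f₀ : ℝ)| * η ^ 4 * q ^ 6 ≤ 480 * q ^ 2 * q ^ 6 := by
        calc _ = |(f₀ : ℝ)| * q ^ 6 * η ^ 4 := by ring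
          _ ≤ 30 * a ^ 4 * η ^ 4 := by gcongr
          _ = 30 * (a * η) ^ 4 := by ring
          _ ≤ 30 * (2 * q ^ 2) ^ 4 := by gcongr
          _ = _ := by ring
      exact le_of_mul_le_mul_right this (by positivity)
    · have : |(f₃ : ℝ)| * q * q ^ 5 ≤ 3840 * k ^ 3 * η ^ 2 * q ^ 5 := by
        calc _ = |(f₃ : ℝ)| * q ^ 6 := by ring
          _ ≤ 120 * (b ^ 3 * a) := g3
          _ = 120 * b ^ 2 * (a * b) := by ring
          _ ≤ 120 * (4 * k * q * η) ^ 2 * (2 * k * q ^ 3) := by gcongr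
          _ = _ := by ring
      exact le_of_mul_le_mul_right this (by positivity)
    · have : |(f₄ : ℝ)| * q ^ 2 * q ^ 4 ≤ 7680 * k ^ 4 * η ^ 4 * q ^ 4 := by
        calc _ = |(f₄ : ℝ)| * q ^ 6 := by ring
          _ ≤ 30 * b ^ 4 := g4
          _ ≤ 30 * (4 * k * q * η) ^ 4 := by gcongr
          _ = _ := by ring
      exact le_of_mul_le_mul_right this (by positivity)
    · have : (q : ℝ) * q ≤ 8 * k * η ^ 2 * q := by
        calc (q : ℝ) * q = q ^ 2 := by ring
          _ ≤ 2 * (a * η) := hca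
          _ ≤ 2 * ((4 * k * q * η) * η) := by gcongr; exact hab.trans ea
          _ = _ := by ring
      exact le_of_mul_le_mul_right this hq0

theorem card_le_of_successive_congr (m : ℤ) (hm : 0 < m) (X Y Z : ℝ) (hX : 0 ≤ X) (hY : 0 ≤ Y)
    (hZ : 0 ≤ Z) (S : Finset (ℤ × ℤ × ℤ × ℤ))
    (hb : ∀ s ∈ S, |(s.1 : ℝ)| ≤ X ∧ |(s.2.1 : ℝ)| ≤ Y ∧ |(s.2.2.1 : ℝ)| ≤ Z)
    (h1 : ∀ s ∈ S, ∀ t ∈ S, m ∣ s.1 - t.1)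
    (h2 : ∀ s ∈ S, ∀ t ∈ S, s.1 = t.1 → m ∣ s.2.1 - t.2.1)
    (h3 : ∀ s ∈ S, ∀ t ∈ S, s.1 = t.1 → s.2.1 = t.2.1 → m ∣ s.2.2.1 - t.2.2.1)
    (h4 : ∀ s ∈ S, ∀ t ∈ S, s.1 = t.1 → s.2.1 = t.2.1 → s.2.2.1 = t.2.2.1 →
      s.2.2.2 = t.2.2.2) :
    (S.card : ℝ) ≤ (2 * X / m + 1) * ((2 * Y / m + 1) * (2 * Z / m + 1)) := by
  have hm' : (0 : ℝ) < m := by exact_mod_cast hm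
  refine card_le_mul_of_fiber S (fun s => s.1) _ _ (by positivity) ?_ ?_
  · refine card_le_of_congr m hm X hX _ ?_ ?_
    · intro x hx
      obtain ⟨s, hs, rfl⟩ := Finset.mem_image.mp hx
      exact (hb s hs).1
    · intro x hx x' hx'
      obtain ⟨s, hs, rfl⟩ := Finset.mem_image.mp hx
      obtain ⟨t, ht, rfl⟩ := Finset.mem_image.mp hx'
      exact h1 s hs t ht
  intro x _
  refine card_le_mul_of_fiber _ (fun s => s.2.1) _ _ (by positivity) ?_ ?_
  · refine card_le_of_congr m hm Y hY _ ?_ ?_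
    · intro y hy
      obtain ⟨s, hs, rfl⟩ := Finset.mem_image.mp hy
      exact (hb s (Finset.mem_filter.mp hs).1).2.1
    · intro y hy y' hy'
      obtain ⟨s, hs, rfl⟩ := Finset.mem_image.mp hy
      obtain ⟨t, ht, rfl⟩ := Finset.mem_image.mp hy'
      rw [Finset.mem_filter] at hs ht
      exact h2 s hs.1 t ht.1 (hs.2.trans ht.2.symm)
  intro y _
  rw [← Finset.card_image_of_injOn (f := fun s : ℤ × ℤ × ℤ × ℤ => s.2.2.1)]
  · refine card_le_of_congr m hm Z hZ _ ?_ ?_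
    · intro y hy
      obtain ⟨s, hs, rfl⟩ := Finset.mem_image.mp hy
      exact (hb s (Finset.mem_filter.mp (Finset.mem_filter.mp hs).1).1).2.2
    · intro y hy y' hy'
      obtain ⟨s, hs, rfl⟩ := Finset.mem_image.mp hy
      obtain ⟨t, ht, rfl⟩ := Finset.mem_image.mp hy'
      rw [Finset.mem_filter, Finset.mem_filter] at hs ht
      exact h3 s hs.1.1 t ht.1.1 (hs.1.2.trans ht.1.2.symm) (hs.2.trans ht.2.symm)
  · intro s hs t ht hst
    rw [Finset.mem_coe, Finset.mem_filter, Finset.mem_filter] at hs ht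
    have e1 := hs.1.2.trans ht.1.2.symm
    have e2 := hs.2.trans ht.2.symm
    exact Prod.ext e1 (Prod.ext e2 (Prod.ext hst (h4 s hs.1.1 t ht.1.1 e1 e2 hst)))

theorem dvd_of_eqn_eq {z₁ z₂ a b : ℤ} (n : ℕ) (hz : z₁ ≠ 0) (hc : IsCoprime z₁ z₂) (m : ℕ)
    (r : ℤ) (h : z₁ ^ m * (z₂ ^ n * (a - b)) = z₁ ^ m * (z₁ * r)) : z₁ ∣ a - b :=
  (hc.pow_right (n := n)).dvd_of_dvd_mul_left ⟨r, mul_left_cancel₀ (pow_ne_zero m hz) h⟩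

theorem card_forms_le_of_z₁ {k q z₁ z₂ f₀ : ℤ} (hk : 1 ≤ k) (hkq : 2 * k ^ 3 < q)
    (S : Finset (ℤ × ℤ × ℤ × ℤ))
    (hS : ∀ s ∈ S, IsForm k q z₁ z₂ f₀ s.1 s.2.1 s.2.2.1 s.2.2.2)
    (hS' : ∀ s ∈ S, |(f₀ : ℝ)| * q ^ 2 ≤ 7680 * k ^ 4 * z₁ ^ 4 ∧
      |(s.1 : ℝ)| * q ≤ 15360 * k ^ 3 * z₁ ^ 2 ∧
      |(s.2.1 : ℝ)| ≤ 720 * k ^ 2 ∧ |(s.2.2.1 : ℝ)| * z₁ ^ 2 ≤ 960 * k * q) :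
    (S.card : ℝ) * (|(f₀ : ℝ)| * (|(z₂ : ℝ)| + 1)) ≤ 10 ^ 15 * (k ^ 3 * q) := by
  have hk' : (1 : ℝ) ≤ k := by exact_mod_cast hk
  have hkq' : 2 * (k : ℝ) ^ 3 < q := by exact_mod_cast hkq
  have hk0 : (0 : ℝ) < k := by linarith
  have hq0 : (0 : ℝ) < q := by have : (0 : ℝ) < k ^ 3 := by positivity
                               linarith
  rcases S.eq_empty_or_nonempty with rfl | ⟨s₀, hs₀⟩
  · simp only [Finset.card_empty, Nat.cast_zero, zero_mul]; positivity
  have hform := hS s₀ hs₀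
  have hz := hform.z₁_ne
  have hc := hform.coprime
  set ζ := |(z₁ : ℝ)| with hζdef
  have hζ : (1 : ℝ) ≤ ζ := by rw [hζdef]; exact_mod_cast Int.one_le_abs hz
  have hζ0 : 0 < ζ := by linarith
  have hsq : (z₁ : ℝ) ^ 2 = ζ ^ 2 := (sq_abs _).symm
  have hq4 : (z₁ : ℝ) ^ 4 = ζ ^ 4 := by
    rw [show (z₁ : ℝ) ^ 4 = ((z₁ : ℝ) ^ 2) ^ 2 by ring, hsq]; ring
  have c1 : k * ζ ^ 2 ≤ 2 * q := by rw [← hsq]; exact_mod_cast hform.z₁_sq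
  have c2 : k * (ζ * |(z₂ : ℝ)|) ≤ 2 * q := by
    rw [hζdef]; exact_mod_cast hform.z₁_z₂
  have c3 : k * ζ ≤ 2 * q := (by gcongr; exact le_self_pow₀ hζ (by norm_num) :
    k * ζ ≤ k * ζ ^ 2).trans c1
  have hf0 := (hS' s₀ hs₀).1
  rw [hq4] at hf0
  simp only [hsq] at hS'
  have hcount : (S.card : ℝ) ≤ (2 * (15360 * k ^ 3 * ζ ^ 2 / q) / ζ + 1) *
      ((2 * (720 * k ^ 2) / ζ + 1) * (2 * (960 * k * q / ζ ^ 2) / ζ + 1)) := by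
    have := card_le_of_successive_congr |z₁| (abs_pos.mpr hz) (15360 * k ^ 3 * ζ ^ 2 / q)
      (720 * k ^ 2) (960 * k * q / ζ ^ 2) (by positivity) (by positivity) (by positivity) S
      ?_ ?_ ?_ ?_ ?_
    · simpa [hζdef] using this
    · intro s hs
      obtain ⟨-, h1, h2, h3⟩ := hS' s hs
      exact ⟨by rwa [le_div_iff₀ hq0], h2, by rwa [le_div_iff₀ (by positivity)]⟩
    · intro s hs t ht
      rw [abs_dvd]
      refine dvd_of_eqn_eq 3 hz hc 1
        (z₂ ^ 2 * (s.2.1 - t.2.1) - z₂ * z₁ * (s.2.2.1 - t.2.2.1)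
          + z₁ ^ 2 * (s.2.2.2 - t.2.2.2)) ?_
      linear_combination (hS s hs).eqn - (hS t ht).eqn
    · intro s hs t ht h1
      rw [abs_dvd]
      refine dvd_of_eqn_eq 2 hz hc 2
        (z₂ * (s.2.2.1 - t.2.2.1) - z₁ * (s.2.2.2 - t.2.2.2)) ?_
      have e1 := (hS s hs).eqn
      rw [h1] at e1
      linear_combination (hS t ht).eqn - e1
    · intro s hs t ht h1 h2
      rw [abs_dvd]
      refine dvd_of_eqn_eq 1 hz hc 3 (s.2.2.2 - t.2.2.2) ?_
      have e1 := (hS s hs).eqn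
      rw [h1, h2] at e1
      linear_combination e1 - (hS t ht).eqn
    · intro s hs t ht h1 h2 h3
      have e1 := (hS s hs).eqn
      rw [h1, h2, h3] at e1
      apply mul_right_cancel₀ (pow_ne_zero 4 hz)
      linear_combination (hS t ht).eqn - e1
  have hprod : (2 * (15360 * k ^ 3 * ζ ^ 2 / q) / ζ + 1) *
      ((2 * (720 * k ^ 2) / ζ + 1) * (2 * (960 * k * q / ζ ^ 2) / ζ + 1)) * ζ ^ 3 ≤
      15361 * 1392004 * q ^ 2 := by
    have e0 : (2 * (15360 * k ^ 3 * ζ ^ 2 / q) / ζ + 1) *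
      ((2 * (720 * k ^ 2) / ζ + 1) * (2 * (960 * k * q / ζ ^ 2) / ζ + 1)) * ζ ^ 3 =
      (30720 * k ^ 3 * ζ + q) * ((1440 * k ^ 2 + ζ) * (1920 * k * q + ζ ^ 3)) / (q * ζ) := by
      field_simp
      ring
    rw [e0, div_le_iff₀ (by positivity)]
    have b1 : 30720 * k ^ 3 * ζ + q ≤ 15361 * (q * ζ) := by
      have t1 : 2 * k ^ 3 * ζ ≤ q * ζ := by gcongr
      have t2 : q * 1 ≤ q * ζ := by gcongr
      linarith
    have b2 : (1440 * k ^ 2 + ζ) * (1920 * k * q + ζ ^ 3) ≤ 1392004 * (q ^ 2 : ℝ) := by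
      have t1 : 2 * (k : ℝ) ^ 3 * q ≤ q * q := by gcongr
      have t2 : (k * ζ ^ 2) * (k * ζ) ≤ (2 * q) * (2 * q) :=
        mul_le_mul c1 c3 (by positivity) (by positivity)
      have t3 : k * ζ * q ≤ 2 * q * q := by gcongr
      have t4 : (k * ζ ^ 2) * (k * ζ ^ 2) ≤ (2 * q) * (2 * q) :=
        mul_le_mul c1 c1 (by positivity) (by positivity)
      have t5 : 1 * ζ ^ 4 ≤ (k * k) * ζ ^ 4 := by
        gcongr; nlinarith
      linarith
    calc _ ≤ (15361 * (q * ζ)) * (1392004 * (q ^ 2 : ℝ)) := by gcongr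
      _ = _ := by ring
  have hS3 : (S.card : ℝ) * ζ ^ 3 ≤ 15361 * 1392004 * q ^ 2 := by
    refine le_trans ?_ hprod
    gcongr
  have hz2 : (|(z₂ : ℝ)| + 1) * (k * ζ) ≤ 4 * q := by linarith
  have : (S.card : ℝ) * (|(f₀ : ℝ)| * (|(z₂ : ℝ)| + 1)) * (k * ζ ^ 4 * q ^ 2) ≤
      10 ^ 15 * (k ^ 3 * q) * (k * ζ ^ 4 * q ^ 2) := by
    calc _ = (S.card * ζ ^ 3) * ((|(f₀ : ℝ)| * q ^ 2) * ((|(z₂ : ℝ)| + 1) * (k * ζ))) := by ring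
      _ ≤ (15361 * 1392004 * q ^ 2) * ((7680 * k ^ 4 * ζ ^ 4) * (4 * q)) := by gcongr
      _ = 15361 * 1392004 * 30720 * (k ^ 4 * ζ ^ 4 * q ^ 3) := by ring
      _ ≤ 10 ^ 15 * (k ^ 4 * ζ ^ 4 * q ^ 3) := by gcongr; norm_num
      _ = _ := by ring
  exact le_of_mul_le_mul_right this (by positivity)

theorem card_forms_le_of_z₂ {k q z₁ z₂ f₀ : ℤ} (hk : 1 ≤ k) (hkq : 2 * k ^ 3 < q) (hf₀ : f₀ ≠ 0)
    (S : Finset (ℤ × ℤ × ℤ × ℤ))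
    (hS : ∀ s ∈ S, IsForm k q z₁ z₂ f₀ s.1 s.2.1 s.2.2.1 s.2.2.2)
    (hS' : ∀ s ∈ S, z₂ ≠ 0 ∧ |(f₀ : ℝ)| * z₂ ^ 4 ≤ 480 * q ^ 2 ∧ |(s.2.1 : ℝ)| ≤ 720 * k ^ 2 ∧
      |(s.2.2.1 : ℝ)| * q ≤ 3840 * k ^ 3 * z₂ ^ 2 ∧
      |(s.2.2.2 : ℝ)| * q ^ 2 ≤ 7680 * k ^ 4 * z₂ ^ 4 ∧ (q : ℝ) ≤ 8 * k * z₂ ^ 2) :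
    (S.card : ℝ) * (|(f₀ : ℝ)| * (|(z₂ : ℝ)| + 1)) ≤ 10 ^ 15 * (k ^ 3 * q) := by
  have hk' : (1 : ℝ) ≤ k := by exact_mod_cast hk
  have hkq' : 2 * (k : ℝ) ^ 3 < q := by exact_mod_cast hkq
  have hk0 : (0 : ℝ) < k := by linarith
  have hq0 : (0 : ℝ) < q := by have : (0 : ℝ) < k ^ 3 := by positivity
                               linarith
  rcases S.eq_empty_or_nonempty with rfl | ⟨s₀, hs₀⟩
  · simp only [Finset.card_empty, Nat.cast_zero, zero_mul]; positivity
  have hform := hS s₀ hs₀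
  have hc := hform.coprime.symm
  have hz1 := hform.z₁_ne
  obtain ⟨hz, hf0, -, -, -, hqη⟩ := hS' s₀ hs₀
  set η := |(z₂ : ℝ)| with hηdef
  have hη : (1 : ℝ) ≤ η := by rw [hηdef]; exact_mod_cast Int.one_le_abs hz
  have hη0 : 0 < η := by linarith
  have hsq : (z₂ : ℝ) ^ 2 = η ^ 2 := (sq_abs _).symm
  have hq4 : (z₂ : ℝ) ^ 4 = η ^ 4 := by
    rw [show (z₂ : ℝ) ^ 4 = ((z₂ : ℝ) ^ 2) ^ 2 by ring, hsq]; ring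
  have hf1 : (1 : ℝ) ≤ |(f₀ : ℝ)| := by exact_mod_cast Int.one_le_abs hf₀
  rw [hq4] at hf0
  rw [hsq] at hqη
  simp only [hsq, hq4] at hS'
  have hcount : (S.card : ℝ) ≤ (2 * (7680 * k ^ 4 * η ^ 4 / q ^ 2) / η + 1) *
      ((2 * (3840 * k ^ 3 * η ^ 2 / q) / η + 1) * (2 * (720 * k ^ 2) / η + 1)) := by
    let e : ℤ × ℤ × ℤ × ℤ → ℤ × ℤ × ℤ × ℤ := fun s => (s.2.2.2, s.2.2.1, s.2.1, s.1)
    have he : Function.Injective e := by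
      intro s t hst
      simp only [e, Prod.mk.injEq] at hst
      exact Prod.ext hst.2.2.2 (Prod.ext hst.2.2.1 (Prod.ext hst.2.1 hst.1))
    have := card_le_of_successive_congr |z₂| (abs_pos.mpr hz) (7680 * k ^ 4 * η ^ 4 / q ^ 2)
      (3840 * k ^ 3 * η ^ 2 / q) (720 * k ^ 2) (by positivity) (by positivity) (by positivity)
      (S.image e) ?_ ?_ ?_ ?_ ?_
    · rw [Finset.card_image_of_injective _ he] at this
      simpa [hηdef] using this
    all_goals simp only [Finset.forall_mem_image, e]
    · intro s hs
      obtain ⟨-, -, h1, h2, h3, -⟩ := hS' s hs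
      exact ⟨by rwa [le_div_iff₀ (by positivity)], by rwa [le_div_iff₀ hq0], h1⟩
    · intro s hs t ht
      rw [abs_dvd]
      refine (hc.pow_right (n := 4)).dvd_of_dvd_mul_left
        ⟨z₂ ^ 2 * z₁ * (s.1 - t.1) - z₂ * z₁ ^ 2 * (s.2.1 - t.2.1)
          + z₁ ^ 3 * (s.2.2.1 - t.2.2.1), ?_⟩
      linear_combination (hS t ht).eqn - (hS s hs).eqn
    · intro s hs t ht h1
      rw [abs_dvd]
      refine dvd_of_eqn_eq 3 hz hc 1
        (z₁ ^ 2 * (s.2.1 - t.2.1) - z₂ * z₁ * (s.1 - t.1)) ?_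
      have e1 := (hS s hs).eqn
      rw [h1] at e1
      linear_combination e1 - (hS t ht).eqn
    · intro s hs t ht h1 h2
      rw [abs_dvd]
      refine dvd_of_eqn_eq 2 hz hc 2 (z₁ * (s.1 - t.1)) ?_
      have e1 := (hS s hs).eqn
      rw [h1, h2] at e1
      linear_combination (hS t ht).eqn - e1
    · intro s hs t ht h1 h2 h3
      have e1 := (hS s hs).eqn
      rw [h1, h2, h3] at e1
      apply mul_right_cancel₀ (mul_ne_zero (pow_ne_zero 3 hz) hz1)
      linear_combination e1 - (hS t ht).eqn
  have hη4 : η ^ 4 ≤ 480 * q ^ 2 := by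
    calc η ^ 4 = 1 * η ^ 4 := by ring
      _ ≤ |(f₀ : ℝ)| * η ^ 4 := by gcongr
      _ ≤ _ := hf0
  have hη2 : η ^ 2 ≤ 22 * q := by
    refine le_of_sq_le_sq ?_ (by positivity) |> fun h => h
    nlinarith
  have hkk : (k : ℝ) ≤ k ^ 3 := le_self_pow₀ hk' (by norm_num)
  have hkq'' : (k : ℝ) ≤ q := by linarith
  have hkk2 : (k : ℝ) ^ 2 ≤ k ^ 3 := pow_le_pow_right₀ hk' (by norm_num)
  have hk2 : (k : ℝ) ^ 2 ≤ 4 * η ^ 2 := by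
    have : (k : ℝ) ^ 2 * (2 * k) ≤ 4 * η ^ 2 * (2 * k) := by linarith
    exact le_of_mul_le_mul_right this (by positivity)
  have hkη : k * η ≤ 12 * q := by nlinarith [sq_nonneg (k - η)]
  have hη23 : η ^ 2 ≤ η ^ 4 := pow_le_pow_right₀ hη (by norm_num)
  have hη34 : η ^ 3 ≤ η ^ 4 := pow_le_pow_right₀ hη (by norm_num)
  have hprod : (2 * (7680 * k ^ 4 * η ^ 4 / q ^ 2) / η + 1) *
      ((2 * (3840 * k ^ 3 * η ^ 2 / q) / η + 1) * (2 * (720 * k ^ 2) / η + 1)) * q ≤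
      10 ^ 12 * (k ^ 3 * η ^ 3) := by
    have e0 : (2 * (7680 * k ^ 4 * η ^ 4 / q ^ 2) / η + 1) *
      ((2 * (3840 * k ^ 3 * η ^ 2 / q) / η + 1) * (2 * (720 * k ^ 2) / η + 1)) * q =
      (15360 * k ^ 4 * η ^ 3 + q ^ 2) * ((7680 * k ^ 3 * η + q) * (1440 * k ^ 2 + η)) /
        (q ^ 2 * η) := by
      field_simp
      ring
    rw [e0, div_le_iff₀ (by positivity)]
    set M : ℝ := k ^ 3 * η ^ 4 * q ^ 2 with hM
    have hM0 : 0 ≤ M := by positivity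
    have t1 : k ^ 9 * η ^ 4 ≤ M := by
      have : (k : ℝ) ^ 3 * k ^ 3 ≤ q * q := by gcongr <;> linarith
      calc k ^ 9 * η ^ 4 = k ^ 3 * η ^ 4 * (k ^ 3 * k ^ 3) := by ring
        _ ≤ k ^ 3 * η ^ 4 * (q * q) := by gcongr
        _ = _ := by rw [hM]; ring
    have t2 : k ^ 7 * η ^ 5 ≤ 12 * M := by
      calc k ^ 7 * η ^ 5 = k ^ 3 * η ^ 4 * (k ^ 3 * (k * η)) := by ring
        _ ≤ k ^ 3 * η ^ 4 * (q * (12 * q)) := by gcongr; linarith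
        _ = _ := by rw [hM]; ring
    have t3 : k ^ 6 * q * η ^ 3 ≤ M := by
      calc k ^ 6 * q * η ^ 3 = k ^ 3 * η ^ 3 * (k ^ 3 * q) := by ring
        _ ≤ k ^ 3 * η ^ 4 * (q * q) := by gcongr; linarith
        _ = _ := by rw [hM]; ring
    have t4 : k ^ 4 * q * η ^ 4 ≤ M := by
      calc k ^ 4 * q * η ^ 4 = k ^ 3 * η ^ 4 * (k * q) := by ring
        _ ≤ k ^ 3 * η ^ 4 * (q * q) :=
          mul_le_mul_of_nonneg_left (mul_le_mul_of_nonneg_right hkq'' hq0.le) (by positivity)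
        _ = _ := by rw [hM]; ring
    have t5 : q ^ 2 * k ^ 5 * η ≤ 4 * M := by
      calc q ^ 2 * k ^ 5 * η = q ^ 2 * k ^ 3 * η * k ^ 2 := by ring
        _ ≤ q ^ 2 * k ^ 3 * η * (4 * η ^ 2) := by gcongr
        _ = 4 * (q ^ 2 * k ^ 3 * η ^ 3) := by ring
        _ ≤ 4 * (q ^ 2 * k ^ 3 * η ^ 4) := by gcongr
        _ = _ := by rw [hM]; ring
    have t6 : q ^ 2 * k ^ 3 * η ^ 2 ≤ M := by
      calc q ^ 2 * k ^ 3 * η ^ 2 ≤ q ^ 2 * k ^ 3 * η ^ 4 := by gcongr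
        _ = _ := by rw [hM]; ring
    have t7 : q ^ 3 * k ^ 2 ≤ 8 * M := by
      calc (q ^ 3 * k ^ 2 : ℝ) = q ^ 2 * k ^ 2 * q := by ring
        _ ≤ q ^ 2 * k ^ 2 * (8 * k * η ^ 2) := by gcongr
        _ = 8 * (q ^ 2 * k ^ 3 * η ^ 2) := by ring
        _ ≤ _ := by linarith
    have t8 : q ^ 3 * η ≤ 8 * M := by
      calc (q ^ 3 * η : ℝ) = q ^ 2 * η * q := by ring
        _ ≤ q ^ 2 * η * (8 * k * η ^ 2) := by gcongr
        _ = 8 * (q ^ 2 * k * η ^ 3) := by ring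
        _ ≤ 8 * (q ^ 2 * k ^ 3 * η ^ 4) := by gcongr
        _ = _ := by rw [hM]; ring
    have : 10 ^ 12 * (k ^ 3 * η ^ 3) * (q ^ 2 * η) = 10 ^ 12 * M := by rw [hM]; ring
    rw [this]
    linarith
  have hS3 : (S.card : ℝ) * q ≤ 10 ^ 12 * (k ^ 3 * η ^ 3) := by
    refine le_trans ?_ hprod
    gcongr
  have : (S.card : ℝ) * (|(f₀ : ℝ)| * (η + 1)) * (q * η ^ 4) ≤
      10 ^ 15 * (k ^ 3 * q) * (q * η ^ 4) := by
    calc _ = (S.card * q) * ((|(f₀ : ℝ)| * η ^ 4) * (η + 1)) := by ring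
      _ ≤ (10 ^ 12 * (k ^ 3 * η ^ 3)) * ((480 * q ^ 2) * (2 * η)) := by gcongr; linarith
      _ = 10 ^ 12 * 960 * (k ^ 3 * η ^ 4 * q ^ 2) := by ring
      _ ≤ 10 ^ 15 * (k ^ 3 * η ^ 4 * q ^ 2) := by gcongr; norm_num
      _ = _ := by ring
  exact le_of_mul_le_mul_right this (by positivity)

theorem card_forms_le {k q z₁ z₂ f₀ : ℤ} (hk : 1 ≤ k) (hkq : 2 * k ^ 3 < q) (hf₀ : f₀ ≠ 0)
    (S : Finset (ℤ × ℤ × ℤ × ℤ))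
    (hS : ∀ s ∈ S, IsForm k q z₁ z₂ f₀ s.1 s.2.1 s.2.2.1 s.2.2.2) :
    (S.card : ℝ) * (|(f₀ : ℝ)| * (|(z₂ : ℝ)| + 1)) ≤ 2 * 10 ^ 15 * (k ^ 3 * q) := by
  classical
  rw [← Finset.card_filter_add_card_filter_not (s := S)
    (fun s => |(f₀ : ℝ)| * q ^ 2 ≤ 7680 * k ^ 4 * z₁ ^ 4 ∧
      |(s.1 : ℝ)| * q ≤ 15360 * k ^ 3 * z₁ ^ 2 ∧
      |(s.2.1 : ℝ)| ≤ 720 * k ^ 2 ∧ |(s.2.2.1 : ℝ)| * z₁ ^ 2 ≤ 960 * k * q)]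
  push_cast
  rw [add_mul, show (2 * 10 ^ 15 * (k ^ 3 * q) : ℝ) =
    10 ^ 15 * (k ^ 3 * q) + 10 ^ 15 * (k ^ 3 * q) by ring]
  refine add_le_add (card_forms_le_of_z₁ (z₁ := z₁) hk hkq _ ?_ ?_)
    (card_forms_le_of_z₂ (z₁ := z₁) hk hkq hf₀ _ ?_ ?_)
  · exact fun s hs => hS s (Finset.mem_filter.mp hs).1
  · exact fun s hs => (Finset.mem_filter.mp hs).2
  · exact fun s hs => hS s (Finset.mem_filter.mp hs).1
  · exact fun s hs => ((hS s (Finset.mem_filter.mp hs).1).cases).resolve_left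
      (Finset.mem_filter.mp hs).2

theorem card_le_two_mul_card_divisors {n : ℤ} (hn : n ≠ 0) (S : Finset ℤ) (hS : ∀ z ∈ S, z ∣ n) :
    S.card ≤ 2 * n.natAbs.divisors.card := by
  have hsub : S ⊆ n.natAbs.divisors.image (fun d : ℕ => (d : ℤ)) ∪
      n.natAbs.divisors.image (fun d : ℕ => -(d : ℤ)) := by
    intro z hz
    have hmem : z.natAbs ∈ n.natAbs.divisors :=
      Nat.mem_divisors.mpr ⟨Int.natAbs_dvd_natAbs.mpr (hS z hz), Int.natAbs_ne_zero.mpr hn⟩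
    rw [Finset.mem_union, Finset.mem_image, Finset.mem_image]
    rcases Int.natAbs_eq z with h | h
    · exact Or.inl ⟨_, hmem, h.symm⟩
    · exact Or.inr ⟨_, hmem, h.symm⟩
  calc S.card ≤ _ := Finset.card_le_card hsub
    _ ≤ _ := Finset.card_union_le _ _
    _ ≤ n.natAbs.divisors.card + n.natAbs.divisors.card :=
      add_le_add Finset.card_image_le Finset.card_image_le
    _ = _ := by ring

theorem sum_one_div_le_one_add_log (N : ℕ) :
    ∑ n ∈ Finset.range N, 1 / ((n : ℝ) + 1) ≤ 1 + Real.log N := by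
  have := harmonic_le_one_add_log N
  simpa [harmonic] using this

theorem sum_one_div_abs_add_one_le (B : ℕ) :
    ∑ z ∈ Finset.Icc (-(B : ℤ)) B, 1 / (|(z : ℝ)| + 1) ≤ 2 * (1 + Real.log (B + 1)) := by
  have hsub : Finset.Icc (-(B : ℤ)) B ⊆ (Finset.range (B + 1)).image (fun d : ℕ => (d : ℤ)) ∪
      (Finset.range (B + 1)).image (fun d : ℕ => -(d : ℤ)) := by
    intro z hz
    rw [Finset.mem_Icc] at hz
    have hmem : z.natAbs ∈ Finset.range (B + 1) := Finset.mem_range.mpr (by omega)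
    rw [Finset.mem_union, Finset.mem_image, Finset.mem_image]
    rcases Int.natAbs_eq z with h | h
    · exact Or.inl ⟨_, hmem, h.symm⟩
    · exact Or.inr ⟨_, hmem, h.symm⟩
  have hnn : ∀ z : ℤ, 0 ≤ 1 / (|(z : ℝ)| + 1) := fun z => by positivity
  have h1 := sum_one_div_le_one_add_log (B + 1)
  push_cast at h1
  calc _ ≤ _ := Finset.sum_le_sum_of_subset_of_nonneg hsub fun z _ _ => hnn z
    _ ≤ (∑ z ∈ (Finset.range (B + 1)).image (fun d : ℕ => (d : ℤ)), 1 / (|(z : ℝ)| + 1)) +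
        ∑ z ∈ (Finset.range (B + 1)).image (fun d : ℕ => -(d : ℤ)), 1 / (|(z : ℝ)| + 1) := by
      rw [← Finset.sum_union_inter]
      exact le_add_of_nonneg_right (Finset.sum_nonneg fun z _ => hnn z)
    _ = (∑ n ∈ Finset.range (B + 1), 1 / ((n : ℝ) + 1)) +
        ∑ n ∈ Finset.range (B + 1), 1 / ((n : ℝ) + 1) := by
      rw [Finset.sum_image (fun a _ b _ h => by simpa using h),
        Finset.sum_image (fun a _ b _ h => by simpa using h)]
      simp
    _ ≤ _ := by linarith

theorem card_isForm_fiber_le {k q z₁ z₂ f₀ : ℤ} (hk : 1 ≤ k) (hkq : 2 * k ^ 3 < q) (hf₀ : f₀ ≠ 0)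
    (D : Finset (ℤ × ℤ × ℤ × ℤ × ℤ × ℤ × ℤ))
    (hD : ∀ d ∈ D, IsForm k q d.2.2.1 d.1 d.2.1 d.2.2.2.1 d.2.2.2.2.1 d.2.2.2.2.2.1
      d.2.2.2.2.2.2)
    (hz : ∀ d ∈ D, d.1 = z₂ ∧ d.2.1 = f₀ ∧ d.2.2.1 = z₁) :
    (D.card : ℝ) ≤ 2 * 10 ^ 15 * (k ^ 3 * q) / (|(f₀ : ℝ)| * (|(z₂ : ℝ)| + 1)) := by
  have hf : 0 < |(f₀ : ℝ)| := abs_pos.mpr (by exact_mod_cast hf₀)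
  rw [le_div_iff₀ (by positivity)]
  rw [← Finset.card_image_of_injOn (f := fun d : ℤ × ℤ × ℤ × ℤ × ℤ × ℤ × ℤ => d.2.2.2)]
  · refine card_forms_le (z₁ := z₁) hk hkq hf₀ _ ?_
    simp only [Finset.forall_mem_image]
    intro d hd
    obtain ⟨h1, h2, h3⟩ := hz d hd
    have := hD d hd
    rwa [h1, h2, h3] at this
  · intro d hd e he hde
    obtain ⟨h1, h2, h3⟩ := hz d hd
    obtain ⟨h1', h2', h3'⟩ := hz e he
    exact Prod.ext (h1.trans h1'.symm) (Prod.ext (h2.trans h2'.symm)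
      (Prod.ext (h3.trans h3'.symm) hde))

theorem IsForm.abs_z₂_le {k q z₁ z₂ f₀ f₁ f₂ f₃ f₄ : ℤ} (hk : 1 ≤ k)
    (h : IsForm k q z₁ z₂ f₀ f₁ f₂ f₃ f₄) : |z₂| ≤ 2 * q := by
  have h1 := Int.one_le_abs h.z₁_ne
  have h2 := h.z₁_z₂
  have h3 := abs_nonneg z₂
  nlinarith [mul_nonneg (sub_nonneg.mpr h1) h3,
    mul_nonneg (sub_nonneg.mpr hk) (mul_nonneg (abs_nonneg z₁) h3)]

theorem card_isForm_le_of_ne {k q : ℤ} (hk : 1 ≤ k) (hkq : 2 * k ^ 3 < q) (M : ℝ)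
    (hM : ∀ n : ℕ, n ≠ 0 → (n : ℝ) ≤ 2000 * q ^ 6 → (n.divisors.card : ℝ) ≤ M)
    (D : Finset (ℤ × ℤ × ℤ × ℤ × ℤ × ℤ × ℤ))
    (hD : ∀ d ∈ D, IsForm k q d.2.2.1 d.1 d.2.1 d.2.2.2.1 d.2.2.2.2.1 d.2.2.2.2.2.1
      d.2.2.2.2.2.2)
    (hf : ∀ d ∈ D, d.2.1 ≠ 0) (hne : ∀ d ∈ D, q ^ 2 ≠ d.2.1 * d.1 ^ 4) :
    (D.card : ℝ) ≤ 32 * 10 ^ 15 * M * (1 + Real.log (121 * q)) ^ 2 * (k ^ 3 * q) := by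
  have hk3 : k ^ 2 ≤ k ^ 3 := pow_le_pow_right₀ hk (by norm_num)
  have hk1 : 1 ≤ k ^ 2 := one_le_pow₀ hk
  have hq : 1 ≤ q := by linarith
  have hq' : (1 : ℝ) ≤ q := by exact_mod_cast hq
  have hk0 : (0 : ℝ) < k := by exact_mod_cast (by linarith : 0 < k)
  have hM0 : 0 ≤ M := (Nat.cast_nonneg _).trans
    (hM 1 one_ne_zero (by norm_num; nlinarith [one_le_pow₀ hq' (n := 6)]))
  set K : ℝ := 2 * 10 ^ 15 * (k ^ 3 * q) with hK
  have hK0 : 0 ≤ K := by positivity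
  set B : ℕ := (120 * q).toNat with hB
  have hBz : (B : ℤ) = 120 * q := Int.toNat_of_nonneg (by linarith)
  have hBr : (B : ℝ) = 120 * q := by exact_mod_cast hBz
  have key := card_le_sum_card_fiber D (Finset.Icc (-(B : ℤ)) B ×ˢ Finset.Icc (-(B : ℤ)) B)
    (fun d => (d.1, d.2.1))
    (by
      intro d hd
      have h := hD d hd
      have h1 := abs_le.mp (h.abs_z₂_le hk)
      have h2 := abs_le.mp h.abs_f₀
      rw [Finset.mem_product, Finset.mem_Icc, Finset.mem_Icc, hBz]
      refine ⟨⟨?_, ?_⟩, ?_, ?_⟩ <;> dsimp only <;> linarith)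
    (fun b => (4 * M * K) * ((1 / (|(b.1 : ℝ)| + 1)) * (1 / (|(b.2 : ℝ)| + 1))))
    (by
      rintro ⟨z₂, f₀⟩ -
      dsimp only
      set F := D.filter (fun d => (d.1, d.2.1) = (z₂, f₀)) with hF
      rcases F.eq_empty_or_nonempty with h0 | ⟨d₀, hd₀⟩
      · rw [h0, Finset.card_empty, Nat.cast_zero]; positivity
      have hFm : ∀ d ∈ F, d ∈ D ∧ d.1 = z₂ ∧ d.2.1 = f₀ := by
        intro d hd
        rw [hF, Finset.mem_filter, Prod.mk.injEq] at hd
        exact hd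
      obtain ⟨hd₀D, hd₀z, hd₀f⟩ := hFm d₀ hd₀
      have hf₀ : f₀ ≠ 0 := hd₀f ▸ hf d₀ hd₀D
      have hn : q ^ 2 - f₀ * z₂ ^ 4 ≠ 0 := by
        rw [← hd₀f, ← hd₀z]; exact sub_ne_zero.mpr (hne d₀ hd₀D)
      have hf₀1 : (1 : ℝ) ≤ |(f₀ : ℝ)| := by exact_mod_cast Int.one_le_abs hf₀
      have habs : |q ^ 2 - f₀ * z₂ ^ 4| ≤ 2000 * q ^ 6 := by
        have h := hD d₀ hd₀D
        have h1 := h.abs_z₂_le hk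
        have h2 := h.abs_f₀
        rw [hd₀z] at h1
        rw [hd₀f] at h2
        have h3 : |z₂| ^ 4 ≤ (2 * q) ^ 4 := by gcongr
        have h4 : |f₀| ≤ 120 * q := by linarith
        calc |q ^ 2 - f₀ * z₂ ^ 4| ≤ |q ^ 2| + |f₀ * z₂ ^ 4| := abs_sub _ _
          _ = q ^ 2 + |f₀| * |z₂| ^ 4 := by
            rw [abs_mul, abs_pow, abs_pow, abs_of_pos (by linarith : 0 < q)]
          _ ≤ q ^ 2 + (120 * q) * (2 * q) ^ 4 := by gcongr
          _ = q ^ 2 + 1920 * q ^ 5 := by ring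
          _ ≤ q ^ 6 + 1920 * q ^ 6 := by
            have a1 : q ^ 2 ≤ q ^ 6 := pow_le_pow_right₀ hq (by norm_num)
            have a2 : q ^ 5 ≤ q ^ 6 := pow_le_pow_right₀ hq (by norm_num)
            linarith
          _ ≤ _ := by linarith [pow_nonneg (by linarith : 0 ≤ q) 6]
      have := card_le_mul_of_fiber F (fun d => d.2.2.1) (2 * M)
        (K / (|(f₀ : ℝ)| * (|(z₂ : ℝ)| + 1))) (by positivity) ?_ ?_
      · refine this.trans ?_
        have : K / (|(f₀ : ℝ)| * (|(z₂ : ℝ)| + 1)) ≤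
            2 * K * ((1 / (|(z₂ : ℝ)| + 1)) * (1 / (|(f₀ : ℝ)| + 1))) := by
          rw [one_div_mul_one_div, mul_one_div, div_le_div_iff₀ (by positivity) (by positivity)]
          have : |(f₀ : ℝ)| + 1 ≤ 2 * |(f₀ : ℝ)| := by linarith
          calc K * ((|(z₂ : ℝ)| + 1) * (|(f₀ : ℝ)| + 1))
              ≤ K * ((|(z₂ : ℝ)| + 1) * (2 * |(f₀ : ℝ)|)) := by gcongr
            _ = _ := by ring
        calc _ ≤ 2 * M * (2 * K * ((1 / (|(z₂ : ℝ)| + 1)) * (1 / (|(f₀ : ℝ)| + 1)))) := by gcongr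
          _ = _ := by ring
      · have h1 := card_le_two_mul_card_divisors hn (F.image fun d => d.2.2.1) (by
          simp only [Finset.forall_mem_image]
          intro d hd
          obtain ⟨hdD, hdz, hdf⟩ := hFm d hd
          have e := (hD d hdD).eqn
          rw [hdz, hdf] at e
          exact ⟨-d.2.2.2.1 * z₂ ^ 3 + d.2.2.2.2.1 * z₂ ^ 2 * d.2.2.1
            - d.2.2.2.2.2.1 * z₂ * d.2.2.1 ^ 2 + d.2.2.2.2.2.2 * d.2.2.1 ^ 3, by
              linear_combination e⟩)
        have h2 := hM (q ^ 2 - f₀ * z₂ ^ 4).natAbs (Int.natAbs_ne_zero.mpr hn) (by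
          rw [Nat.cast_natAbs]; exact_mod_cast habs)
        calc _ ≤ ((2 * (q ^ 2 - f₀ * z₂ ^ 4).natAbs.divisors.card : ℕ) : ℝ) := by exact_mod_cast h1
          _ ≤ _ := by push_cast; linarith
      · intro z₁ _
        refine card_isForm_fiber_le (z₁ := z₁) hk hkq hf₀ _ ?_ ?_
        · exact fun d hd => hD d (hFm d (Finset.mem_filter.mp hd).1).1
        · intro d hd
          rw [Finset.mem_filter] at hd
          exact ⟨(hFm d hd.1).2.1, (hFm d hd.1).2.2, hd.2⟩)
  refine key.trans ?_
  rw [← Finset.mul_sum, Finset.sum_product]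
  simp only
  rw [← Finset.sum_mul_sum]
  set H := ∑ z ∈ Finset.Icc (-(B : ℤ)) B, 1 / (|(z : ℝ)| + 1) with hH
  have hH0 : 0 ≤ H := Finset.sum_nonneg fun z _ => by positivity
  have hHle : H ≤ 2 * (1 + Real.log (121 * q)) := by
    refine (sum_one_div_abs_add_one_le B).trans ?_
    have : Real.log (B + 1) ≤ Real.log (121 * q) := by
      apply Real.log_le_log (by positivity)
      rw [hBr]; linarith
    linarith
  have hL0 : 0 ≤ Real.log (121 * q) := Real.log_nonneg (by linarith)
  calc 4 * M * K * (H * H)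
      ≤ 4 * M * K * ((2 * (1 + Real.log (121 * q))) * (2 * (1 + Real.log (121 * q)))) := by gcongr
    _ = 16 * M * K * (1 + Real.log (121 * q)) ^ 2 := by ring
    _ = _ := by rw [hK]; ring

theorem card_isForm_le_of_eq {k q : ℤ} (hk : 1 ≤ k) (hkq : 2 * k ^ 3 < q) (M : ℝ)
    (hM : ∀ n : ℕ, n ≠ 0 → (n : ℝ) ≤ 2000 * q ^ 6 → (n.divisors.card : ℝ) ≤ M)
    (D : Finset (ℤ × ℤ × ℤ × ℤ × ℤ × ℤ × ℤ))
    (hD : ∀ d ∈ D, IsForm k q d.2.2.1 d.1 d.2.1 d.2.2.2.1 d.2.2.2.2.1 d.2.2.2.2.2.1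
      d.2.2.2.2.2.2)
    (heq : ∀ d ∈ D, q ^ 2 = d.2.1 * d.1 ^ 4) :
    (D.card : ℝ) ≤ 20 * 10 ^ 15 * M * (k ^ 3 * q) := by
  have hk1 : 1 ≤ k ^ 3 := one_le_pow₀ hk
  have hq : 1 ≤ q := by linarith
  have hq' : (1 : ℝ) ≤ q := by exact_mod_cast hq
  have hk' : (1 : ℝ) ≤ k := by exact_mod_cast hk
  have hk0 : (0 : ℝ) < k := by linarith
  set K : ℝ := 2 * 10 ^ 15 * (k ^ 3 * q) with hK
  have hK0 : 0 ≤ K := by positivity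
  have hsq : ∀ d ∈ D, d.1 ^ 2 ∣ q := by
    intro d hd
    rw [← Int.pow_dvd_pow_iff (two_ne_zero), heq d hd]
    exact ⟨d.2.1, by ring⟩
  have key := card_le_mul_of_fiber D (fun d => d.1) (2 * M) (5 * K) (by positivity) ?_ ?_
  · exact key.trans (by rw [hK]; ring_nf; exact le_rfl)
  · have h1 := card_le_two_mul_card_divisors (by linarith : q ≠ 0) (D.image fun d => d.1) (by
      simp only [Finset.forall_mem_image]
      exact fun d hd => (dvd_pow_self _ two_ne_zero).trans (hsq d hd))
    have h2 := hM q.natAbs (by omega) (by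
      rw [Nat.cast_natAbs, abs_of_pos (by linarith)]
      have : (q : ℝ) ≤ q ^ 6 := le_self_pow₀ hq' (by norm_num)
      linarith)
    calc _ ≤ ((2 * q.natAbs.divisors.card : ℕ) : ℝ) := by exact_mod_cast h1
      _ ≤ _ := by push_cast; linarith
  intro z₂ hz₂
  set F := D.filter (fun d => d.1 = z₂) with hF
  obtain ⟨d₀, hd₀, rfl⟩ := Finset.mem_image.mp hz₂
  set z₂ := d₀.1 with hz₂
  set f₀ := d₀.2.1 with hf₀d
  have hqf : q ^ 2 = f₀ * z₂ ^ 4 := heq d₀ hd₀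
  have hq2 : q ^ 2 ≠ 0 := pow_ne_zero _ (by linarith)
  have hz0 : z₂ ≠ 0 := by rintro h; rw [h] at hqf; simp at hqf; omega
  have hf0 : f₀ ≠ 0 := by rintro h; rw [h] at hqf; simp at hqf; omega
  set ζ := |(z₂ : ℝ)| with hζ
  have hζ1 : 1 ≤ ζ := by rw [hζ]; exact_mod_cast Int.one_le_abs hz0
  have hζ0 : 0 < ζ := by linarith
  have hf1 : 0 < |(f₀ : ℝ)| := abs_pos.mpr (by exact_mod_cast hf0)
  have hqr : (q : ℝ) ^ 2 = |(f₀ : ℝ)| * ζ ^ 4 := by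
    have : |((q ^ 2 : ℤ) : ℝ)| = |((f₀ * z₂ ^ 4 : ℤ) : ℝ)| := by rw [hqf]
    push_cast at this
    rwa [abs_mul, abs_pow, abs_pow, abs_of_pos (by linarith : (0 : ℝ) < q)] at this
  have hzq : ζ ^ 2 ≤ q := by
    have := Int.le_of_dvd (by linarith) (hsq d₀ hd₀)
    rw [hζ, sq_abs]; exact_mod_cast this
  have hzq' : ζ ≤ q := (le_self_pow₀ hζ1 two_ne_zero).trans hzq
  have := card_le_mul_of_fiber F (fun d => d.2.2.1) (5 * q / ζ)
    (K / (|(f₀ : ℝ)| * (ζ + 1))) (by positivity) ?_ ?_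
  · refine this.trans ?_
    rw [div_mul_div_comm, div_le_iff₀ (by positivity)]
    have : (q : ℝ) ≤ ζ * (|(f₀ : ℝ)| * (ζ + 1)) := by
      have h1 : (q : ℝ) * q ≤ q * (ζ * (|(f₀ : ℝ)| * (ζ + 1))) := by
        calc (q : ℝ) * q = |(f₀ : ℝ)| * ζ ^ 2 * ζ ^ 2 := by rw [← sq, hqr]; ring
          _ ≤ |(f₀ : ℝ)| * ζ ^ 2 * q := by gcongr
          _ = q * (ζ * (|(f₀ : ℝ)| * ζ)) := by ring
          _ ≤ _ := by gcongr; linarith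
      exact le_of_mul_le_mul_left h1 (by linarith)
    calc 5 * q * K = 5 * K * q := by ring
      _ ≤ _ := by gcongr
  · refine (card_le_of_abs_le (2 * q / ζ) (by positivity) _ ?_).trans ?_
    · simp only [Finset.forall_mem_image]
      intro d hd
      rw [hF, Finset.mem_filter] at hd
      have h := (hD d hd.1).z₁_z₂
      rw [hd.2] at h
      have h' : (k : ℝ) * (|(d.2.2.1 : ℝ)| * ζ) ≤ 2 * q := by rw [hζ]; exact_mod_cast h
      rw [le_div_iff₀ hζ0]
      refine le_trans ?_ h'
      exact le_mul_of_one_le_left (by positivity) hk'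
    · rw [mul_div_assoc', div_add_one hζ0.ne']
      gcongr
      linarith
  · intro z₁ _
    refine card_isForm_fiber_le (z₁ := z₁) hk hkq hf0 _ ?_ ?_
    · exact fun d hd => hD d (Finset.mem_filter.mp (Finset.mem_filter.mp hd).1).1
    · intro d hd
      rw [Finset.mem_filter, hF, Finset.mem_filter] at hd
      refine ⟨hd.1.2, ?_, hd.2⟩
      have := heq d hd.1.1
      rw [hd.1.2, hqf] at this
      exact (mul_right_cancel₀ (pow_ne_zero 4 hz0) this).symm

theorem card_isForm_le {k q : ℤ} (hk : 1 ≤ k) (hkq : 2 * k ^ 3 < q) (M : ℝ)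
    (hM : ∀ n : ℕ, n ≠ 0 → (n : ℝ) ≤ 2000 * q ^ 6 → (n.divisors.card : ℝ) ≤ M)
    (D : Finset (ℤ × ℤ × ℤ × ℤ × ℤ × ℤ × ℤ))
    (hD : ∀ d ∈ D, IsForm k q d.2.2.1 d.1 d.2.1 d.2.2.2.1 d.2.2.2.2.1 d.2.2.2.2.2.1
      d.2.2.2.2.2.2)
    (hf : ∀ d ∈ D, d.2.1 ≠ 0) :
    (D.card : ℝ) ≤ 10 ^ 17 * M * (1 + Real.log (121 * q)) ^ 2 * (k ^ 3 * q) := by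
  have hk1 : 1 ≤ k ^ 3 := one_le_pow₀ hk
  have hq' : (1 : ℝ) ≤ q := by exact_mod_cast (by linarith : 1 ≤ q)
  have hk0 : (0 : ℝ) < k := by exact_mod_cast (by linarith : 0 < k)
  have hM0 : 0 ≤ M := (Nat.cast_nonneg _).trans
    (hM 1 one_ne_zero (by norm_num; nlinarith [one_le_pow₀ hq' (n := 6)]))
  have hL : 1 ≤ (1 + Real.log (121 * q)) ^ 2 := by
    have : 0 ≤ Real.log (121 * q) := Real.log_nonneg (by linarith)
    exact one_le_pow₀ (by linarith)
  have h1 := card_isForm_le_of_eq hk hkq M hM (D.filter fun d => q ^ 2 = d.2.1 * d.1 ^ 4)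
    (fun d hd => hD d (Finset.mem_filter.mp hd).1) (fun d hd => (Finset.mem_filter.mp hd).2)
  have h2 := card_isForm_le_of_ne hk hkq M hM (D.filter fun d => ¬ q ^ 2 = d.2.1 * d.1 ^ 4)
    (fun d hd => hD d (Finset.mem_filter.mp hd).1) (fun d hd => hf d (Finset.mem_filter.mp hd).1)
    (fun d hd => (Finset.mem_filter.mp hd).2)
  rw [← Finset.card_filter_add_card_filter_not (s := D) (fun d => q ^ 2 = d.2.1 * d.1 ^ 4)]
  push_cast
  have h3 : 20 * 10 ^ 15 * M * (k ^ 3 * q) * 1 ≤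
      20 * 10 ^ 15 * M * (k ^ 3 * q) * (1 + Real.log (121 * q)) ^ 2 := by gcongr
  have h4 : 0 ≤ M * (k ^ 3 * q) * (1 + Real.log (121 * q)) ^ 2 := by positivity
  linarith

/-- Points with a nondegenerate associated quartic form, counted for a fixed denominator. -/
theorem card_isFormOf_le {k q : ℤ} (hk : 1 ≤ k) (hkq : 2 * k ^ 3 < q) (M : ℝ)
    (hM : ∀ n : ℕ, n ≠ 0 → (n : ℝ) ≤ 2000 * q ^ 6 → (n.divisors.card : ℝ) ≤ M)
    (S : Finset (ℤ × ℤ × ℤ × ℤ))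
    (hS : ∀ t ∈ S, IsPt k q t.1 t.2.1 t.2.2.1 t.2.2.2 ∧ ∃ v₁ z₁ v₂ z₂ f₀ f₁ f₂ f₃ f₄,
      IsFormOf q t.1 t.2.2.1 t.2.2.2 v₁ z₁ v₂ z₂ f₀ f₁ f₂ f₃ f₄ ∧
        IsForm k q z₁ z₂ f₀ f₁ f₂ f₃ f₄ ∧ f₀ ≠ 0) :
    (S.card : ℝ) ≤ 10 ^ 17 * M * (1 + Real.log (121 * q)) ^ 2 * (k ^ 3 * q) := by
  classical
  have hk1 : 1 ≤ k ^ 3 := one_le_pow₀ hk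
  have hS' : ∀ t : ℤ × ℤ × ℤ × ℤ, ∃ d : ℤ × ℤ × ℤ × ℤ × ℤ × ℤ × ℤ, t ∈ S →
      IsPt k q t.1 t.2.1 t.2.2.1 t.2.2.2 ∧
      (∃ v₁ v₂, IsFormOf q t.1 t.2.2.1 t.2.2.2 v₁ d.2.2.1 v₂ d.1 d.2.1 d.2.2.2.1 d.2.2.2.2.1
        d.2.2.2.2.2.1 d.2.2.2.2.2.2) ∧
      IsForm k q d.2.2.1 d.1 d.2.1 d.2.2.2.1 d.2.2.2.2.1 d.2.2.2.2.2.1 d.2.2.2.2.2.2 ∧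
      d.2.1 ≠ 0 := by
    intro t
    by_cases ht : t ∈ S
    · obtain ⟨hpt, v₁, z₁, v₂, z₂, f₀, f₁, f₂, f₃, f₄, h1, h2, h3⟩ := hS t ht
      exact ⟨(z₂, f₀, z₁, f₁, f₂, f₃, f₄), fun _ => ⟨hpt, ⟨v₁, v₂, h1⟩, h2, h3⟩⟩
    · exact ⟨0, fun h => absurd h ht⟩
  choose d hd using hS'
  rw [← Finset.card_image_of_injOn (f := d)]
  · refine card_isForm_le hk hkq M hM _ ?_ ?_ <;> simp only [Finset.forall_mem_image]
    · exact fun t ht => (hd t ht).2.2.1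
    · exact fun t ht => (hd t ht).2.2.2
  · intro s hs t ht hst
    obtain ⟨p1, ⟨v₁, v₂, g1⟩, i1, -⟩ := hd s hs
    obtain ⟨p2, ⟨v₁', v₂', g2⟩, -, -⟩ := hd t ht
    rw [hst] at g1 i1
    obtain ⟨hA, hw, hy⟩ := g1.injective (by linarith) i1.z₁_ne g2
    rw [hA, hw, hy] at p1
    exact Prod.ext hA (Prod.ext (p1.B_eq p2) (Prod.ext hw hy))

/-- The sum over the last coordinate of the sizes of the corresponding fibres. -/
theorem card_le_sum_last (N : ℤ) (S : Finset (ℤ × ℤ × ℤ × ℤ × ℤ))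
    (hS : ∀ t ∈ S, 1 ≤ t.2.2.2.2 ∧ t.2.2.2.2 ≤ N) (P : ℤ → ℤ × ℤ × ℤ × ℤ → Prop)
    (hP : ∀ t ∈ S, P t.2.2.2.2 (t.1, t.2.1, t.2.2.1, t.2.2.2.1)) (g : ℤ → ℝ)
    (hg : ∀ q, 1 ≤ q → q ≤ N → ∀ F : Finset (ℤ × ℤ × ℤ × ℤ), (∀ u ∈ F, P q u) →
      (F.card : ℝ) ≤ g q) :
    (S.card : ℝ) ≤ ∑ q ∈ Finset.Icc 1 N, g q := by
  refine card_le_sum_card_fiber S _ (fun t => t.2.2.2.2)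
    (fun t ht => Finset.mem_Icc.mpr (hS t ht)) g fun q hq => ?_
  rw [Finset.mem_Icc] at hq
  rw [← Finset.card_image_of_injOn
    (f := fun t : ℤ × ℤ × ℤ × ℤ × ℤ => (t.1, t.2.1, t.2.2.1, t.2.2.2.1))]
  · refine hg q hq.1 hq.2 _ ?_
    simp only [Finset.forall_mem_image]
    intro t ht
    rw [Finset.mem_filter] at ht
    have := hP t ht.1
    rwa [ht.2] at this
  · intro s hs t ht hst
    have hs := (Finset.mem_filter.mp hs).2
    have ht := (Finset.mem_filter.mp ht).2
    simp only [Prod.mk.injEq] at hst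
    exact Prod.ext hst.1 (Prod.ext hst.2.1 (Prod.ext hst.2.2.1
      (Prod.ext hst.2.2.2 (hs.trans ht.symm))))

theorem sum_one_div_Icc_le {N : ℤ} (hN : 0 ≤ N) :
    ∑ q ∈ Finset.Icc 1 N, 1 / (q : ℝ) ≤ 1 + Real.log N := by
  have h := sum_one_div_le_one_add_log N.toNat
  have hc : ((N.toNat : ℕ) : ℝ) = N := by exact_mod_cast Int.toNat_of_nonneg hN
  rw [hc] at h
  refine le_trans (le_of_eq ?_) h
  refine Finset.sum_bij' (fun q _ => (q - 1).toNat) (fun n _ => (n : ℤ) + 1) ?_ ?_ ?_ ?_ ?_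
  · intro q hq
    rw [Finset.mem_Icc] at hq
    rw [Finset.mem_range]
    omega
  · intro n hn
    rw [Finset.mem_range] at hn
    rw [Finset.mem_Icc]
    omega
  · intro q hq
    rw [Finset.mem_Icc] at hq
    omega
  · intro n _
    simp
  · intro q hq
    rw [Finset.mem_Icc] at hq
    have : (((q - 1).toNat : ℕ) : ℝ) = q - 1 := by
      exact_mod_cast Int.toNat_of_nonneg (by linarith : 0 ≤ q - 1)
    rw [this, sub_add_cancel]

theorem sum_div_Icc_le {N : ℤ} (hN : 0 ≤ N) {K : ℝ} (hK : 0 ≤ K) :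
    ∑ q ∈ Finset.Icc 1 N, K / (q : ℝ) ≤ K * (1 + Real.log N) := by
  simp only [div_eq_mul_one_div K]
  rw [← Finset.mul_sum]
  exact mul_le_mul_of_nonneg_left (sum_one_div_Icc_le hN) hK

theorem card_nondegenerate_le {k R : ℤ} (hk : 1 ≤ k) (hR : 1 ≤ R) (M : ℝ)
    (hM : ∀ n : ℕ, n ≠ 0 → (n : ℝ) ≤ 2000 * R ^ 6 → (n.divisors.card : ℝ) ≤ M)
    (S : Finset (ℤ × ℤ × ℤ × ℤ × ℤ))
    (hS : ∀ t ∈ S, 2 * k ^ 3 < t.2.2.2.2 ∧ t.2.2.2.2 ≤ R ∧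
      IsPt k t.2.2.2.2 t.1 t.2.1 t.2.2.1 t.2.2.2.1 ∧ ∃ v₁ z₁ v₂ z₂ f₀ f₁ f₂ f₃ f₄,
      IsFormOf t.2.2.2.2 t.1 t.2.2.1 t.2.2.2.1 v₁ z₁ v₂ z₂ f₀ f₁ f₂ f₃ f₄ ∧
        IsForm k t.2.2.2.2 z₁ z₂ f₀ f₁ f₂ f₃ f₄ ∧ f₀ ≠ 0) :
    (S.card : ℝ) ≤ 10 ^ 17 * M * (1 + Real.log (121 * R)) ^ 2 * (k ^ 3 * R ^ 2) := by
  have hk0 : (0 : ℝ) < k := by exact_mod_cast (by linarith : 0 < k)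
  have hR' : (1 : ℝ) ≤ R := by exact_mod_cast hR
  have hM0 : 0 ≤ M := (Nat.cast_nonneg _).trans
    (hM 1 one_ne_zero (by norm_num; nlinarith [one_le_pow₀ hR' (n := 6)]))
  refine (card_le_sum_last R S (fun t ht => ⟨(hS t ht).2.2.1.q_pos, (hS t ht).2.1⟩)
    (fun q u => 2 * k ^ 3 < q ∧ IsPt k q u.1 u.2.1 u.2.2.1 u.2.2.2 ∧
      ∃ v₁ z₁ v₂ z₂ f₀ f₁ f₂ f₃ f₄,
      IsFormOf q u.1 u.2.2.1 u.2.2.2 v₁ z₁ v₂ z₂ f₀ f₁ f₂ f₃ f₄ ∧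
        IsForm k q z₁ z₂ f₀ f₁ f₂ f₃ f₄ ∧ f₀ ≠ 0)
    (fun t ht => ⟨(hS t ht).1, (hS t ht).2.2⟩)
    (fun _ => 10 ^ 17 * M * (1 + Real.log (121 * R)) ^ 2 * (k ^ 3 * R)) ?_).trans ?_
  · intro q hq hqR F hF
    rcases F.eq_empty_or_nonempty with rfl | ⟨u, hu⟩
    · simp only [Finset.card_empty, Nat.cast_zero]; positivity
    have hq' : (1 : ℝ) ≤ q := by exact_mod_cast hq
    have hqR' : (q : ℝ) ≤ R := by exact_mod_cast hqR
    have hlog : 0 ≤ Real.log (121 * q) := Real.log_nonneg (by linarith)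
    have hlog' : Real.log (121 * q) ≤ Real.log (121 * R) :=
      Real.log_le_log (by linarith) (by linarith)
    calc (F.card : ℝ) ≤ 10 ^ 17 * M * (1 + Real.log (121 * q)) ^ 2 * (k ^ 3 * q) :=
        card_isFormOf_le hk (hF u hu).1 M (fun n hn hnq => hM n hn (hnq.trans (by gcongr))) F
          fun u hu => (hF u hu).2
      _ ≤ _ := by gcongr
  · rw [Finset.sum_const, Int.card_Icc, nsmul_eq_mul]
    have : ((R + 1 - 1).toNat : ℝ) = R := by
      rw [add_sub_cancel_right]; exact_mod_cast Int.toNat_of_nonneg (by linarith)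
    rw [this]
    exact le_of_eq (by ring)

theorem card_divisors_pow_four_le {R q : ℤ} (hq : 1 ≤ q) (hqR : q ^ 2 ≤ 20 * R ^ 2) (hR : 1 ≤ R)
    (M : ℝ) (hM : ∀ n : ℕ, n ≠ 0 → (n : ℝ) ≤ 2000 * R ^ 6 → (n.divisors.card : ℝ) ≤ M) :
    ((q.toNat ^ 4).divisors.card : ℝ) ≤ M := by
  refine hM _ (pow_ne_zero _ (by omega)) ?_
  have hc : ((q.toNat : ℕ) : ℝ) = q := by exact_mod_cast Int.toNat_of_nonneg (by linarith)
  push_cast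
  rw [hc]
  have : q ^ 4 ≤ 2000 * R ^ 6 := by
    have h1 : R ^ 4 ≤ R ^ 6 := pow_le_pow_right₀ hR (by norm_num)
    have h2 : q ^ 2 * q ^ 2 ≤ (20 * R ^ 2) * (20 * R ^ 2) := by gcongr
    nlinarith
  exact_mod_cast this

theorem card_small_denominator_le {k R : ℤ} (hk : 1 ≤ k) (hR : 1 ≤ R) (M W : ℝ) (hW : 1 ≤ W)
    (hM : ∀ n : ℕ, n ≠ 0 → (n : ℝ) ≤ 2000 * R ^ 6 → (n.divisors.card : ℝ) ≤ M)
    (S : Finset (ℤ × ℤ × ℤ × ℤ × ℤ))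
    (hS : ∀ t ∈ S, t.2.2.2.2 ≤ 2 * k ^ 3 ∧ t.2.2.2.2 ≤ R ∧
      IsPt k t.2.2.2.2 t.1 t.2.1 t.2.2.1 t.2.2.2.1 ∧ |(t.2.2.1 : ℝ)| ≤ W) :
    (S.card : ℝ) ≤ 18 * M * (k ^ 3 * (2 * k ^ 6 + W)) * (1 + Real.log R) := by
  have hk' : (1 : ℝ) ≤ k := by exact_mod_cast hk
  have hk0 : (0 : ℝ) < k := by linarith
  have hR' : (1 : ℝ) ≤ R := by exact_mod_cast hR
  have hM0 : 0 ≤ M := (Nat.cast_nonneg _).trans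
    (hM 1 one_ne_zero (by norm_num; nlinarith [one_le_pow₀ hR' (n := 6)]))
  refine (card_le_sum_last R S (fun t ht => ⟨(hS t ht).2.2.1.q_pos, (hS t ht).2.1⟩)
    (fun q u => q ≤ 2 * k ^ 3 ∧ IsPt k q u.1 u.2.1 u.2.2.1 u.2.2.2 ∧ |(u.2.2.1 : ℝ)| ≤ W)
    (fun t ht => ⟨(hS t ht).1, (hS t ht).2.2⟩)
    (fun q => 18 * M * (k ^ 3 * (2 * k ^ 6 + W)) / q) ?_).trans
      (sum_div_Icc_le (by linarith) (by positivity))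
  intro q hq hqR F hF
  rcases F.eq_empty_or_nonempty with rfl | ⟨u, hu⟩
  · simp only [Finset.card_empty, Nat.cast_zero]
    have : (0 : ℝ) ≤ q := by exact_mod_cast (by linarith : 0 ≤ q)
    positivity
  have hqk : (q : ℝ) ≤ 2 * k ^ 3 := by exact_mod_cast (hF u hu).1
  have hq' : (1 : ℝ) ≤ q := by exact_mod_cast hq
  have hq0 : (0 : ℝ) < q := by linarith
  set V : ℝ := min (k ^ 2 * q ^ 2) W with hV
  have hV1 : 1 ≤ V := le_min (one_le_mul_of_one_le_of_one_le (one_le_pow₀ hk') (one_le_pow₀ hq')) hW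
  have h1 := card_isPt_le k q hk hq V (by linarith) F fun u hu => by
    obtain ⟨-, h1, h2⟩ := hF u hu
    exact ⟨h1, le_min (by exact_mod_cast h1.abs_w) h2⟩
  have hτ := card_divisors_pow_four_le hq (by nlinarith) hR M hM
  have h2 : 4 * (k : ℝ) ^ 3 / q + 1 ≤ 6 * k ^ 3 / q := by
    rw [div_add_one hq0.ne']; gcongr; linarith
  have h3 : V * (2 * k ^ 4 / q ^ 2 + 1) ≤ 2 * k ^ 6 + W := by
    have a1 : V * (2 * k ^ 4 / q ^ 2) ≤ (k ^ 2 * q ^ 2) * (2 * k ^ 4 / q ^ 2) := by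
      gcongr; exact min_le_left _ _
    have a2 : ((k : ℝ) ^ 2 * q ^ 2) * (2 * k ^ 4 / q ^ 2) = 2 * k ^ 6 := by field_simp
    have a3 : V ≤ W := min_le_right _ _
    linarith
  calc (F.card : ℝ) ≤ _ := h1
    _ ≤ (3 * V) * ((M * (6 * k ^ 3 / q)) * (2 * k ^ 4 / q ^ 2 + 1)) := by gcongr; linarith
    _ = 3 * (M * (6 * k ^ 3 / q)) * (V * (2 * k ^ 4 / q ^ 2 + 1)) := by ring
    _ ≤ 3 * (M * (6 * k ^ 3 / q)) * (2 * k ^ 6 + W) := by gcongr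
    _ = _ := by ring

theorem card_isPt_le_of_sq_le {k R : ℤ} (hk : 1 ≤ k) (hR : 1 ≤ R) (M : ℝ)
    (hM : ∀ n : ℕ, n ≠ 0 → (n : ℝ) ≤ 2000 * R ^ 6 → (n.divisors.card : ℝ) ≤ M)
    (S : Finset (ℤ × ℤ × ℤ × ℤ × ℤ))
    (hS : ∀ t ∈ S, k * t.2.2.2.2 ^ 2 ≤ 20 * R ∧ IsPt k t.2.2.2.2 t.1 t.2.1 t.2.2.1 t.2.2.2.1) :
    (S.card : ℝ) ≤ 1500 * M * (k ^ 9 + k ^ 3 * R ^ 2) * (1 + Real.log (20 * R)) := by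
  have hk' : (1 : ℝ) ≤ k := by exact_mod_cast hk
  have hk0 : (0 : ℝ) < k := by linarith
  have hR' : (1 : ℝ) ≤ R := by exact_mod_cast hR
  have hM0 : 0 ≤ M := (Nat.cast_nonneg _).trans
    (hM 1 one_ne_zero (by norm_num; nlinarith [one_le_pow₀ hR' (n := 6)]))
  have hlog := sum_div_Icc_le (N := 20 * R) (by linarith)
    (K := 1500 * M * (k ^ 9 + k ^ 3 * R ^ 2)) (by positivity)
  push_cast at hlog
  refine (card_le_sum_last (20 * R) S (fun t ht => ⟨(hS t ht).2.q_pos, ?_⟩)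
    (fun q u => k * q ^ 2 ≤ 20 * R ∧ IsPt k q u.1 u.2.1 u.2.2.1 u.2.2.2)
    hS (fun q => 1500 * M * (k ^ 9 + k ^ 3 * R ^ 2) / q) ?_).trans hlog
  · have h1 := (hS t ht).1
    have h2 := (hS t ht).2.q_pos
    nlinarith [mul_nonneg (sub_nonneg.mpr hk) (sq_nonneg t.2.2.2.2)]
  intro q hq hqR F hF
  rcases F.eq_empty_or_nonempty with rfl | ⟨u, hu⟩
  · simp only [Finset.card_empty, Nat.cast_zero]
    have : (0 : ℝ) ≤ q := by exact_mod_cast (by linarith : 0 ≤ q)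
    positivity
  have hkq := (hF u hu).1
  have hkq' : (k : ℝ) * q ^ 2 ≤ 20 * R := by exact_mod_cast hkq
  have hq' : (1 : ℝ) ≤ q := by exact_mod_cast hq
  have hq0 : (0 : ℝ) < q := by linarith
  have h1 := card_isPt_le k q hk hq (k ^ 2 * q ^ 2) (by positivity) F fun u hu =>
    ⟨(hF u hu).2, by exact_mod_cast (hF u hu).2.abs_w⟩
  have hτ := card_divisors_pow_four_le hq
    (by nlinarith [mul_nonneg (sub_nonneg.mpr hk) (sq_nonneg q)]) hR M hM
  have hkq1 : 1 ≤ (k : ℝ) ^ 2 * q ^ 2 :=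
    one_le_mul_of_one_le_of_one_le (one_le_pow₀ hk') (one_le_pow₀ hq')
  have b1 : (k : ℝ) ^ 6 * q ≤ k ^ 9 + 20 * (k ^ 3 * R ^ 2) := by
    have a1 : 2 * ((k : ℝ) ^ 6 * q) ≤ k ^ 9 + k ^ 3 * q ^ 2 := by
      nlinarith [mul_nonneg (pow_nonneg hk0.le 3) (sq_nonneg ((k : ℝ) ^ 3 - q))]
    have a2 : (k : ℝ) ^ 2 * (k * q ^ 2) ≤ k ^ 2 * (20 * R) := by gcongr
    have a3 : (k : ℝ) ^ 2 * R ≤ k ^ 3 * R ^ 2 := by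
      exact mul_le_mul (pow_le_pow_right₀ hk' (by norm_num)) (le_self_pow₀ hR' two_ne_zero)
        (by linarith) (by positivity)
    have a4 : (0 : ℝ) ≤ k ^ 6 * q := by positivity
    linarith
  have b2 : (k : ℝ) ^ 5 * q ^ 2 ≤ 10 * k ^ 9 + 10 * (k ^ 3 * R ^ 2) := by
    have a1 : (k : ℝ) ^ 4 * (k * q ^ 2) ≤ k ^ 4 * (20 * R) := by gcongr
    have a2 : 2 * ((k : ℝ) ^ 4 * R) ≤ k ^ 5 + k ^ 3 * R ^ 2 := by
      nlinarith [mul_nonneg (pow_nonneg hk0.le 3) (sq_nonneg ((k : ℝ) - R))]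
    have a3 : (k : ℝ) ^ 5 ≤ k ^ 9 := pow_le_pow_right₀ hk' (by norm_num)
    linarith
  have b3 : (k : ℝ) ^ 2 * q ^ 3 ≤ 400 * (k ^ 3 * R ^ 2) := by
    have a1 : (k * q ^ 2) * (k * q ^ 2) ≤ (20 * R) * (20 * R : ℝ) := by gcongr
    have a2 : (k : ℝ) ^ 2 * q ^ 3 ≤ k ^ 2 * q ^ 4 :=
      mul_le_mul_of_nonneg_left (pow_le_pow_right₀ hq' (by norm_num)) (by positivity)
    have a3 : 1 * (R : ℝ) ^ 2 ≤ k ^ 3 * R ^ 2 := by gcongr; exact one_le_pow₀ hk'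
    linarith
  calc (F.card : ℝ) ≤ _ := h1
    _ ≤ (3 * (k ^ 2 * q ^ 2)) * ((M * (4 * k ^ 3 / q + 1)) * (2 * k ^ 4 / q ^ 2 + 1)) := by
      gcongr; linarith
    _ = 3 * M * (8 * k ^ 9 + 2 * (k ^ 6 * q) + 4 * (k ^ 5 * q ^ 2) + k ^ 2 * q ^ 3) / q := by
      field_simp; ring
    _ ≤ 3 * M * (500 * (k ^ 9 + k ^ 3 * R ^ 2)) / q := by
      gcongr
      have : (0 : ℝ) ≤ k ^ 9 := by positivity
      have : (0 : ℝ) ≤ k ^ 3 * R ^ 2 := by positivity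
      linarith
    _ = _ := by ring

theorem Rat.exists_eq_of_sq_eq_cubic {ξ η : ℚ} {A B : ℤ} (h : η ^ 2 = ξ ^ 3 + A * ξ + B) :
    ∃ w y q : ℤ, 1 ≤ q ∧ IsCoprime w q ∧ ξ = w / q ^ 2 ∧ η = y / q ^ 3 ∧ (ξ.den : ℤ) = q ^ 2 := by
  set d : ℤ := (ξ.den : ℤ) with hd
  set e : ℤ := (η.den : ℤ) with he
  have hd0 : 0 < d := by rw [hd]; exact_mod_cast ξ.den_pos
  have he0 : 0 < e := by rw [he]; exact_mod_cast η.den_pos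
  have hdq : (d : ℚ) ≠ 0 := by exact_mod_cast hd0.ne'
  have heq : (e : ℚ) ≠ 0 := by exact_mod_cast he0.ne'
  have hξ : ξ = ξ.num / d := by rw [hd]; exact_mod_cast (Rat.num_div_den ξ).symm
  have hη : η = η.num / e := by rw [he]; exact_mod_cast (Rat.num_div_den η).symm
  have hcd : IsCoprime ξ.num d := by
    rw [hd, Int.isCoprime_iff_nat_coprime]; simpa using ξ.reduced
  have hce : IsCoprime η.num e := by
    rw [he, Int.isCoprime_iff_nat_coprime]; simpa using η.reduced
  set N : ℤ := ξ.num ^ 3 + A * ξ.num * d ^ 2 + B * d ^ 3 with hN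
  have hmain : η.num ^ 2 * d ^ 3 = N * e ^ 2 := by
    have h' := h
    rw [hξ, hη] at h'
    field_simp at h'
    have : (η.num : ℚ) ^ 2 * d ^ 3 = N * e ^ 2 := by
      rw [hN]; push_cast; linear_combination h'
    exact_mod_cast this
  have hcN : IsCoprime N d := by
    have := (hcd.pow_left (m := 3)).add_mul_right_left (A * ξ.num * d + B * d ^ 2)
    rwa [show ξ.num ^ 3 + (A * ξ.num * d + B * d ^ 2) * d = N by rw [hN]; ring] at this
  have h1 : e ^ 2 ∣ d ^ 3 := (hce.pow (m := 2) (n := 2)).symm.dvd_of_dvd_mul_left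
    ⟨N, by rw [hmain]; ring⟩
  have h2 : d ^ 3 ∣ e ^ 2 := (hcN.pow_right (n := 3)).symm.dvd_of_dvd_mul_left
    ⟨η.num ^ 2, by rw [← hmain]; ring⟩
  have h3 : d ^ 3 = e ^ 2 :=
    le_antisymm (Int.le_of_dvd (by positivity) h2) (Int.le_of_dvd (by positivity) h1)
  obtain ⟨q, hq⟩ : d ∣ e := by
    rw [← Int.pow_dvd_pow_iff two_ne_zero, ← h3]
    exact pow_dvd_pow _ (by norm_num)
  have hdq2 : d = q ^ 2 := by
    apply mul_left_cancel₀ (pow_ne_zero 2 hd0.ne')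
    rw [hq] at h3
    linear_combination h3
  have hq0 : 0 < q := by
    rw [hq] at he0
    exact pos_of_mul_pos_right he0 hd0.le
  have heq3 : e = q ^ 3 := by rw [hq, hdq2]; ring
  refine ⟨ξ.num, η.num, q, hq0, ?_, ?_, ?_, hdq2⟩
  · rw [hdq2] at hcd
    exact (IsCoprime.pow_right_iff two_pos).mp hcd
  · rw [hdq2] at hξ; exact_mod_cast hξ
  · rw [heq3] at hη; exact_mod_cast hη

/-- The line of slope `m` through the point `(w / q ^ 2, y / q ^ 3)` is tangent to the curve
`y ^ 2 = x ^ 3 + A x + B` at the point `(w' / q' ^ 2, y' / q' ^ 3)`. -/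
structure IsTangent (A w y q w' y' q' : ℤ) (m : ℚ) : Prop where
  slope : 2 * m * (y' / q' ^ 3) = 3 * (w' / q' ^ 2) ^ 2 + A
  x_eq : (w / q ^ 2 : ℚ) = m ^ 2 - 2 * (w' / q' ^ 2)
  y_eq : (y / q ^ 3 : ℚ) = y' / q' ^ 3 - m * (w' / q' ^ 2 - w / q ^ 2)

theorem IsPt.exists_isTangent {k q A B w y v z : ℤ} (h : IsPt k q A B w y) (hz : z ≠ 0)
    (hkz : k * z ^ 2 ≤ 2 * q) (hdvd : q ^ 2 ∣ v ^ 2 - w * z ^ 2)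
    (hv : qCoeff₀ (-6 * w) (8 * y) (-(4 * A * q ^ 4 + 3 * w ^ 2)) v z = 0) :
    ∃ w' y' q' m, IsTangent A w y q w' y' q' m ∧ 1 ≤ q' ∧ k * q' ^ 2 ≤ 4 * q ∧
      |w'| ≤ 25 * k ^ 2 * q' ^ 2 ∧ IsCoprime w' q' ∧ |m| ≤ 6 * k ∧
      y' ^ 2 = w' ^ 3 + A * w' * q' ^ 4 + B * q' ^ 6 := by
  have hk := h.k_pos
  have hq := h.q_pos
  have hkq : (1 : ℚ) ≤ k := by exact_mod_cast hk
  have hk0 : (0 : ℚ) < k := by linarith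
  have hqq : (0 : ℚ) < q := by exact_mod_cast (by linarith : 0 < q)
  have hzq : (z : ℚ) ≠ 0 := by exact_mod_cast hz
  set m : ℚ := v / (z * q) with hm
  set x₀ : ℚ := w / q ^ 2 with hx₀
  set y₀ : ℚ := y / q ^ 3 with hy₀
  have hE : y₀ ^ 2 = x₀ ^ 3 + A * x₀ + B := by
    have : (y : ℚ) ^ 2 = w ^ 3 + A * w * q ^ 4 + B * q ^ 6 := by exact_mod_cast h.eqn
    rw [hy₀, hx₀]
    field_simp
    linear_combination this
  have hQ : m ^ 4 - 6 * x₀ * m ^ 2 + 8 * y₀ * m - (4 * A + 3 * x₀ ^ 2) = 0 := by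
    unfold qCoeff₀ at hv
    have : (v : ℚ) ^ 4 + -6 * w * v ^ 2 * z ^ 2 + 8 * y * v * z ^ 3 +
        -(4 * A * q ^ 4 + 3 * w ^ 2) * z ^ 4 = 0 := by exact_mod_cast hv
    rw [hm, hy₀, hx₀]
    field_simp
    linear_combination this
  set ξ : ℚ := (m ^ 2 - x₀) / 2 with hξ
  set η : ℚ := y₀ + m * (ξ - x₀) with hη
  have hcurve : η ^ 2 = ξ ^ 3 + A * ξ + B := by
    rw [hη]
    linear_combination hE + (ξ - x₀) / 4 * hQ + (0 : ℚ) * hξ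
  have hslope : 2 * m * η = 3 * ξ ^ 2 + A := by
    rw [hη, hξ]
    linear_combination 1 / 4 * hQ
  have hxk : |x₀| ≤ k ^ 2 := by
    rw [hx₀, abs_div, abs_of_pos (by positivity : (0 : ℚ) < q ^ 2), div_le_iff₀ (by positivity)]
    exact_mod_cast h.abs_w
  have hyk : |y₀| ≤ 2 * k ^ 3 := by
    rw [hy₀, abs_div, abs_of_pos (by positivity : (0 : ℚ) < q ^ 3), div_le_iff₀ (by positivity),
      abs_of_pos (by exact_mod_cast h.y_pos)]
    exact_mod_cast h.y_le
  have hAk : |(A : ℚ)| ≤ k ^ 4 := by exact_mod_cast h.abs_A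
  have hmk : |m| ≤ 6 * k := by
    by_contra! hlt
    set μ := |m| with hμ
    have hm4 : μ ^ 4 ≤ 6 * k ^ 2 * μ ^ 2 + 8 * (2 * k ^ 3) * μ + (4 * k ^ 4 + 3 * (k ^ 2) ^ 2) := by
      have e : m ^ 4 = 6 * x₀ * m ^ 2 - 8 * y₀ * m + (4 * A + 3 * x₀ ^ 2) := by
        linear_combination hQ
      calc μ ^ 4 = |m ^ 4| := by rw [hμ, abs_pow]
        _ ≤ |6 * x₀ * m ^ 2| + |8 * y₀ * m| + (|4 * (A : ℚ)| + |3 * x₀ ^ 2|) := by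
          rw [e]
          exact (abs_add_le _ _).trans (add_le_add (abs_sub _ _) (abs_add_le _ _))
        _ = 6 * |x₀| * μ ^ 2 + 8 * |y₀| * μ + (4 * |(A : ℚ)| + 3 * |x₀| ^ 2) := by
          simp only [abs_mul, abs_pow, Nat.abs_ofNat, hμ]
        _ ≤ _ := by gcongr
    have c2 : (6 * (k : ℚ)) ^ 2 ≤ μ ^ 2 := by gcongr
    have c3 : (6 * (k : ℚ)) ^ 3 ≤ μ ^ 3 := by gcongr
    have c4 : (6 * (k : ℚ)) ^ 4 ≤ μ ^ 4 := by gcongr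
    have hμ0 : 0 < μ := by linarith
    have d2 : (6 * (k : ℚ)) ^ 2 * μ ^ 2 ≤ μ ^ 2 * μ ^ 2 := by gcongr
    have d3 : (6 * (k : ℚ)) ^ 3 * μ ≤ μ ^ 3 * μ := by gcongr
    have : 0 < μ ^ 4 := by positivity
    nlinarith
  obtain ⟨w', y', q', hq', hc, hξ', hη', hden⟩ := Rat.exists_eq_of_sq_eq_cubic hcurve
  have hq'q : (0 : ℚ) < q' := by exact_mod_cast (by linarith : 0 < q')
  refine ⟨w', y', q', m, ⟨?_, ?_, ?_⟩, hq', ?_, ?_, hc, hmk, ?_⟩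
  · rw [← hξ', ← hη']; exact hslope
  · rw [← hξ', hξ]; ring
  · rw [← hξ', ← hη', hη]; ring
  · obtain ⟨c, hc'⟩ := hdvd
    have e : ξ = ((c : ℤ) : ℚ) / ((2 * z ^ 2 : ℤ) : ℚ) := by
      have : (v : ℚ) ^ 2 - w * z ^ 2 = q ^ 2 * c := by exact_mod_cast hc'
      rw [hξ, hm, hx₀]
      push_cast
      field_simp
      linear_combination this
    have hdvd : (ξ.den : ℤ) ∣ 2 * z ^ 2 := by
      rw [e, ← Rat.divInt_eq_div]
      exact Rat.den_dvd _ _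
    rw [hden] at hdvd
    have hle := Int.le_of_dvd (by positivity) hdvd
    nlinarith
  · have : |ξ| ≤ 25 * k ^ 2 := by
      have c2 : |m| ^ 2 ≤ (6 * k) ^ 2 := by gcongr
      rw [sq_abs] at c2
      rw [abs_le] at hxk ⊢
      constructor <;> nlinarith [sq_nonneg m]
    rw [hξ', abs_div, abs_of_pos (by positivity : (0 : ℚ) < q' ^ 2),
      div_le_iff₀ (by positivity)] at this
    exact_mod_cast this
  · rw [hξ', hη'] at hcurve
    field_simp at hcurve
    have : (y' : ℚ) ^ 2 = w' ^ 3 + A * w' * q' ^ 4 + B * q' ^ 6 := by linear_combination hcurve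
    exact_mod_cast this

theorem IsTangent.injective {k A B w y q w₁ y₁ q₁ w' y' q' : ℤ} {m m₁ : ℚ}
    (h : IsTangent A w y q w' y' q' m) (h₁ : IsTangent A w₁ y₁ q₁ w' y' q' m₁)
    (hp : IsPt k q A B w y) (hp₁ : IsPt k q₁ A B w₁ y₁) (hq' : q' ≠ 0) (hy' : y' ≠ 0) :
    w = w₁ ∧ y = y₁ ∧ q = q₁ := by
  have hη : (y' : ℚ) / q' ^ 3 ≠ 0 :=
    div_ne_zero (by exact_mod_cast hy') (pow_ne_zero _ (by exact_mod_cast hq'))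
  have hm : m = m₁ := by
    apply mul_right_cancel₀ hη
    linear_combination (h.slope - h₁.slope) / 2
  subst hm
  have hq := hp.q_pos
  have hq₁ := hp₁.q_pos
  have hqq : (q : ℚ) ≠ 0 := by exact_mod_cast (by linarith : q ≠ 0)
  have hqq₁ : (q₁ : ℚ) ≠ 0 := by exact_mod_cast (by linarith : q₁ ≠ 0)
  have hx : (w : ℚ) / q ^ 2 = w₁ / q₁ ^ 2 := by rw [h.x_eq, h₁.x_eq]
  have hy : (y : ℚ) / q ^ 3 = y₁ / q₁ ^ 3 := by rw [h.y_eq, h₁.y_eq, hx]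
  rw [div_eq_div_iff (pow_ne_zero _ hqq) (pow_ne_zero _ hqq₁)] at hx hy
  have hx' : w * q₁ ^ 2 = w₁ * q ^ 2 := by exact_mod_cast hx
  have hy' : y * q₁ ^ 3 = y₁ * q ^ 3 := by exact_mod_cast hy
  have d1 : q ^ 2 ∣ q₁ ^ 2 := (hp.coprime.pow_right (n := 2)).symm.dvd_of_dvd_mul_left
    ⟨w₁, by rw [hx']; ring⟩
  have d2 : q₁ ^ 2 ∣ q ^ 2 := (hp₁.coprime.pow_right (n := 2)).symm.dvd_of_dvd_mul_left
    ⟨w, by rw [← hx']; ring⟩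
  rw [Int.pow_dvd_pow_iff two_ne_zero] at d1 d2
  have hqe : q = q₁ :=
    le_antisymm (Int.le_of_dvd (by linarith) d1) (Int.le_of_dvd (by linarith) d2)
  subst hqe
  exact ⟨mul_right_cancel₀ (pow_ne_zero 2 (by linarith)) hx',
    mul_right_cancel₀ (pow_ne_zero 3 (by linarith)) hy', rfl⟩

theorem card_tangent_le_of_sign {k R : ℤ} (hk : 1 ≤ k) (hR : 1 ≤ R) (M : ℝ)
    (hM : ∀ n : ℕ, n ≠ 0 → (n : ℝ) ≤ 2000 * R ^ 6 → (n.divisors.card : ℝ) ≤ M)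
    (s : ℤ) (hs : s ^ 2 = 1) (S : Finset (ℤ × ℤ × ℤ × ℤ × ℤ))
    (hS : ∀ t ∈ S, t.2.2.2.2 ≤ R ∧ IsPt k t.2.2.2.2 t.1 t.2.1 t.2.2.1 t.2.2.2.1 ∧
      ∃ w' y' q' m, IsTangent t.1 t.2.2.1 t.2.2.2.1 t.2.2.2.2 w' y' q' m ∧ 1 ≤ q' ∧
      k * q' ^ 2 ≤ 4 * t.2.2.2.2 ∧ |w'| ≤ 25 * k ^ 2 * q' ^ 2 ∧ IsCoprime w' q' ∧
      y' ^ 2 = w' ^ 3 + t.1 * w' * q' ^ 4 + t.2.1 * q' ^ 6 ∧ 1 ≤ s * y') :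
    (S.card : ℝ) ≤
      3 * 10 ^ 9 * M * (k ^ 9 + k ^ 3 * R ^ 2) * (1 + Real.log (20 * R)) := by
  classical
  have hk' : (1 : ℝ) ≤ k := by exact_mod_cast hk
  have hR' : (1 : ℝ) ≤ R := by exact_mod_cast hR
  have hM0 : 0 ≤ M := (Nat.cast_nonneg _).trans
    (hM 1 one_ne_zero (by norm_num; nlinarith [one_le_pow₀ hR' (n := 6)]))
  have hS' : ∀ t : ℤ × ℤ × ℤ × ℤ × ℤ, ∃ d : ℤ × ℤ × ℤ × ℤ × ℤ, t ∈ S →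
      d.1 = t.1 ∧ d.2.1 = t.2.1 ∧
      IsPt k t.2.2.2.2 t.1 t.2.1 t.2.2.1 t.2.2.2.1 ∧
      (∃ m, IsTangent t.1 t.2.2.1 t.2.2.2.1 t.2.2.2.2 d.2.2.1 (s * d.2.2.2.1) d.2.2.2.2 m) ∧
      (5 * k) * d.2.2.2.2 ^ 2 ≤ 20 * R ∧
      IsPt (5 * k) d.2.2.2.2 d.1 d.2.1 d.2.2.1 d.2.2.2.1 := by
    intro t
    by_cases ht : t ∈ S
    · obtain ⟨hqR, hpt, w', y', q', m, hT, hq', hkq, hw', hc, he, hy'⟩ := hS t ht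
      have hsy : s * (s * y') = y' := by linear_combination y' * hs
      refine ⟨(t.1, t.2.1, w', s * y', q'), fun _ => ⟨rfl, rfl, hpt, ⟨m, ?_⟩, ?_, ?_⟩⟩
      · dsimp only
        rwa [hsy]
      · dsimp only
        linarith
      · refine ⟨by linarith, hq', hy', ?_, ?_, ?_, hc, ?_⟩
        · refine hpt.abs_A.trans ?_
          gcongr; linarith
        · refine hpt.abs_B.trans ?_
          gcongr; linarith
        · exact hw'.trans (le_of_eq (by ring))
        · dsimp only
          linear_combination he + y' ^ 2 * hs
    · exact ⟨0, fun h => absurd h ht⟩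
  choose d hd using hS'
  rw [← Finset.card_image_of_injOn (f := d)]
  · have := card_isPt_le_of_sq_le (by linarith : 1 ≤ 5 * k) hR M hM (S.image d) (by
      simp only [Finset.forall_mem_image]
      exact fun t ht => (hd t ht).2.2.2.2)
    have hlog : 0 ≤ Real.log (20 * R) := Real.log_nonneg (by linarith)
    refine this.trans ?_
    push_cast
    have hc : (5 * (k : ℝ)) ^ 9 + (5 * k) ^ 3 * R ^ 2 ≤ 1953125 * (k ^ 9 + k ^ 3 * R ^ 2) := by
      have : (0 : ℝ) ≤ k ^ 3 * R ^ 2 := by positivity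
      rw [mul_pow, mul_pow]
      linarith
    calc _ ≤ 1500 * M * (1953125 * (k ^ 9 + k ^ 3 * R ^ 2)) * (1 + Real.log (20 * R)) := by gcongr
      _ = 1500 * 1953125 * (M * (k ^ 9 + k ^ 3 * R ^ 2) * (1 + Real.log (20 * R))) := by ring
      _ ≤ 3 * 10 ^ 9 * (M * (k ^ 9 + k ^ 3 * R ^ 2) * (1 + Real.log (20 * R))) :=
        mul_le_mul_of_nonneg_right (by norm_num) (by positivity)
      _ = _ := by ring
  · intro t ht u hu htu
    obtain ⟨hA, hB, p, ⟨m, hT⟩, -, p'⟩ := hd t ht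
    obtain ⟨hA₁, hB₁, p₁, ⟨m₁, hT₁⟩, -, -⟩ := hd u hu
    rw [htu] at hT hA hB p'
    have eA : t.1 = u.1 := hA.symm.trans hA₁
    have eB : t.2.1 = u.2.1 := hB.symm.trans hB₁
    rw [eA] at hT p
    rw [eB] at p
    have hs0 : s ≠ 0 := by rintro rfl; norm_num at hs
    have hq' := p'.q_pos
    have hy' := p'.y_pos
    obtain ⟨e1, e2, e3⟩ := hT.injective hT₁ p p₁ (by linarith) (mul_ne_zero hs0 (by linarith))
    exact Prod.ext eA (Prod.ext eB (Prod.ext e1 (Prod.ext e2 e3)))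

theorem Rat.exists_int_eq_of_sq_eq {r : ℚ} {n : ℤ} (h : r ^ 2 = n) : ∃ t : ℤ, r = t := by
  have h1 : (r ^ 2).den = 1 := by rw [h]; exact Rat.den_intCast n
  rw [Rat.den_pow] at h1
  exact ⟨r.num,
    ((Rat.den_eq_one_iff r).mp ((Nat.pow_eq_one.mp h1).resolve_right (by norm_num))).symm⟩

theorem card_tangent_two_torsion_le {k R : ℤ} (hk : 1 ≤ k) (hR : 1 ≤ R)
    (S : Finset (ℤ × ℤ × ℤ × ℤ × ℤ))
    (hS : ∀ t ∈ S, t.2.2.2.2 ≤ R ∧ IsPt k t.2.2.2.2 t.1 t.2.1 t.2.2.1 t.2.2.2.1 ∧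
      ∃ w' q' m, IsTangent t.1 t.2.2.1 t.2.2.2.1 t.2.2.2.2 w' 0 q' m ∧ 1 ≤ q' ∧
      |w'| ≤ 25 * k ^ 2 * q' ^ 2 ∧ IsCoprime w' q' ∧ |m| ≤ 6 * k ∧
      0 = w' ^ 3 + t.1 * w' * q' ^ 4 + t.2.1 * q' ^ 6) :
    (S.card : ℝ) ≤ 663 * (k ^ 3 * R ^ 2) := by
  classical
  have hS' : ∀ t : ℤ × ℤ × ℤ × ℤ × ℤ, ∃ d : ℤ × ℤ, t ∈ S →
      d ∈ Finset.Icc (-(25 * k ^ 2)) (25 * k ^ 2) ×ˢ Finset.Icc (-(6 * k * R)) (6 * k * R) ∧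
      t.1 = -3 * d.1 ^ 2 ∧ t.2.1 = 2 * d.1 ^ 3 ∧
      t.2.2.1 = d.2 ^ 2 - 2 * d.1 * t.2.2.2.2 ^ 2 ∧
      t.2.2.2.1 = -d.2 * (3 * d.1 * t.2.2.2.2 ^ 2 - d.2 ^ 2) := by
    intro t
    by_cases ht : t ∈ S
    · obtain ⟨hqR, hpt, ξ, q', m, hT, hq', hw', hc, hm, he⟩ := hS t ht
      have hq'1 : q' = 1 := by
        have : q' ∣ ξ ^ 3 := ⟨-t.1 * ξ * q' ^ 3 - t.2.1 * q' ^ 5, by linear_combination -he⟩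
        have hu : IsUnit q' := (hc.symm.pow_right (n := 3)).isUnit_of_dvd' dvd_rfl this
        rcases Int.isUnit_iff.mp hu with h | h
        · exact h
        · linarith
      subst hq'1
      have hq := hpt.q_pos
      have hqq : (0 : ℚ) < t.2.2.2.2 := by exact_mod_cast (by linarith : 0 < t.2.2.2.2)
      have hqRq : (t.2.2.2.2 : ℚ) ≤ R := by exact_mod_cast hqR
      have hkq : (0 : ℚ) ≤ k := by exact_mod_cast (by linarith : 0 ≤ k)
      have s1 := hT.slope
      have s2 := hT.x_eq
      have s3 := hT.y_eq
      simp only [Int.cast_zero, Int.cast_one, one_pow, div_one, mul_zero] at s1 s2 s3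
      have hA : t.1 = -3 * ξ ^ 2 := by
        have : (t.1 : ℚ) = -3 * ξ ^ 2 := by linear_combination -s1
        exact_mod_cast this
      have hB : t.2.1 = 2 * ξ ^ 3 := by
        rw [hA] at he
        linear_combination -he
      obtain ⟨r, hr⟩ := Rat.exists_int_eq_of_sq_eq (r := m * t.2.2.2.2)
        (n := t.2.2.1 + 2 * ξ * t.2.2.2.2 ^ 2) (by
          rw [div_eq_iff (pow_ne_zero _ hqq.ne')] at s2
          push_cast
          linear_combination -s2)
      rw [div_eq_iff (pow_ne_zero _ hqq.ne')] at s2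
      have hw : t.2.2.1 = r ^ 2 - 2 * ξ * t.2.2.2.2 ^ 2 := by
        have : (t.2.2.1 : ℚ) = r ^ 2 - 2 * ξ * t.2.2.2.2 ^ 2 := by
          rw [← hr]; linear_combination s2
        exact_mod_cast this
      have hy : t.2.2.2.1 = -r * (3 * ξ * t.2.2.2.2 ^ 2 - r ^ 2) := by
        have : (t.2.2.2.1 : ℚ) = -r * (3 * ξ * t.2.2.2.2 ^ 2 - r ^ 2) := by
          have hx : (t.2.2.1 : ℚ) / t.2.2.2.2 ^ 2 = m ^ 2 - 2 * ξ := by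
            rw [div_eq_iff (pow_ne_zero _ hqq.ne')]; exact s2
          rw [hx, div_eq_iff (pow_ne_zero _ hqq.ne')] at s3
          rw [← hr, s3]; ring
        exact_mod_cast this
      refine ⟨(ξ, r), fun _ => ⟨?_, hA, hB, hw, hy⟩⟩
      rw [Finset.mem_product, Finset.mem_Icc, Finset.mem_Icc, ← abs_le, ← abs_le]
      refine ⟨by simpa using hw', ?_⟩
      have : |(r : ℚ)| ≤ 6 * k * R := by
        rw [← hr, abs_mul, abs_of_pos hqq]
        gcongr
      exact_mod_cast this
    · exact ⟨0, fun h => absurd h ht⟩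
  choose d hd using hS'
  have hcard : S.card ≤ ((Finset.Icc (-(25 * k ^ 2)) (25 * k ^ 2) ×ˢ
      Finset.Icc (-(6 * k * R)) (6 * k * R)) ×ˢ Finset.Icc 1 R).card := by
    refine Finset.card_le_card_of_injOn (fun t => (d t, t.2.2.2.2)) ?_ ?_
    · intro t ht
      have h := hS t ht
      exact Finset.mem_product.mpr ⟨(hd t ht).1, Finset.mem_Icc.mpr ⟨h.2.1.q_pos, h.1⟩⟩
    · intro t ht u hu htu
      simp only [Prod.mk.injEq] at htu
      obtain ⟨hdt, hq⟩ := htu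
      obtain ⟨-, a1, a2, a3, a4⟩ := hd t ht
      obtain ⟨-, b1, b2, b3, b4⟩ := hd u hu
      rw [hdt] at a1 a2 a3 a4
      rw [hq] at a3 a4
      exact Prod.ext (a1.trans b1.symm) (Prod.ext (a2.trans b2.symm)
        (Prod.ext (a3.trans b3.symm) (Prod.ext (a4.trans b4.symm) hq)))
  have hk2 : 1 ≤ k ^ 2 := one_le_pow₀ hk
  have hkR : 1 ≤ k * R := by nlinarith
  rw [Finset.card_product, Finset.card_product, Int.card_Icc, Int.card_Icc, Int.card_Icc] at hcard
  have hz : (S.card : ℤ) ≤ (51 * k ^ 2) * (13 * (k * R)) * R := by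
    have hcard' : (S.card : ℤ) ≤ ((25 * k ^ 2 + 1 - -(25 * k ^ 2)).toNat : ℤ) *
      ((6 * k * R + 1 - -(6 * k * R)).toNat : ℤ) * ((R + 1 - 1).toNat : ℤ) := by
      exact_mod_cast hcard
    refine hcard'.trans ?_
    rw [Int.toNat_of_nonneg (by nlinarith), Int.toNat_of_nonneg (by nlinarith),
      Int.toNat_of_nonneg (by linarith)]
    gcongr <;> nlinarith
  have : (S.card : ℝ) ≤ (51 * k ^ 2) * (13 * (k * R)) * R := by exact_mod_cast hz
  exact this.trans (le_of_eq (by ring))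

theorem card_isPt_le_of_abs_le {k R : ℤ} (hk : 1 ≤ k) (hR : 1 ≤ R) (M W : ℝ)
    (hRW : (R : ℝ) ^ 2 ≤ W)
    (hM : ∀ n : ℕ, n ≠ 0 → (n : ℝ) ≤ 2000 * R ^ 6 → (n.divisors.card : ℝ) ≤ M)
    (S : Finset (ℤ × ℤ × ℤ × ℤ × ℤ))
    (hS : ∀ t ∈ S, t.2.2.2.2 ≤ R ∧ |(t.2.2.1 : ℝ)| ≤ W ∧
      IsPt k t.2.2.2.2 t.1 t.2.1 t.2.2.1 t.2.2.2.1) :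
    (S.card : ℝ) ≤ 2 * 10 ^ 17 * (M * (1 + Real.log (121 * R)) ^ 2) * (k ^ 9 + k ^ 3 * W) := by
  classical
  have hk0 : (0 : ℝ) < k := by exact_mod_cast (by linarith : 0 < k)
  have hR' : (1 : ℝ) ≤ R := by exact_mod_cast hR
  have hW : 1 ≤ W := (one_le_pow₀ hR').trans hRW
  have hM1 : 1 ≤ M := by
    simpa using hM 1 one_ne_zero (by norm_num; nlinarith [one_le_pow₀ hR' (n := 6)])
  set S₁ := S.filter fun t => t.2.2.2.2 ≤ 2 * k ^ 3
  set S₂ := S.filter fun t => 2 * k ^ 3 < t.2.2.2.2 ∧ ∃ v₁ z₁ v₂ z₂ f₀ f₁ f₂ f₃ f₄,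
    IsFormOf t.2.2.2.2 t.1 t.2.2.1 t.2.2.2.1 v₁ z₁ v₂ z₂ f₀ f₁ f₂ f₃ f₄ ∧
      IsForm k t.2.2.2.2 z₁ z₂ f₀ f₁ f₂ f₃ f₄ ∧ f₀ ≠ 0
  let St : ℤ → Finset (ℤ × ℤ × ℤ × ℤ × ℤ) := fun s => S.filter fun t => ∃ w' y' q' m,
      IsTangent t.1 t.2.2.1 t.2.2.2.1 t.2.2.2.2 w' y' q' m ∧ 1 ≤ q' ∧
      k * q' ^ 2 ≤ 4 * t.2.2.2.2 ∧ |w'| ≤ 25 * k ^ 2 * q' ^ 2 ∧ IsCoprime w' q' ∧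
      y' ^ 2 = w' ^ 3 + t.1 * w' * q' ^ 4 + t.2.1 * q' ^ 6 ∧ 1 ≤ s * y'
  set S₃ := S.filter fun t => ∃ w' q' m, IsTangent t.1 t.2.2.1 t.2.2.2.1 t.2.2.2.2 w' 0 q' m ∧
      1 ≤ q' ∧ |w'| ≤ 25 * k ^ 2 * q' ^ 2 ∧ IsCoprime w' q' ∧ |m| ≤ 6 * k ∧
      0 = w' ^ 3 + t.1 * w' * q' ^ 4 + t.2.1 * q' ^ 6
  have hcover : S ⊆ S₁ ∪ (S₂ ∪ (St 1 ∪ (St (-1) ∪ S₃))) := by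
    intro t ht
    obtain ⟨hqR, hw, hpt⟩ := hS t ht
    simp only [Finset.mem_union, S₁, S₂, S₃, St, Finset.mem_filter, ht, true_and]
    rcases le_or_gt t.2.2.2.2 (2 * k ^ 3) with hq | hq
    · exact Or.inl hq
    refine Or.inr ?_
    obtain ⟨v₁, z₁, v₂, z₂, f₀, f₁, f₂, f₃, f₄, hF, hf, hd⟩ := hpt.exists_isForm hq
    by_cases hf₀ : f₀ = 0
    · subst hf₀
      have h₀ := hF.h₀
      rw [mul_zero] at h₀
      obtain ⟨w', y', q', m, hT, h1, h2, h3, h4, h5, h6⟩ :=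
        hpt.exists_isTangent hf.z₁_ne hf.z₁_sq hd h₀.symm
      refine Or.inr ?_
      rcases lt_trichotomy y' 0 with hy | rfl | hy
      · exact Or.inr (Or.inl ⟨w', y', q', m, hT, h1, h2, h3, h4, h6, by linarith⟩)
      · exact Or.inr (Or.inr ⟨w', q', m, hT, h1, h3, h4, h5, by linear_combination h6⟩)
      · exact Or.inl ⟨w', y', q', m, hT, h1, h2, h3, h4, h6, by linarith⟩
    · exact Or.inl ⟨hq, v₁, z₁, v₂, z₂, f₀, f₁, f₂, f₃, f₄, hF, hf, hf₀⟩
  have hsum : (S.card : ℝ) ≤ S₁.card + (S₂.card + ((St 1).card + ((St (-1)).card + S₃.card))) := by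
    have h := Finset.card_le_card hcover
    have h1 := Finset.card_union_le S₁ (S₂ ∪ (St 1 ∪ (St (-1) ∪ S₃)))
    have h2 := Finset.card_union_le S₂ (St 1 ∪ (St (-1) ∪ S₃))
    have h3 := Finset.card_union_le (St 1) (St (-1) ∪ S₃)
    have h4 := Finset.card_union_le (St (-1)) S₃
    exact_mod_cast (by omega : S.card ≤
      S₁.card + (S₂.card + ((St 1).card + ((St (-1)).card + S₃.card))))
  have c1 := card_small_denominator_le hk hR M W hW hM S₁ fun t ht => by
    obtain ⟨ht, h⟩ := Finset.mem_filter.mp ht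
    exact ⟨h, (hS t ht).1, (hS t ht).2.2, (hS t ht).2.1⟩
  have c2 := card_nondegenerate_le hk hR M hM S₂ fun t ht => by
    obtain ⟨ht, h⟩ := Finset.mem_filter.mp ht
    exact ⟨h.1, (hS t ht).1, (hS t ht).2.2, h.2⟩
  have c3 := card_tangent_le_of_sign hk hR M hM 1 (by norm_num) (St 1) fun t ht => by
    obtain ⟨ht, h⟩ := Finset.mem_filter.mp ht
    exact ⟨(hS t ht).1, (hS t ht).2.2, h⟩
  have c4 := card_tangent_le_of_sign hk hR M hM (-1) (by norm_num) (St (-1)) fun t ht => by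
    obtain ⟨ht, h⟩ := Finset.mem_filter.mp ht
    exact ⟨(hS t ht).1, (hS t ht).2.2, h⟩
  have c5 := card_tangent_two_torsion_le hk hR S₃ fun t ht => by
    obtain ⟨ht, h⟩ := Finset.mem_filter.mp ht
    exact ⟨(hS t ht).1, (hS t ht).2.2, h⟩
  set L := 1 + Real.log (121 * R) with hL
  have hlog : ∀ a : ℝ, 1 ≤ a → a ≤ 121 → 1 + Real.log (a * R) ≤ L := fun a ha ha' => by
    have : Real.log (a * R) ≤ Real.log (121 * R) :=
      Real.log_le_log (by positivity) (by gcongr)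
    linarith
  have hL1 : 1 ≤ L := by
    have := Real.log_nonneg (by linarith : (1 : ℝ) ≤ 121 * R)
    linarith
  have hLL : L ≤ L ^ 2 := le_self_pow₀ hL1 two_ne_zero
  have l1 := hlog 1 le_rfl (by norm_num)
  rw [one_mul] at l1
  have l2 := (hlog 20 (by norm_num) (by norm_num)).trans hLL
  replace l1 := l1.trans hLL
  set E := (k : ℝ) ^ 9 + k ^ 3 * W with hE
  have hk9 : (0 : ℝ) ≤ k ^ 9 := by positivity
  have hkW : (0 : ℝ) ≤ k ^ 3 * W := by positivity
  have hE0 : 0 ≤ E := by positivity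
  have hkR : (k : ℝ) ^ 3 * R ^ 2 ≤ k ^ 3 * W := by gcongr
  have hkRE : (k : ℝ) ^ 3 * R ^ 2 ≤ E := by linarith
  have hML : 1 ≤ M * L ^ 2 := one_le_mul_of_one_le_of_one_le hM1 (hL1.trans hLL)
  have d1 : (S₁.card : ℝ) ≤ 36 * (M * L ^ 2 * E) := by
    have h : (k : ℝ) ^ 3 * (2 * k ^ 6 + W) ≤ 2 * E := by
      rw [hE]
      linarith [(by ring : (k : ℝ) ^ 3 * (2 * k ^ 6 + W) = 2 * k ^ 9 + k ^ 3 * W)]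
    calc (S₁.card : ℝ) ≤ _ := c1
      _ ≤ 18 * M * (2 * E) * L ^ 2 :=
        mul_le_mul (mul_le_mul_of_nonneg_left h (by positivity)) l1
          (by linarith [Real.log_nonneg hR']) (by positivity)
      _ = _ := by ring
  have d2 : (S₂.card : ℝ) ≤ 10 ^ 17 * (M * L ^ 2 * E) := by
    calc (S₂.card : ℝ) ≤ _ := c2
      _ ≤ 10 ^ 17 * M * L ^ 2 * E := by gcongr
      _ = _ := by ring
  have d3 : ∀ c : ℝ, c ≤ 3 * 10 ^ 9 * M * (k ^ 9 + k ^ 3 * R ^ 2) * (1 + Real.log (20 * R)) →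
      c ≤ 3 * 10 ^ 9 * (M * L ^ 2 * E) := by
    intro c hc
    calc c ≤ _ := hc
      _ ≤ 3 * 10 ^ 9 * M * E * L ^ 2 :=
        mul_le_mul (mul_le_mul_of_nonneg_left (by linarith) (by positivity)) l2
          (by linarith [Real.log_nonneg (by linarith : (1 : ℝ) ≤ 20 * R)]) (by positivity)
      _ = _ := by ring
  have d5 : (S₃.card : ℝ) ≤ 663 * (M * L ^ 2 * E) := by
    refine c5.trans ?_
    have : 1 * E ≤ M * L ^ 2 * E := by gcongr
    linarith
  have hfin : 0 ≤ M * L ^ 2 * E := by positivity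
  have e3 := d3 _ c3
  have e4 := d3 _ c4
  calc (S.card : ℝ) ≤ _ := hsum
    _ ≤ 2 * 10 ^ 17 * (M * L ^ 2 * E) := by linarith
    _ = _ := by ring

theorem Nat.card_subtype_le_of_forall_finset {α : Type*} {p : α → Prop} {N : ℝ}
    (h : ∀ S : Finset α, (∀ a ∈ S, p a) → (S.card : ℝ) ≤ N) : (Nat.card {a // p a} : ℝ) ≤ N := by
  rcases finite_or_infinite {a // p a} with hf | hf
  · have := Fintype.ofFinite {a // p a}
    rw [Nat.card_eq_fintype_card, ← Finset.card_univ,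
      ← Finset.card_map (Function.Embedding.subtype p)]
    refine h _ fun a ha => ?_
    obtain ⟨b, -, rfl⟩ := Finset.mem_map.mp ha
    exact b.2
  · rw [Nat.card_eq_zero_of_infinite]
    simpa using h ∅ (by simp)

theorem one_add_log_sq_le {ε a Z : ℝ} (hε : 0 < ε) (ha : 0 ≤ a) (hZ : 1 ≤ Z) (x : ℝ) (hx : 1 ≤ x)
    (hxZ : x ≤ a * Z ^ 2) :
    (1 + Real.log x) ^ 2 ≤ (1 + a ^ (ε / 4) / (ε / 4)) ^ 2 * Z ^ ε := by
  have hZ0 : 0 ≤ Z := by linarith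
  have h1 : Real.log x ≤ (a ^ (ε / 4) / (ε / 4)) * Z ^ (ε / 2) := by
    calc Real.log x ≤ x ^ (ε / 4) / (ε / 4) := Real.log_le_rpow_div (by linarith) (by positivity)
      _ ≤ (a * Z ^ 2) ^ (ε / 4) / (ε / 4) := by gcongr
      _ = _ := by
        rw [Real.mul_rpow ha (by positivity), ← Real.rpow_natCast, ← Real.rpow_mul hZ0,
          show ((2 : ℕ) : ℝ) * (ε / 4) = ε / 2 by push_cast; ring]
        ring
  have h2 : 1 ≤ Z ^ (ε / 2) := Real.one_le_rpow hZ (by positivity)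
  have h3 : 0 ≤ Real.log x := Real.log_nonneg hx
  calc (1 + Real.log x) ^ 2
      ≤ (Z ^ (ε / 2) + (a ^ (ε / 4) / (ε / 4)) * Z ^ (ε / 2)) ^ 2 := by gcongr
    _ = (1 + a ^ (ε / 4) / (ε / 4)) ^ 2 * (Z ^ (ε / 2)) ^ 2 := by ring
    _ = _ := by
      rw [← Real.rpow_natCast (Z ^ (ε / 2)), ← Real.rpow_mul hZ0]
      congr 2
      push_cast
      ring

theorem Int.abs_le_pow_of_pow_abs_le {n k : ℤ} (hk : 0 ≤ k) (m : ℕ) (hm : m ≠ 0) (j : ℕ)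
    (h : |(n : ℝ)| ^ m ≤ (k : ℝ) ^ (j * m)) : |n| ≤ k ^ j := by
  rw [pow_mul] at h
  have h' : |n| ^ m ≤ (k ^ j) ^ m := by exact_mod_cast h
  exact le_of_pow_le_pow_left₀ hm (by positivity) h'

theorem isPt_of_mem_Sset2 {c₀ δ X T : ℝ} {k : ℤ} (hX : 1 ≤ X) (hk : 1 ≤ k)
    (hXk : X ^ ((1 : ℝ) / 12) ≤ k) {t : ℤ × ℤ × ℤ × ℤ × ℤ} (ht : t ∈ Sset2 c₀ δ X T) :
    IsPt k t.2.2.2.2 t.1 t.2.1 t.2.2.1 t.2.2.2.1 := by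
  obtain ⟨hS, hS1⟩ := ht
  have hw : ¬ X ^ ((1 : ℝ) / 6) * (t.2.2.2.2 : ℝ) ^ 2 < (|t.2.2.1| : ℝ) := fun h => hS1 ⟨hS, h⟩
  obtain ⟨hy, hq, heqn, hA, hB, -, -, hgcd⟩ := hS
  have hX0 : (0 : ℝ) ≤ X := by linarith
  have hr0 : 0 ≤ X ^ ((1 : ℝ) / 12) := by positivity
  have hX12 : X ≤ (k : ℝ) ^ 12 := by
    calc X = (X ^ ((1 : ℝ) / 12)) ^ 12 := by
          rw [← Real.rpow_natCast, ← Real.rpow_mul hX0]; norm_num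
      _ ≤ _ := by gcongr
  have hX6 : X ^ ((1 : ℝ) / 6) ≤ (k : ℝ) ^ 2 := by
    calc X ^ ((1 : ℝ) / 6) = (X ^ ((1 : ℝ) / 12)) ^ 2 := by
          rw [← Real.rpow_natCast, ← Real.rpow_mul hX0]; norm_num
      _ ≤ _ := by gcongr
  refine ⟨hk, hq, hy, ?_, ?_, ?_, Int.isCoprime_iff_gcd_eq_one.mpr hgcd, heqn⟩
  · refine Int.abs_le_pow_of_pow_abs_le (by linarith) 3 (by norm_num) 4 ?_
    have : 0 ≤ |(t.1 : ℝ)| ^ 3 := by positivity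
    push_cast at hA
    norm_num
    linarith
  · refine Int.abs_le_pow_of_pow_abs_le (by linarith) 2 (by norm_num) 6 ?_
    rw [sq_abs]
    have : 0 ≤ (t.2.1 : ℝ) ^ 2 := by positivity
    norm_num
    linarith
  · have h : |(t.2.2.1 : ℝ)| ≤ (k : ℝ) ^ 2 * (t.2.2.2.2 : ℝ) ^ 2 :=
      (not_lt.mp hw).trans (by gcongr)
    exact_mod_cast h

/-- `#𝒮^{(2)}(X,T) ≪ (XT)^ε (X^{3/4} + X^{1/4 + δ} T²)` for fixed `δ ∈ (0, 1)`, `ε > 0` and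
`c₀ > 0`. -/
theorem Sset2_count (δ ε c₀ : ℝ) (hδ : δ ∈ Set.Ioo (0 : ℝ) 1) (hε : 0 < ε) (hc₀ : 0 < c₀) :
    ∃ C : ℝ, 0 < C ∧ ∀ X T : ℝ, 1 ≤ X → 1 ≤ T →
      (Nat.card {t : ℤ × ℤ × ℤ × ℤ × ℤ // t ∈ Sset2 c₀ δ X T} : ℝ) ≤
        C * (X * T) ^ ε * (X ^ ((3 : ℝ) / 4) + X ^ (1 / 4 + δ) * T ^ 2) := by
  obtain ⟨D, hD, hdiv⟩ := exists_card_divisors_le_rpow (ε / 12) (by positivity)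
  set b := 1 + c₀ with hb
  have hb1 : 1 ≤ b := by linarith
  set CM := D * (2000 * b ^ 3) ^ (ε / 12) with hCM
  set CL := (1 + (121 * b) ^ (ε / 2 / 4) / (ε / 2 / 4)) ^ 2 with hCL
  refine ⟨2 * 10 ^ 17 * (CM * CL) * (512 * b), by positivity, fun X T hX hT => ?_⟩
  have hX0 : (0 : ℝ) < X := by linarith
  have hT0 : (0 : ℝ) < T := by linarith
  set Z := X * T with hZ
  have hZ1 : 1 ≤ Z := one_le_mul_of_one_le_of_one_le hX hT
  have hXδ1 : 1 ≤ X ^ δ := Real.one_le_rpow hX hδ.1.le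
  have hXδ : X ^ δ ≤ X := by
    simpa using Real.rpow_le_rpow_of_exponent_le hX hδ.2.le
  set W := b * T ^ 2 * X ^ δ with hW
  have hT2 : 1 ≤ T ^ 2 := one_le_pow₀ hT
  have hW1 : 1 ≤ W := one_le_mul_of_one_le_of_one_le (one_le_mul_of_one_le_of_one_le hb1 hT2) hXδ1
  have hWZ : W ≤ b * Z ^ 2 := by
    calc W ≤ b * T ^ 2 * X ^ 2 := by
          rw [hW]
          gcongr
          exact hXδ.trans (le_self_pow₀ hX two_ne_zero)
      _ = _ := by rw [hZ]; ring
  have hcW : c₀ * T ^ 2 * X ^ δ ≤ W := by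
    rw [hW]
    gcongr
    linarith
  set R : ℤ := ⌊√W⌋ with hR
  have hR1 : 1 ≤ R := Int.le_floor.mpr (by simpa using hW1)
  have hR1' : (1 : ℝ) ≤ R := by exact_mod_cast hR1
  have hRW : (R : ℝ) ^ 2 ≤ W := by
    calc (R : ℝ) ^ 2 ≤ √W ^ 2 := by
          gcongr
          exact Int.floor_le _
      _ = W := Real.sq_sqrt (by linarith)
  set k : ℤ := ⌈X ^ ((1 : ℝ) / 12)⌉ with hk
  have hr1 : 1 ≤ X ^ ((1 : ℝ) / 12) := Real.one_le_rpow hX (by norm_num)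
  have hXk : X ^ ((1 : ℝ) / 12) ≤ k := Int.le_ceil _
  have hk1 : 1 ≤ k := by exact_mod_cast hr1.trans hXk
  have hk0 : (0 : ℝ) ≤ k := by exact_mod_cast zero_le_one.trans hk1
  have hkX : (k : ℝ) ≤ 2 * X ^ ((1 : ℝ) / 12) := by
    linarith [Int.ceil_lt_add_one (X ^ ((1 : ℝ) / 12))]
  have hk9 : (k : ℝ) ^ 9 ≤ 512 * X ^ ((3 : ℝ) / 4) := by
    calc (k : ℝ) ^ 9 ≤ (2 * X ^ ((1 : ℝ) / 12)) ^ 9 := by gcongr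
      _ = 512 * (X ^ ((1 : ℝ) / 12)) ^ 9 := by ring
      _ = _ := by rw [← Real.rpow_natCast, ← Real.rpow_mul hX0.le]; norm_num
  have hk3 : (k : ℝ) ^ 3 ≤ 8 * X ^ ((1 : ℝ) / 4) := by
    calc (k : ℝ) ^ 3 ≤ (2 * X ^ ((1 : ℝ) / 12)) ^ 3 := by gcongr
      _ = 8 * (X ^ ((1 : ℝ) / 12)) ^ 3 := by ring
      _ = _ := by rw [← Real.rpow_natCast, ← Real.rpow_mul hX0.le]; norm_num
  have hmain : (k : ℝ) ^ 9 + k ^ 3 * W ≤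
      512 * b * (X ^ ((3 : ℝ) / 4) + X ^ (1 / 4 + δ) * T ^ 2) := by
    have h1 : (k : ℝ) ^ 3 * W ≤ 512 * b * (X ^ (1 / 4 + δ) * T ^ 2) := by
      calc (k : ℝ) ^ 3 * W ≤ 8 * X ^ ((1 : ℝ) / 4) * W := by gcongr
        _ = 8 * b * (X ^ (1 / 4 + δ) * T ^ 2) := by rw [hW, Real.rpow_add hX0]; ring
        _ ≤ _ := by gcongr; norm_num
    have h2 : (k : ℝ) ^ 9 ≤ 512 * b * X ^ ((3 : ℝ) / 4) := by
      refine hk9.trans ?_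
      gcongr
      linarith
    linarith
  have hM : ∀ n : ℕ, n ≠ 0 → (n : ℝ) ≤ 2000 * R ^ 6 →
      (n.divisors.card : ℝ) ≤ CM * Z ^ (ε / 2) := by
    intro n hn hnR
    have h : (n : ℝ) ≤ 2000 * b ^ 3 * Z ^ 6 := by
      calc (n : ℝ) ≤ 2000 * ((R : ℝ) ^ 2) ^ 3 := hnR.trans_eq (by ring)
        _ ≤ 2000 * (b * Z ^ 2) ^ 3 := by
          gcongr
          exact hRW.trans hWZ
        _ = _ := by ring
    calc (n.divisors.card : ℝ) ≤ D * (n : ℝ) ^ (ε / 12) := hdiv n hn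
      _ ≤ D * (2000 * b ^ 3 * Z ^ 6) ^ (ε / 12) := by gcongr
      _ = _ := by
        rw [Real.mul_rpow (by positivity) (by positivity), ← Real.rpow_natCast Z,
          ← Real.rpow_mul (by positivity),
          show ((6 : ℕ) : ℝ) * (ε / 12) = ε / 2 by push_cast; ring, hCM]
        ring
  have hL : (1 + Real.log (121 * R)) ^ 2 ≤ CL * Z ^ (ε / 2) := by
    refine one_add_log_sq_le (by positivity) (by positivity) hZ1 _ (by linarith) ?_
    have : (R : ℝ) ≤ b * Z ^ 2 := (le_self_pow₀ hR1' two_ne_zero).trans (hRW.trans hWZ)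
    linarith
  have hcount : (Nat.card {t : ℤ × ℤ × ℤ × ℤ × ℤ // t ∈ Sset2 c₀ δ X T} : ℝ) ≤
      2 * 10 ^ 17 * (CM * Z ^ (ε / 2) * (1 + Real.log (121 * R)) ^ 2) * (k ^ 9 + k ^ 3 * W) := by
    refine Nat.card_subtype_le_of_forall_finset fun S hS =>
      card_isPt_le_of_abs_le hk1 hR1 _ W hRW hM S fun t ht => ⟨?_, ?_,
        isPt_of_mem_Sset2 hX hk1 hXk (hS t ht)⟩
    · exact Int.le_floor.mpr (Real.le_sqrt_of_sq_le ((hS t ht).1.2.2.2.2.2.2.1.trans hcW))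
    · exact (hS t ht).1.2.2.2.2.2.1.trans hcW
  calc _ ≤ _ := hcount
    _ ≤ 2 * 10 ^ 17 * (CM * Z ^ (ε / 2) * (CL * Z ^ (ε / 2))) *
        (512 * b * (X ^ ((3 : ℝ) / 4) + X ^ (1 / 4 + δ) * T ^ 2)) := by
      gcongr
    _ = 2 * 10 ^ 17 * (CM * CL) * (512 * b) * (Z ^ (ε / 2) * Z ^ (ε / 2)) *
        (X ^ ((3 : ℝ) / 4) + X ^ (1 / 4 + δ) * T ^ 2) := by ring
    _ = _ := by rw [← Real.rpow_add (by positivity), add_halves]
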